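/- arXiv:0807.1141 — 2 statements merged into one kernel-verified Lean document; each statement's English description precedes it below -/
import Mathlib

section
/- If a countable undistorted group G endowed with a proper left-invariant metric is coarsely equivalent to a countable abelian group A endowed with a proper left-invariant metric, then G is locally abelian-by-finite. -/
/-- A map between metric spaces is bornologous. -/
def Bornologous {X Y : Type*} [MetricSpace X] [MetricSpace Y] (f : X → Y) : Prop :=
  ∀ δ : ℝ, 0 ≤ δ → ∃ ε : ℝ, 0 ≤ ε ∧ ∀ x x' : X, dist x x' ≤ δ → dist (f x) (f x') ≤ ε

/-- Two metric spaces are coarsely equivalent. -/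
def CoarseEquiv (X Y : Type*) [MetricSpace X] [MetricSpace Y] : Prop :=
  ∃ (f : X → Y) (g : Y → X) (K : ℝ), 0 ≤ K ∧ Bornologous f ∧ Bornologous g ∧
    (∀ x : X, dist (g (f x)) x ≤ K) ∧ (∀ y : Y, dist (f (g y)) y ≤ K)

/-- The word metric on a group with respect to a set `S` of generators:
`wordDist S x y` is the least `n` such that `x⁻¹ * y` is a product of `n` elements
of `S`. -/
noncomputable def wordDist {K : Type*} [Group K] (S : Set K) (x y : K) : ℕ :=
  sInf {n : ℕ | ∃ l : List K, (∀ a ∈ l, a ∈ S) ∧ l.length = n ∧ l.prod = x⁻¹ * y}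

/-- `S` is a finite symmetric generating set of the group `K`. -/
def IsWordGenSet {K : Type*} [Group K] (S : Finset K) : Prop :=
  (∀ a ∈ S, a⁻¹ ∈ S) ∧ Subgroup.closure (S : Set K) = ⊤

/-- A finitely generated subgroup `H` of a finitely generated group `K` is undistorted
in `K`: the inclusion `H → K` is a quasi-isometric embedding with respect to (any)
word metrics. -/
def UndistortedIn {G : Type*} [Group G] (H K : Subgroup G) : Prop :=
  ∀ hHK : H ≤ K, ∀ S : Finset H, ∀ T : Finset K, IsWordGenSet S → IsWordGenSet T →
    ∃ L C : ℝ, 1 ≤ L ∧ 0 ≤ C ∧ ∀ x y : H,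
      L⁻¹ * (wordDist (S : Set H) x y : ℝ) - C ≤
        (wordDist (T : Set K) (Subgroup.inclusion hHK x) (Subgroup.inclusion hHK y) : ℝ) ∧
      (wordDist (T : Set K) (Subgroup.inclusion hHK x) (Subgroup.inclusion hHK y) : ℝ) ≤
        L * (wordDist (S : Set H) x y : ℝ) + C

/-- A countable group is undistorted: it is the union of a non-decreasing sequence of
finitely generated subgroups, each undistorted in the next one. -/
def Undistorted (G : Type*) [Group G] : Prop :=
  ∃ Gs : ℕ → Subgroup G, (∀ n, Gs n ≤ Gs (n + 1)) ∧ (∀ n, Group.FG (Gs n)) ∧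
    (∀ x : G, ∃ n, x ∈ Gs n) ∧ (∀ n, UndistortedIn (Gs n) (Gs (n + 1)))

/-- A group is abelian-by-finite: it has an abelian normal subgroup with finite quotient. -/
def AbelianByFinite (G : Type*) [Group G] : Prop :=
  ∃ N : Subgroup G, N.Normal ∧ (∀ a b : G, a ∈ N → b ∈ N → a * b = b * a) ∧ Finite (G ⧸ N)


/-- Abstract word length function. -/
structure WLen {Γ : Type} [Group Γ] (S : Finset Γ) (ℓ : Γ → ℕ) : Prop where
  symm : ∀ s ∈ S, s⁻¹ ∈ S
  one : ℓ 1 = 0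
  inv : ∀ g, ℓ g⁻¹ = ℓ g
  mul : ∀ g h, ℓ (g * h) ≤ ℓ g + ℓ h
  gen : ∀ s ∈ S, ℓ s ≤ 1
  eq_one : ∀ g, ℓ g = 0 → g = 1
  succ : ∀ g n, ℓ g = n + 1 → ∃ h s, s ∈ S ∧ ℓ h = n ∧ g = h * s

namespace WLen
variable {Γ : Type} [Group Γ] {S : Finset Γ} {ℓ : Γ → ℕ}

theorem finite (h : WLen S ℓ) : ∀ n, {g | ℓ g ≤ n}.Finite := by
  classical
  intro n
  induction n with
  | zero =>
    apply (Set.finite_singleton (1 : Γ)).subset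
    intro g hg
    exact h.eq_one g (Nat.le_zero.mp hg)
  | succ n ih =>
    apply (ih.union (Set.Finite.image2 (fun a b : Γ => a * b) ih S.finite_toSet)).subset
    intro g hg
    rcases Nat.lt_or_ge (ℓ g) (n+1) with h1 | h1
    · left; exact Nat.lt_succ_iff.mp h1
    · right
      obtain ⟨k, s, hs, hk, rfl⟩ := h.succ g n (le_antisymm hg h1)
      exact ⟨k, hk.le, s, hs, rfl⟩

/-- ball -/
noncomputable def ball (h : WLen S ℓ) (a : Γ) (n : ℕ) : Finset Γ :=
  (h.finite n).toFinset.map ⟨fun x => a * x, mul_right_injective a⟩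

theorem mem_ball (h : WLen S ℓ) {a x : Γ} {n : ℕ} : x ∈ h.ball a n ↔ ℓ (a⁻¹ * x) ≤ n := by
  simp only [ball, Finset.mem_map, Set.Finite.mem_toFinset, Set.mem_ofPred_eq,
    Function.Embedding.coeFn_mk]
  constructor
  · rintro ⟨y, hy, rfl⟩; simpa using hy
  · intro hx; exact ⟨_, hx, by simp⟩

theorem mem_ball_one (h : WLen S ℓ) {x : Γ} {n : ℕ} : x ∈ h.ball 1 n ↔ ℓ x ≤ n := by
  simp [mem_ball]

theorem card_ball (h : WLen S ℓ) (a : Γ) (n : ℕ) : (h.ball a n).card = (h.ball 1 n).card := by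
  simp [ball]

theorem symm_dist (h : WLen S ℓ) (x y : Γ) : ℓ (x⁻¹ * y) = ℓ (y⁻¹ * x) := by
  rw [← h.inv]; simp

theorem tri (h : WLen S ℓ) (x y z : Γ) : ℓ (x⁻¹ * z) ≤ ℓ (x⁻¹ * y) + ℓ (y⁻¹ * z) := by
  have := h.mul (x⁻¹ * y) (y⁻¹ * z)
  simpa [mul_assoc] using this

theorem ball_pos (h : WLen S ℓ) (a : Γ) (n : ℕ) : 0 < (h.ball a n).card :=
  Finset.card_pos.mpr ⟨a, by simp [h.mem_ball, h.one]⟩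

theorem ball_mono (h : WLen S ℓ) (a : Γ) {m n : ℕ} (hmn : m ≤ n) : h.ball a m ⊆ h.ball a n := by
  intro x hx; rw [mem_ball] at *; omega

theorem exists_cover (h : WLen S ℓ) (a : Γ) (n r : ℕ) : ∃ F : Finset Γ, F ⊆ h.ball a n ∧
    (∀ x ∈ F, ∀ y ∈ F, x ≠ y → r < ℓ (x⁻¹ * y)) ∧ ∀ x ∈ h.ball a n, ∃ c ∈ F, x ∈ h.ball c r := by
  classical
  let P : Finset (Finset Γ) := (h.ball a n).powerset.filter
    (fun F => ∀ x ∈ F, ∀ y ∈ F, x ≠ y → r < ℓ (x⁻¹ * y))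
  have hP : P.Nonempty := ⟨∅, by simp [P]⟩
  obtain ⟨F, hF, hmax⟩ := Finset.exists_max_image P Finset.card hP
  simp only [P, Finset.mem_filter, Finset.mem_powerset] at hF hmax
  refine ⟨F, hF.1, hF.2, ?_⟩
  intro x hx
  by_contra hcon
  push Not at hcon
  simp only [h.mem_ball, not_le] at hcon
  have hxF : x ∉ F := fun hxF => by
    have := hcon x hxF
    simp [h.one] at this
  have := hmax (insert x F) ⟨by
    intro y hy
    rcases Finset.mem_insert.mp hy with rfl | hy
    · exact hx
    · exact hF.1 hy, by
    intro y hy z hz hyz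
    rcases Finset.mem_insert.mp hy with hy | hy <;> rcases Finset.mem_insert.mp hz with hz | hz
    · exact absurd (hy.trans hz.symm) hyz
    · rw [hy, h.symm_dist]; exact hcon z hz
    · rw [hz]; exact hcon y hy
    · exact hF.2 y hy z hz hyz⟩
  rw [Finset.card_insert_of_notMem hxF] at this
  omega

end WLen

/-- Packing (large scale doubling). -/
def Packing {Γ : Type} [Group Γ] (ℓ : Γ → ℕ) (r0 : ℕ) (N : ℕ → ℕ) : Prop :=
  ∀ k r : ℕ, r0 ≤ r → ∀ (a : Γ) (F : Finset Γ), (∀ x ∈ F, ℓ (a⁻¹ * x) ≤ k * r) →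
    (∀ x ∈ F, ∀ y ∈ F, x ≠ y → r < ℓ (x⁻¹ * y)) → F.card ≤ N k

theorem packing_of_embedding {Γ : Type} [Group Γ] {ℓ : Γ → ℕ} {d : ℕ}
    (f : Γ → EuclideanSpace ℝ (Fin d)) (c C L : ℝ) (hc : 0 < c) (hL : 0 ≤ L)
    (hlow : ∀ x y, c * ℓ (x⁻¹ * y) - C ≤ ‖f x - f y‖)
    (hup : ∀ x y, ‖f x - f y‖ ≤ L * ℓ (x⁻¹ * y)) :
    ∃ r0 N, 1 ≤ r0 ∧ Packing ℓ r0 N := by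
  classical
  obtain ⟨r0, hr0⟩ := exists_nat_ge (2 * C / c)
  set η : ℝ := c / (2 * (d + 1)) with hη
  have hη0 : 0 < η := by positivity
  refine ⟨r0 + 1, fun k => (2 * (⌈L * k / η⌉₊ + 1) + 1) ^ d, by omega, ?_⟩
  intro k r hr a F hF hsep
  have hr1 : (1 : ℝ) ≤ r := by exact_mod_cast (by omega : 1 ≤ r)
  have hrr : 2 * C ≤ c * r := by
    have : (r0 : ℝ) ≤ r := by exact_mod_cast (by omega : r0 ≤ r)
    rw [div_le_iff₀ hc] at hr0
    nlinarith
  set M : ℕ := ⌈L * k / η⌉₊ + 1 with hM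
  let φ : Γ → (Fin d → ℤ) := fun x i => ⌊(f x i - f a i) / (η * r)⌋
  have hmaps : ∀ x ∈ F, φ x ∈ Fintype.piFinset (fun _ : Fin d => Finset.Icc (-(M : ℤ)) M) := by
    intro x hx
    rw [Fintype.mem_piFinset]
    intro i
    have h1 : |f x i - f a i| ≤ L * (k * r) := by
      have h2 : |(f x - f a) i| ≤ ‖f x - f a‖ := by
        simpa using PiLp.norm_apply_le (f x - f a) i
      have h3 := hup a x
      rw [norm_sub_rev] at h3
      have h4 : ((ℓ (a⁻¹ * x) : ℕ) : ℝ) ≤ k * r := by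
        exact_mod_cast hF x hx
      have : L * (ℓ (a⁻¹ * x) : ℕ) ≤ L * (k * r) := by gcongr
      simp only [PiLp.sub_apply] at h2
      linarith
    have h5 : |(f x i - f a i) / (η * r)| ≤ L * k / η := by
      rw [abs_div, abs_of_pos (show 0 < η * r by positivity), div_le_div_iff₀ (by positivity) hη0]
      nlinarith
    have h6 : L * k / η ≤ (⌈L * k / η⌉₊ : ℝ) := Nat.le_ceil _
    obtain ⟨h7, h8⟩ := abs_le.mp (h5.trans h6)
    rw [Finset.mem_Icc]
    constructor
    · apply Int.le_floor.mpr
      push_cast [hM]; linarith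
    · have := Int.floor_le ((f x i - f a i) / (η * r))
      have h9 : ((φ x i : ℤ) : ℝ) ≤ (M : ℝ) := by
        simp only [φ]; push_cast [hM]; linarith
      exact_mod_cast h9
  have hinj : Set.InjOn φ F := by
    intro x hx y hy hxy
    by_contra hne
    have h1 := hsep x hx y hy hne
    have h1' : (r : ℝ) < ℓ (x⁻¹ * y) := by exact_mod_cast h1
    have h2 := hlow x y
    have h3 : ‖f x - f y‖ ≤ ∑ i, |(f x - f y) i| := by
      rw [EuclideanSpace.norm_eq]
      apply Real.sqrt_le_iff.mpr
      refine ⟨Finset.sum_nonneg (fun i _ => abs_nonneg _), ?_⟩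
      simp only [Real.norm_eq_abs]
      exact Finset.sum_sq_le_sq_sum_of_nonneg (fun i _ => abs_nonneg _)
    have h4 : ∀ i, |(f x - f y) i| ≤ η * r := by
      intro i
      have := Int.abs_sub_lt_one_of_floor_eq_floor (congrFun hxy i)
      rw [← sub_div, abs_div, abs_of_pos (show 0 < η * r by positivity), div_lt_one (by positivity)] at this
      simp only [sub_sub_sub_cancel_right] at this
      exact this.le
    have h5 : ∑ i, |(f x - f y) i| ≤ d * (η * r) := by
      calc _ ≤ ∑ i : Fin d, η * r := Finset.sum_le_sum (fun i _ => h4 i)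
        _ = _ := by simp
    have h6 : (d : ℝ) * (η * r) < c * r / 2 := by
      have : η * (2 * (d + 1)) = c := by rw [hη]; field_simp
      have h7 : c * r / 2 = (d + 1) * (η * r) := by rw [← this]; ring
      rw [h7]
      nlinarith [mul_pos hη0 (by linarith : (0:ℝ) < r)]
    nlinarith
  calc F.card ≤ _ := Finset.card_le_card_of_injOn φ hmaps hinj
    _ = (2 * M + 1) ^ d := by
      simp only [Fintype.card_piFinset, Int.card_Icc, Finset.prod_const, Finset.card_univ, Fintype.card_fin]
      congr 1
      omega


theorem caccioppoli_abstract {Γ : Type} (T : Finset Γ) (w : Γ → Γ → ℝ) (u φ : Γ → ℝ)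
    (hsymm : ∀ x y, w x y = w y x) (hw : ∀ x y, 0 ≤ w x y)
    (hharm : ∀ x ∈ T, φ x ≠ 0 → ∑ y ∈ T, w x y * (u x - u y) = 0) :
    ∑ x ∈ T, ∑ y ∈ T, w x y * ((φ x ^ 2 + φ y ^ 2) * (u x - u y) ^ 2) ≤
      2 * ∑ x ∈ T, ∑ y ∈ T, w x y * ((φ x - φ y) ^ 2 * (u x + u y) ^ 2) := by
  have h1 : ∑ x ∈ T, ∑ y ∈ T, φ x ^ 2 * u x * (w x y * (u x - u y)) = 0 := by
    apply Finset.sum_eq_zero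
    intro x hx
    rw [← Finset.mul_sum]
    by_cases h : φ x = 0
    · simp [h]
    · rw [hharm x hx h, mul_zero]
  have h2 : ∑ x ∈ T, ∑ y ∈ T, φ y ^ 2 * u y * (w x y * (u y - u x)) = 0 := by
    rw [Finset.sum_comm, ← h1]
    refine Finset.sum_congr rfl fun x _ => Finset.sum_congr rfl fun y _ => ?_
    rw [hsymm]
  have h3 : ∑ x ∈ T, ∑ y ∈ T, w x y * ((φ x ^ 2 + φ y ^ 2) * (u x - u y) ^ 2) ≤
      2 * ∑ x ∈ T, ∑ y ∈ T, w x y * ((φ x - φ y) ^ 2 * (u x + u y) ^ 2) +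
      (4 * ∑ x ∈ T, ∑ y ∈ T, φ x ^ 2 * u x * (w x y * (u x - u y)) +
       4 * ∑ x ∈ T, ∑ y ∈ T, φ y ^ 2 * u y * (w x y * (u y - u x))) := by
    simp only [Finset.mul_sum, ← Finset.sum_add_distrib]
    refine Finset.sum_le_sum fun x _ => Finset.sum_le_sum fun y _ => ?_
    have h4 : 0 ≤ w x y * (((φ x + φ y) * (u x - u y) + 2 * (φ x - φ y) * (u x + u y)) ^ 2 / 2 +
        (φ x - φ y) ^ 2 * (u x - u y) ^ 2 / 2) := mul_nonneg (hw x y) (by positivity)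
    nlinarith [h4]
  rw [h1, h2] at h3
  linarith

namespace WLen
variable {Γ : Type} [Group Γ] {S : Finset Γ} {ℓ : Γ → ℕ}

theorem sum_ball (h : WLen S ℓ) (a : Γ) (n : ℕ) (F : Γ → ℝ) :
    ∑ y ∈ h.ball a n, F y = ∑ g ∈ h.ball 1 n, F (a * g) := by
  simp [ball]

/-- energy density -/
def en (S : Finset Γ) (u : Γ → ℝ) (y : Γ) : ℝ := ∑ s ∈ S, (u (y * s) - u y) ^ 2

theorem en_nonneg (u : Γ → ℝ) (y : Γ) : 0 ≤ en S u y := Finset.sum_nonneg fun _ _ => sq_nonneg _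

theorem path_bound (h : WLen S ℓ) (u : Γ → ℝ) (B T : Finset Γ) : ∀ (n : ℕ) (g : Γ), ℓ g = n →
    (∀ x ∈ B, ∀ k, ℓ k ≤ n → x * k ∈ T) →
    ∑ x ∈ B, (u (x * g) - u x) ^ 2 ≤ (n : ℝ) ^ 2 * ∑ y ∈ T, en S u y := by
  classical
  intro n
  induction n with
  | zero =>
    intro g hg _
    rw [h.eq_one g hg]; simp
  | succ n ih =>
    intro g hg hT
    obtain ⟨k, s, hs, hk, rfl⟩ := h.succ g n hg
    have h1 := ih k hk (fun x hx k' hk' => hT x hx k' (by omega))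
    have h2 : ∑ x ∈ B, (u (x * (k * s)) - u (x * k)) ^ 2 ≤ ∑ y ∈ T, en S u y := by
      calc _ ≤ ∑ x ∈ B, en S u (x * k) := by
            refine Finset.sum_le_sum fun x _ => ?_
            rw [← mul_assoc]
            exact Finset.single_le_sum (f := fun s => (u (x * k * s) - u (x * k)) ^ 2)
              (fun _ _ => sq_nonneg _) hs
        _ = ∑ y ∈ B.image (fun x => x * k), en S u y := by
            rw [Finset.sum_image]
            intro x _ y _ hxy
            exact mul_right_cancel hxy
        _ ≤ _ := by
            apply Finset.sum_le_sum_of_subset_of_nonneg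
            · intro y hy
              obtain ⟨x, hx, rfl⟩ := Finset.mem_image.mp hy
              exact hT x hx k (by omega)
            · intro _ _ _; exact en_nonneg _ _
    rcases Nat.eq_zero_or_pos n with rfl | hn
    · rw [h.eq_one k hk] at h2 ⊢
      simpa using h2
    · have hn' : (0 : ℝ) < n := by exact_mod_cast hn
      have h3 : (n : ℝ) * ∑ x ∈ B, (u (x * (k * s)) - u x) ^ 2 ≤
          (n + 1) * ∑ x ∈ B, (u (x * k) - u x) ^ 2 +
          n * (n + 1) * ∑ x ∈ B, (u (x * (k * s)) - u (x * k)) ^ 2 := by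
        simp only [Finset.mul_sum, ← Finset.sum_add_distrib]
        refine Finset.sum_le_sum fun x _ => ?_
        nlinarith [sq_nonneg ((u (x * k) - u x) - n * (u (x * (k * s)) - u (x * k)))]
      have h4 : (n : ℝ) * ∑ x ∈ B, (u (x * (k * s)) - u x) ^ 2 ≤
          n * (((n + 1 : ℕ) : ℝ) ^ 2 * ∑ y ∈ T, en S u y) := by
        refine h3.trans ?_
        have h5 := mul_le_mul_of_nonneg_left h1 (by positivity : (0 : ℝ) ≤ n + 1)
        have h6 := mul_le_mul_of_nonneg_left h2 (by positivity : (0 : ℝ) ≤ n * (n + 1))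
        refine (add_le_add h5 h6).trans (le_of_eq ?_)
        push_cast; ring
      exact le_of_mul_le_mul_left h4 hn'

theorem poincare (h : WLen S ℓ) (u : Γ → ℝ) (a : Γ) (r : ℕ) (hu : ∑ x ∈ h.ball a r, u x = 0) :
    ((h.ball 1 r).card : ℝ) * ∑ x ∈ h.ball a r, u x ^ 2 ≤
      2 * r ^ 2 * (h.ball 1 (2 * r)).card * ∑ y ∈ h.ball a (3 * r), en S u y := by
  set B := h.ball a r with hB
  have h1 : ∑ x ∈ B, ∑ y ∈ B, (u y - u x) ^ 2 = 2 * (B.card * ∑ x ∈ B, u x ^ 2) := by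
    have : ∀ x ∈ B, ∑ y ∈ B, (u y - u x) ^ 2 = ∑ y ∈ B, u y ^ 2 + B.card * u x ^ 2 := by
      intro x _
      have : ∀ y ∈ B, (u y - u x) ^ 2 = u y ^ 2 - (2 * u x) * u y + u x ^ 2 := fun y _ => by ring
      rw [Finset.sum_congr rfl this, Finset.sum_add_distrib, Finset.sum_sub_distrib,
        ← Finset.mul_sum, hu]
      simp
    rw [Finset.sum_congr rfl this, Finset.sum_add_distrib, ← Finset.mul_sum]
    simp; ring
  have h2 : ∑ x ∈ B, ∑ y ∈ B, (u y - u x) ^ 2 ≤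
      ∑ x ∈ B, ∑ g ∈ h.ball 1 (2 * r), (u (x * g) - u x) ^ 2 := by
    refine Finset.sum_le_sum fun x hx => ?_
    rw [← h.sum_ball x (2 * r) (fun y => (u y - u x) ^ 2)]
    apply Finset.sum_le_sum_of_subset_of_nonneg
    · intro y hy
      rw [h.mem_ball]
      rw [hB, h.mem_ball] at hx hy
      have := h.tri x a y
      rw [h.symm_dist x a] at this
      omega
    · intro _ _ _; positivity
  rw [h1, Finset.sum_comm] at h2
  have h3 : ∑ g ∈ h.ball 1 (2 * r), ∑ x ∈ B, (u (x * g) - u x) ^ 2 ≤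
      ∑ g ∈ h.ball 1 (2 * r), (2 * r : ℝ) ^ 2 * ∑ y ∈ h.ball a (3 * r), en S u y := by
    refine Finset.sum_le_sum fun g hg => ?_
    rw [h.mem_ball_one] at hg
    refine (h.path_bound u B (h.ball a (3 * r)) (ℓ g) g rfl ?_).trans ?_
    · intro x hx k hk
      rw [hB, h.mem_ball] at hx
      rw [h.mem_ball]
      have := h.mul (a⁻¹ * x) k
      rw [← mul_assoc]; omega
    · have : (ℓ g : ℝ) ≤ 2 * r := by exact_mod_cast hg
      have := Finset.sum_nonneg (s := h.ball a (3 * r)) (fun y _ => en_nonneg (S := S) u y)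
      gcongr
  rw [Finset.sum_const, nsmul_eq_mul] at h3
  rw [← h.card_ball a r]
  nlinarith

theorem caccioppoli (h : WLen S ℓ) (u : Γ → ℝ) (hu : ∀ x, ∑ s ∈ S, (u (x * s) - u x) = 0)
    (ρ : ℕ) : (ρ : ℝ) ^ 2 * ∑ x ∈ h.ball 1 ρ, en S u x ≤
      8 * S.card * ∑ x ∈ h.ball 1 (2 * ρ + 1), u x ^ 2 := by
  classical
  set T := h.ball 1 (2 * ρ + 1) with hT
  let w : Γ → Γ → ℝ := fun x y => if x⁻¹ * y ∈ S then 1 else 0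
  let φ : Γ → ℝ := fun x => ((min ρ (2 * ρ - ℓ x) : ℕ) : ℝ)
  have hws : ∀ x y, w x y = w y x := by
    intro x y
    have : x⁻¹ * y ∈ S ↔ y⁻¹ * x ∈ S := by
      constructor
      · intro hh; simpa using h.symm _ hh
      · intro hh; simpa using h.symm _ hh
    simp only [w, this]
  have hw0 : ∀ x y, 0 ≤ w x y := by intro x y; simp only [w]; split_ifs <;> norm_num
  have hsum : ∀ (x : Γ) (F : Γ → ℝ), (∀ s ∈ S, x * s ∈ T) →
      ∑ y ∈ T, w x y * F y = ∑ s ∈ S, F (x * s) := by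
    intro x F hx
    simp only [w, ite_mul, one_mul, zero_mul]
    rw [← Finset.sum_filter]
    symm
    apply Finset.sum_bij (fun s _ => x * s)
    · intro s hs; simp [hx s hs, hs]
    · intro s _ t _ hst; exact mul_left_cancel hst
    · intro y hy; rw [Finset.mem_filter] at hy; exact ⟨_, hy.2, by simp⟩
    · intro s _; rfl
  have hsum_le : ∀ (x : Γ), ∑ y ∈ T, w x y ≤ S.card := by
    intro x
    simp only [w]
    rw [← Finset.sum_filter, Finset.sum_const, nsmul_eq_mul, mul_one]
    norm_cast
    apply Finset.card_le_card_of_injOn (fun y => x⁻¹ * y)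
    · intro y hy; exact (Finset.mem_filter.mp hy).2
    · intro y _ z _ hyz; exact mul_left_cancel hyz
  have hmemT : ∀ x, ℓ x ≤ 2 * ρ → ∀ s ∈ S, x * s ∈ T := by
    intro x hx s hs
    rw [hT, h.mem_ball_one]
    have := h.mul x s
    have := h.gen s hs
    omega
  have hcac := caccioppoli_abstract T w u φ hws hw0 (by
    intro x _ hx
    have hx' : ℓ x ≤ 2 * ρ := by
      by_contra hcon
      apply hx
      simp only [φ, Nat.cast_eq_zero]
      omega
    rw [hsum x (fun y => u x - u y) (hmemT x hx'), ← neg_eq_zero, ← hu x, ← Finset.sum_neg_distrib]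
    exact Finset.sum_congr rfl fun s _ => by ring)
  have hlow : (ρ : ℝ) ^ 2 * ∑ x ∈ h.ball 1 ρ, en S u x ≤
      ∑ x ∈ T, ∑ y ∈ T, w x y * ((φ x ^ 2 + φ y ^ 2) * (u x - u y) ^ 2) := by
    rw [Finset.mul_sum]
    calc _ ≤ ∑ x ∈ h.ball 1 ρ, ∑ y ∈ T, w x y * ((φ x ^ 2 + φ y ^ 2) * (u x - u y) ^ 2) := by
          refine Finset.sum_le_sum fun x hx => ?_
          rw [h.mem_ball_one] at hx
          rw [hsum x (fun y => (φ x ^ 2 + φ y ^ 2) * (u x - u y) ^ 2) (hmemT x (by omega)), en,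
            Finset.mul_sum]
          refine Finset.sum_le_sum fun s _ => ?_
          have : φ x = ρ := by simp only [φ]; congr 1; omega
          rw [this]
          nlinarith [mul_nonneg (sq_nonneg (φ (x * s))) (sq_nonneg (u x - u (x * s)))]
      _ ≤ _ := by
          apply Finset.sum_le_sum_of_subset_of_nonneg
          · exact h.ball_mono 1 (by omega)
          · intro x _ _
            exact Finset.sum_nonneg fun y _ => mul_nonneg (hw0 x y) (by positivity)
  have hup : ∑ x ∈ T, ∑ y ∈ T, w x y * ((φ x - φ y) ^ 2 * (u x + u y) ^ 2) ≤
      ∑ x ∈ T, ∑ y ∈ T, w x y * (2 * u x ^ 2) + ∑ x ∈ T, ∑ y ∈ T, w x y * (2 * u y ^ 2) := by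
    simp only [← Finset.sum_add_distrib]
    refine Finset.sum_le_sum fun x _ => Finset.sum_le_sum fun y _ => ?_
    rw [← mul_add]
    by_cases hxy : x⁻¹ * y ∈ S
    · apply mul_le_mul_of_nonneg_left _ (hw0 x y)
      have h1 := h.gen _ hxy
      have h2 := h.mul x (x⁻¹ * y)
      have h3 := h.mul y (y⁻¹ * x)
      rw [h.symm_dist y x] at h3
      simp only [mul_inv_cancel_left] at h2 h3
      have h4 : (φ x - φ y) ^ 2 ≤ 1 := by
        have h5 : φ x ≤ φ y + 1 := by simp only [φ]; norm_cast; omega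
        have h6 : φ y ≤ φ x + 1 := by simp only [φ]; norm_cast; omega
        nlinarith
      nlinarith [sq_nonneg (u x - u y), sq_nonneg (u x + u y)]
    · simp [w, hxy]
  have h7 : ∑ x ∈ T, ∑ y ∈ T, w x y * (2 * u x ^ 2) ≤ 2 * S.card * ∑ x ∈ T, u x ^ 2 := by
    rw [Finset.mul_sum]
    refine Finset.sum_le_sum fun x _ => ?_
    rw [← Finset.sum_mul]
    nlinarith [hsum_le x, sq_nonneg (u x)]
  have h8 : ∑ x ∈ T, ∑ y ∈ T, w x y * (2 * u y ^ 2) = ∑ x ∈ T, ∑ y ∈ T, w x y * (2 * u x ^ 2) := by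
    rw [Finset.sum_comm]
    refine Finset.sum_congr rfl fun x _ => Finset.sum_congr rfl fun y _ => ?_
    rw [hws]
  linarith

theorem doubling (h : WLen S ℓ) {r0 : ℕ} {N : ℕ → ℕ} (hp : Packing ℓ r0 N) (r : ℕ) (hr : r0 ≤ r) :
    (h.ball 1 (2 * r)).card ≤ N 2 * (h.ball 1 r).card := by
  classical
  obtain ⟨F, hF, hsep, hcov⟩ := h.exists_cover 1 (2 * r) r
  have hN := hp 2 r hr 1 F (fun x hx => h.mem_ball.mp (hF hx)) hsep
  calc (h.ball 1 (2 * r)).card ≤ (F.biUnion (fun c => h.ball c r)).card := by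
        apply Finset.card_le_card
        intro x hx
        obtain ⟨c, hc, hxc⟩ := hcov x hx
        exact Finset.mem_biUnion.mpr ⟨c, hc, hxc⟩
    _ ≤ F.card * (h.ball 1 r).card :=
        Finset.card_biUnion_le_card_mul _ _ _ (fun c _ => (h.card_ball c r).le)
    _ ≤ _ := Nat.mul_le_mul_right _ hN

theorem kleiner_ineq (h : WLen S ℓ) {r0 : ℕ} {N : ℕ → ℕ} (hp : Packing ℓ r0 N) (q r : ℕ)
    (hq : 1 ≤ q) (hr : r0 ≤ r) (hr1 : 1 ≤ r) : ∃ F : Finset Γ, F.card ≤ N q ∧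
    ∀ u : Γ → ℝ, (∀ x, ∑ s ∈ S, (u (x * s) - u x) = 0) →
      (∀ c ∈ F, ∑ x ∈ h.ball c r, u x = 0) →
      (q : ℝ) ^ 2 * ∑ x ∈ h.ball 1 (q * r), u x ^ 2 ≤
        (N 2 * N 3 * S.card) * ∑ x ∈ h.ball 1 (16 * (q * r)), u x ^ 2 := by
  classical
  obtain ⟨F, hF, hsep, hcov⟩ := h.exists_cover 1 (q * r) r
  refine ⟨F, hp q r hr 1 F (fun x hx => h.mem_ball.mp (hF hx)) hsep, ?_⟩
  intro u hu hz
  have h1 : ∑ x ∈ h.ball 1 (q * r), u x ^ 2 ≤ ∑ c ∈ F, ∑ x ∈ h.ball c r, u x ^ 2 := by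
    calc _ ≤ ∑ x ∈ h.ball 1 (q * r), ∑ c ∈ F, if x ∈ h.ball c r then u x ^ 2 else 0 := by
          refine Finset.sum_le_sum fun x hx => ?_
          obtain ⟨c, hc, hxc⟩ := hcov x hx
          have := Finset.single_le_sum (f := fun c => if x ∈ h.ball c r then u x ^ 2 else 0)
            (fun c _ => by split_ifs <;> positivity) hc
          simpa [hxc] using this
      _ = ∑ c ∈ F, ∑ x ∈ h.ball 1 (q * r), if x ∈ h.ball c r then u x ^ 2 else 0 :=
          Finset.sum_comm
      _ ≤ _ := by
          refine Finset.sum_le_sum fun c _ => ?_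
          rw [← Finset.sum_filter]
          apply Finset.sum_le_sum_of_subset_of_nonneg
          · intro x hx; exact (Finset.mem_filter.mp hx).2
          · intro _ _ _; positivity
  have hd : ((h.ball 1 (2 * r)).card : ℝ) ≤ N 2 * (h.ball 1 r).card := by
    exact_mod_cast h.doubling hp r hr
  have hpos : (0 : ℝ) < (h.ball 1 r).card := by exact_mod_cast h.ball_pos 1 r
  have h2 : ∀ c ∈ F, ∑ x ∈ h.ball c r, u x ^ 2 ≤
      2 * r ^ 2 * N 2 * ∑ y ∈ h.ball c (3 * r), en S u y := by
    intro c hc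
    have h3 := h.poincare u c r (hz c hc)
    have h4 := Finset.sum_nonneg (s := h.ball c (3 * r)) (fun y _ => en_nonneg (S := S) u y)
    apply le_of_mul_le_mul_left _ hpos
    refine h3.trans ?_
    calc _ ≤ 2 * r ^ 2 * (N 2 * (h.ball 1 r).card) * ∑ y ∈ h.ball c (3 * r), en S u y := by gcongr
      _ = _ := by ring
  have h5 : ∑ c ∈ F, ∑ y ∈ h.ball c (3 * r), en S u y ≤
      N 3 * ∑ y ∈ h.ball 1 (4 * (q * r)), en S u y := by
    have : ∀ c ∈ F, ∑ y ∈ h.ball c (3 * r), en S u y =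
        ∑ y ∈ h.ball 1 (4 * (q * r)), if y ∈ h.ball c (3 * r) then en S u y else 0 := by
      intro c hc
      rw [← Finset.sum_filter]
      apply Finset.sum_congr _ (fun _ _ => rfl)
      ext y
      simp only [Finset.mem_filter]
      constructor
      · intro hy
        refine ⟨?_, hy⟩
        have hc' := hF hc
        rw [h.mem_ball] at hy hc' ⊢
        have := h.tri 1 c y
        nlinarith
      · exact fun hy => hy.2
    rw [Finset.sum_congr rfl this, Finset.sum_comm, Finset.mul_sum]
    refine Finset.sum_le_sum fun y _ => ?_
    rw [← Finset.sum_filter, Finset.sum_const, nsmul_eq_mul]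
    apply mul_le_mul_of_nonneg_right _ (en_nonneg _ _)
    norm_cast
    apply hp 3 r hr y
    · intro x hx
      have := (Finset.mem_filter.mp hx).2
      rw [h.mem_ball] at this
      rwa [h.symm_dist]
    · intro x hx z hz
      exact hsep x (Finset.mem_filter.mp hx).1 z (Finset.mem_filter.mp hz).1
  have h6 := h.caccioppoli u hu (4 * (q * r))
  have h7 : ∑ x ∈ h.ball 1 (2 * (4 * (q * r)) + 1), u x ^ 2 ≤
      ∑ x ∈ h.ball 1 (16 * (q * r)), u x ^ 2 := by
    apply Finset.sum_le_sum_of_subset_of_nonneg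
    · apply h.ball_mono
      have : 1 ≤ q * r := Nat.mul_pos hq hr1
      omega
    · intro _ _ _; positivity
  have h8 : ∑ x ∈ h.ball 1 (q * r), u x ^ 2 ≤
      2 * r ^ 2 * N 2 * (N 3 * ∑ y ∈ h.ball 1 (4 * (q * r)), en S u y) := by
    refine (h1.trans (Finset.sum_le_sum h2)).trans ?_
    rw [← Finset.mul_sum]
    gcongr
  have h9 : (q : ℝ) ^ 2 * ∑ x ∈ h.ball 1 (q * r), u x ^ 2 ≤
      (N 2 * N 3 / 8) * ((4 * (q * r) : ℕ) ^ 2 * ∑ y ∈ h.ball 1 (4 * (q * r)), en S u y) := by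
    calc _ ≤ (q : ℝ) ^ 2 * (2 * r ^ 2 * N 2 * (N 3 * ∑ y ∈ h.ball 1 (4 * (q * r)), en S u y)) := by
          gcongr
      _ = _ := by push_cast; ring
  refine h9.trans ?_
  calc _ ≤ (N 2 * N 3 / 8 : ℝ) * (8 * S.card * ∑ x ∈ h.ball 1 (16 * (q * r)), u x ^ 2) := by
        apply mul_le_mul_of_nonneg_left _ (by positivity)
        refine h6.trans ?_
        gcongr
    _ = _ := by ring

end WLen


open scoped MatrixOrder in
theorem det_compare {n N : ℕ} {F : Type} [Fintype F] (hF : Fintype.card F ≤ N)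
    (M1 M2 : Matrix (Fin n) (Fin n) ℝ)
    (h1 : M1.PosSemidef) (h2 : M2.PosDef) (δ : ℝ) (hδ0 : 0 ≤ δ) (hδ1 : δ ≤ 1)
    (hle : ∀ x : Fin n → ℝ, x ⬝ᵥ (M1.mulVec x) ≤ x ⬝ᵥ (M2.mulVec x))
    (Φ : (Fin n → ℝ) →ₗ[ℝ] (F → ℝ))
    (hΦ : ∀ x, Φ x = 0 → x ⬝ᵥ (M1.mulVec x) ≤ δ * (x ⬝ᵥ (M2.mulVec x))) :
    M1.det ≤ δ ^ (n - N) * M2.det := by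
  classical
  obtain ⟨B, hB⟩ := CStarAlgebra.nonneg_iff_eq_star_mul_self.mp h2.posSemidef.nonneg
  have hdetB : B.det ≠ 0 := by
    intro h0
    have := h2.det_pos
    rw [hB, Matrix.det_mul, h0, mul_zero] at this
    exact lt_irrefl _ this
  have hBu : IsUnit B.det := isUnit_iff_ne_zero.mpr hdetB
  set A := (B⁻¹).conjTranspose * M1 * B⁻¹ with hA
  have hApsd : A.PosSemidef := h1.conjTranspose_mul_mul_same B⁻¹
  have hAh := hApsd.isHermitian
  set lam := hAh.eigenvalues with hlam
  set U : Matrix (Fin n) (Fin n) ℝ := hAh.eigenvectorUnitary.1 with hU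
  have hUU : U.conjTranspose * U = 1 := by
    have := Unitary.coe_star_mul_self hAh.eigenvectorUnitary
    simpa [Matrix.star_eq_conjTranspose] using this
  have hspec : U.conjTranspose * A * U = Matrix.diagonal lam := by
    have := hAh.spectral_theorem
    rw [Unitary.conjStarAlgAut_apply] at this
    have h3 : A = U * Matrix.diagonal lam * U.conjTranspose := by
      conv_lhs => rw [this]
      rfl
    rw [h3]
    calc _ = (U.conjTranspose * U) * Matrix.diagonal lam * (U.conjTranspose * U) := by
          simp only [Matrix.mul_assoc]
      _ = _ := by rw [hUU]; simp
  set P := B⁻¹ * U with hP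
  have hP1 : P.transpose * M1 * P = Matrix.diagonal lam := by
    rw [← hspec, hA, hP, ← Matrix.conjTranspose_eq_transpose_of_trivial, Matrix.conjTranspose_mul]
    simp only [Matrix.mul_assoc]
  have hP2 : P.transpose * M2 * P = 1 := by
    rw [← hUU, hB, hP, ← Matrix.conjTranspose_eq_transpose_of_trivial, Matrix.conjTranspose_mul,
      Matrix.star_eq_conjTranspose]
    calc _ = U.conjTranspose * ((B * B⁻¹).conjTranspose * (B * B⁻¹)) * U := by
          simp only [Matrix.mul_assoc, Matrix.conjTranspose_mul]
      _ = _ := by rw [Matrix.mul_nonsing_inv _ hBu]; simp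
  have hq : ∀ (M : Matrix (Fin n) (Fin n) ℝ) (y : Fin n → ℝ),
      (P.mulVec y) ⬝ᵥ (M.mulVec (P.mulVec y)) = y ⬝ᵥ ((P.transpose * M * P).mulVec y) := by
    intro M y
    clear_value P
    rw [← Matrix.mulVec_mulVec, ← Matrix.mulVec_mulVec, Matrix.dotProduct_mulVec y,
      Matrix.vecMul_transpose]
  have hq1 : ∀ y : Fin n → ℝ, (P.mulVec y) ⬝ᵥ (M1.mulVec (P.mulVec y)) = ∑ i, lam i * y i ^ 2 := by
    intro y
    rw [hq, hP1]
    simp only [dotProduct, Matrix.mulVec_diagonal]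
    exact Finset.sum_congr rfl fun i _ => by ring
  have hq2 : ∀ y : Fin n → ℝ, (P.mulVec y) ⬝ᵥ (M2.mulVec (P.mulVec y)) = ∑ i, y i ^ 2 := by
    intro y
    rw [hq, hP2, Matrix.one_mulVec]
    simp only [dotProduct]
    exact Finset.sum_congr rfl fun i _ => by ring
  have hlam0 : ∀ i, 0 ≤ lam i := fun i => hApsd.eigenvalues_nonneg i
  have hlam1 : ∀ i, lam i ≤ 1 := by
    intro i
    have := hle (P.mulVec (Pi.single i 1))
    rw [hq1, hq2] at this
    simpa [Pi.single_apply] using this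
  let J : Finset (Fin n) := Finset.univ.filter (fun i => δ < lam i)
  have hJ : J.card ≤ N := by
    by_contra hcon
    push Not at hcon
    let E : (J → ℝ) →ₗ[ℝ] (Fin n → ℝ) :=
      { toFun := fun a i => if hi : i ∈ J then a ⟨i, hi⟩ else 0
        map_add' := by intro a b; ext i; by_cases hi : i ∈ J <;> simp [hi]
        map_smul' := by intro c a; ext i; by_cases hi : i ∈ J <;> simp [hi] }
    let f : (J → ℝ) →ₗ[ℝ] (F → ℝ) := Φ ∘ₗ P.mulVecLin ∘ₗ E
    have hker : f.ker ≠ ⊥ := by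
      apply LinearMap.ker_ne_bot_of_finrank_lt
      simp only [Module.finrank_fintype_fun_eq_card, Fintype.card_coe]
      omega
    obtain ⟨a, ha, ha0⟩ := (Submodule.ne_bot_iff _).mp hker
    have h3 := hΦ (P.mulVec (E a)) ha
    rw [hq1, hq2, Finset.mul_sum] at h3
    have h4 : ∑ i, δ * E a i ^ 2 < ∑ i, lam i * E a i ^ 2 := by
      apply Finset.sum_lt_sum
      · intro i _
        by_cases hi : i ∈ J
        · exact mul_le_mul_of_nonneg_right (Finset.mem_filter.mp hi).2.le (sq_nonneg _)
        · simp [E, hi]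
      · obtain ⟨j, hj⟩ := Function.ne_iff.mp ha0
        refine ⟨j, Finset.mem_univ _, ?_⟩
        have h5 : E a j = a j := by simp [E]
        have h6 : 0 < E a j ^ 2 := by rw [h5]; exact sq_pos_of_ne_zero hj
        exact mul_lt_mul_of_pos_right (Finset.mem_filter.mp j.2).2 h6
    linarith
  have hprod : ∏ i, lam i ≤ δ ^ (n - N) := by
    calc ∏ i, lam i ≤ ∏ i, (if i ∈ J then 1 else δ) := by
          apply Finset.prod_le_prod (fun i _ => hlam0 i)
          intro i _
          split_ifs with hi
          · exact hlam1 i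
          · simp only [J, Finset.mem_filter, Finset.mem_univ, true_and, not_lt] at hi
            exact hi
      _ = δ ^ (n - J.card) := by
          rw [Finset.prod_ite]
          simp only [Finset.prod_const_one, one_mul, Finset.prod_const]
          congr 1
          rw [Finset.filter_not, Finset.card_sdiff_of_subset (Finset.filter_subset _ _)]
          simp
      _ ≤ δ ^ (n - N) := pow_le_pow_of_le_one hδ0 hδ1 (by omega)
  have hd1 : P.det ^ 2 * M1.det = ∏ i, lam i := by
    have := congrArg Matrix.det hP1
    simp only [Matrix.det_mul, Matrix.det_transpose, Matrix.det_diagonal] at this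
    rw [← this]; ring
  have hd2 : P.det ^ 2 * M2.det = 1 := by
    have := congrArg Matrix.det hP2
    simp only [Matrix.det_mul, Matrix.det_transpose, Matrix.det_one] at this
    rw [← this]; ring
  have hM2 := h2.det_pos
  have : M1.det = (∏ i, lam i) * M2.det := by
    rw [← hd1]
    calc M1.det = M1.det * (P.det ^ 2 * M2.det) := by rw [hd2, mul_one]
      _ = _ := by ring
  rw [this]
  exact mul_le_mul_of_nonneg_right hprod hM2.le

set_option maxHeartbeats 1000000 in
theorem WLen.finite_span {Γ : Type} [Group Γ] {S : Finset Γ} {ℓ : Γ → ℕ} (h : WLen S ℓ)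
    {r0 : ℕ} {N : ℕ → ℕ} (hp : Packing ℓ r0 N) {H : Type} [NormedAddCommGroup H]
    [InnerProductSpace ℝ H] (b : Γ → H) (L : ℝ) (hLip : ∀ x, ‖b x‖ ≤ L * ℓ x)
    (hharm : ∀ x, ∑ s ∈ S, (b (x * s) - b x) = 0) :
    FiniteDimensional ℝ (Submodule.span ℝ (Set.range b)) := by
  classical
  obtain ⟨C, hC⟩ : ∃ C : ℕ, C = N 2 * N 3 * S.card := ⟨_, rfl⟩
  obtain ⟨Q, hQ⟩ : ∃ Q : ℕ, Q = 256 * N 2 ^ 4 := ⟨_, rfl⟩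
  obtain ⟨q, hq⟩ : ∃ q : ℕ, q = C * Q ^ 2 + C + 1 := ⟨_, rfl⟩
  obtain ⟨N', hN'⟩ : ∃ N' : ℕ, N' = N q + 1 := ⟨_, rfl⟩
  by_contra hinf
  have hrank : ((2 * N' : ℕ) : Cardinal) ≤ Module.rank ℝ (Submodule.span ℝ (Set.range b)) := by
    by_contra hlt
    apply hinf
    rw [FiniteDimensional, ← Module.rank_lt_aleph0_iff]
    exact (not_le.mp hlt).trans (Cardinal.natCast_lt_aleph0)
  obtain ⟨s, hs, hli⟩ := le_rank_iff_exists_linearIndependent_finset.mp hrank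
  let e : Fin (2 * N') ≃ s := (Fintype.equivFinOfCardEq (by simpa using hs)).symm
  let v : Fin (2 * N') → H := fun i => ((e i : Submodule.span ℝ (Set.range b)) : H)
  have hvli : LinearIndependent ℝ v :=
    (hli.comp e e.injective).map' (Submodule.subtype _) (Submodule.ker_subtype _)
  have hvmem : ∀ i, v i ∈ Submodule.span ℝ (Set.range b) := fun i => (e i).1.2
  -- choose radius
  have hrad : ∀ w ∈ Submodule.span ℝ (Set.range b), ∃ R : ℕ, ∀ R', R ≤ R' →
      w ∈ Submodule.span ℝ (b '' {x | ℓ x ≤ R'}) := by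
    intro w hw
    induction hw using Submodule.span_induction with
    | mem w hw =>
      obtain ⟨x, rfl⟩ := hw
      exact ⟨ℓ x, fun R' hR' => Submodule.subset_span ⟨x, hR', rfl⟩⟩
    | zero => exact ⟨0, fun _ _ => Submodule.zero_mem _⟩
    | add w1 w2 _ _ h1 h2 =>
      obtain ⟨R1, h1⟩ := h1
      obtain ⟨R2, h2⟩ := h2
      exact ⟨max R1 R2, fun R' hR' => Submodule.add_mem _ (h1 R' (le_of_max_le_left hR'))
        (h2 R' (le_of_max_le_right hR'))⟩
    | smul c w _ h1 =>
      obtain ⟨R1, h1⟩ := h1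
      exact ⟨R1, fun R' hR' => Submodule.smul_mem _ _ (h1 R' hR')⟩
  choose Rv hRv using fun i => hrad (v i) (hvmem i)
  obtain ⟨r, hr⟩ : ∃ r : ℕ, r = r0 + 1 + ∑ i, Rv i := ⟨_, rfl⟩
  have hRr : ∀ i, Rv i ≤ r := fun i =>
    (Finset.single_le_sum (f := Rv) (fun _ _ => Nat.zero_le _) (Finset.mem_univ i)).trans (by omega)
  have hq1 : 1 ≤ q := by omega
  obtain ⟨R, hR⟩ : ∃ R : ℕ → ℕ, ∀ k, R k = q * (16 ^ k * r) := ⟨_, fun _ => rfl⟩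
  have hRge : ∀ k, r ≤ R k := by
    intro k
    rw [hR]
    calc r = 1 * (1 * r) := by ring
      _ ≤ q * (16 ^ k * r) := Nat.mul_le_mul hq1 (Nat.mul_le_mul_right _ (Nat.one_le_pow _ _ (by norm_num)))
  let comb : (Fin (2 * N') → ℝ) → H := fun x => ∑ i, x i • v i
  obtain ⟨M, hM⟩ : ∃ M : ℕ → Matrix (Fin (2 * N')) (Fin (2 * N')) ℝ, ∀ k i j, M k i j =
      ∑ g ∈ h.ball 1 (R k), inner ℝ (b g) (v i) * inner ℝ (b g) (v j) :=
    ⟨fun k => Matrix.of fun i j => ∑ g ∈ h.ball 1 (R k), inner ℝ (b g) (v i) * inner ℝ (b g) (v j),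
      fun _ _ _ => rfl⟩
  have hMq : ∀ k x, x ⬝ᵥ ((M k).mulVec x) = ∑ g ∈ h.ball 1 (R k), (inner ℝ (b g) (comb x)) ^ 2 := by
    intro k x
    simp only [dotProduct, Matrix.mulVec, hM, comb, inner_sum, inner_smul_right]
    simp only [Finset.sum_mul, Finset.mul_sum, sq]
    rw [Finset.sum_comm' (t' := Finset.univ) (s' := fun _ => Finset.univ) (by simp)]
    simp only [Finset.sum_comm (s := Finset.univ) (t := h.ball 1 (R k))]
    refine Finset.sum_congr rfl fun g _ => ?_
    refine Finset.sum_congr rfl fun i _ => Finset.sum_congr rfl fun j _ => ?_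
    ring
  have hMherm : ∀ k, (M k).IsHermitian := by
    intro k
    ext i j
    simp only [hM, Matrix.conjTranspose_apply, star_trivial]
    exact Finset.sum_congr rfl fun g _ => mul_comm _ _
  have hMpd : ∀ k, (M k).PosDef := by
    intro k
    refine Matrix.PosDef.of_dotProduct_mulVec_pos (hMherm k) ?_
    intro x hx
    rw [star_trivial, hMq]
    have hnn : 0 ≤ ∑ g ∈ h.ball 1 (R k), (inner ℝ (b g) (comb x)) ^ 2 :=
      Finset.sum_nonneg fun _ _ => sq_nonneg _
    refine lt_of_le_of_ne hnn ?_
    intro h0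
    apply hx
    have h1 : ∀ g ∈ h.ball 1 (R k), inner ℝ (b g) (comb x) = 0 := by
      intro g hg
      have := (Finset.sum_eq_zero_iff_of_nonneg (fun _ _ => sq_nonneg _)).mp h0.symm g hg
      simpa using this
    have h2 : comb x ∈ Submodule.span ℝ (b '' {x | ℓ x ≤ R k}) :=
      Submodule.sum_mem _ fun i _ => Submodule.smul_mem _ _ (hRv i _ ((hRr i).trans (hRge k)))
    have h3 : inner ℝ (comb x) (comb x) = 0 := by
      have : ∀ w ∈ Submodule.span ℝ (b '' {x | ℓ x ≤ R k}), inner ℝ w (comb x) = 0 := by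
        intro w hw
        induction hw using Submodule.span_induction with
        | mem w hw =>
          obtain ⟨g, hg, rfl⟩ := hw
          exact h1 g (h.mem_ball_one.mpr hg)
        | zero => simp
        | add w1 w2 _ _ h1 h2 => rw [inner_add_left, h1, h2, add_zero]
        | smul c w _ h1 => rw [inner_smul_left, h1, mul_zero]
      exact this _ h2
    have h4 : comb x = 0 := inner_self_eq_zero.mp h3
    funext i
    exact (Fintype.linearIndependent_iff.mp hvli) x h4 i
  have hCq : (C : ℝ) * Q ^ 2 + C < (q : ℝ) ^ 2 := by
    have h1 : C * Q ^ 2 + C < q := by omega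
    have h2 : q ≤ q ^ 2 := Nat.le_self_pow (by norm_num) q
    have h3 : C * Q ^ 2 + C < q ^ 2 := by omega
    exact_mod_cast h3
  have hq0 : (0 : ℝ) < (q : ℝ) ^ 2 := by positivity
  obtain ⟨δ, hδ⟩ : ∃ δ : ℝ, δ = C / (q : ℝ) ^ 2 := ⟨_, rfl⟩
  have hδ0 : 0 ≤ δ := by rw [hδ]; positivity
  have hδ1 : δ ≤ 1 := by
    rw [hδ, div_le_one hq0]
    have : (0 : ℝ) ≤ C * Q ^ 2 := by positivity
    linarith
  have hδQ : δ * Q ^ 2 < 1 := by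
    rw [hδ, div_mul_eq_mul_div, div_lt_one hq0]
    have : (0 : ℝ) ≤ C := by positivity
    linarith
  have hstep : ∀ k, (M k).det ≤ δ ^ N' * (M (k + 1)).det := by
    intro k
    have hrk : r ≤ 16 ^ k * r := Nat.le_mul_of_pos_left _ (by positivity)
    obtain ⟨F, hF, hFu⟩ := h.kleiner_ineq hp q (16 ^ k * r) hq1 (by omega) (by omega)
    have hRk : R (k + 1) = 16 * (q * (16 ^ k * r)) := by simp only [hR, pow_succ]; ring
    let Φ : (Fin (2 * N') → ℝ) →ₗ[ℝ] (F → ℝ) :=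
      { toFun := fun x c => ∑ g ∈ h.ball c.1 (16 ^ k * r), inner ℝ (b g) (comb x)
        map_add' := by
          intro x y; ext c
          simp [comb, add_smul, Finset.sum_add_distrib, inner_add_right]
        map_smul' := by
          intro t x; ext c
          have : comb (t • x) = t • comb x := by simp [comb, Finset.smul_sum, smul_smul]
          simp [this, inner_smul_right, Finset.mul_sum] }
    have := det_compare (F := F) (N := N q) (by simpa using hF) (M k) (M (k + 1))
      (hMpd k).posSemidef (hMpd (k+1)) δ hδ0 hδ1 (by
        intro x
        rw [hMq, hMq]
        apply Finset.sum_le_sum_of_subset_of_nonneg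
        · apply h.ball_mono
          rw [hRk]; simp only [hR]; omega
        · intro _ _ _; positivity) Φ (by
        intro x hx
        rw [hMq, hMq]
        have := hFu (fun g => inner ℝ (b g) (comb x)) (by
          intro g
          have := congrArg (fun w => inner ℝ w (comb x)) (hharm g)
          simp only [sum_inner, inner_sub_left, inner_zero_left] at this; exact this) (by
          intro c hc
          exact congrFun hx ⟨c, hc⟩)
        rw [hRk, hR k, hδ, div_mul_eq_mul_div, le_div_iff₀ hq0, mul_comm]
        push_cast [hC]
        exact this)
    refine this.trans ?_
    apply mul_le_mul_of_nonneg_right _ (hMpd _).det_pos.le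
    exact pow_le_pow_of_le_one hδ0 hδ1 (by omega)
  have hiter : ∀ k, (M 0).det ≤ (δ ^ N') ^ k * (M k).det := by
    intro k
    induction k with
    | zero => simp
    | succ k ih =>
      calc _ ≤ _ := ih
        _ ≤ (δ ^ N') ^ k * (δ ^ N' * (M (k + 1)).det) := by gcongr; exact hstep k
        _ = _ := by ring
  have hcard : ∀ k, (h.ball 1 (R k)).card ≤ (N 2 ^ 4) ^ k * (h.ball 1 (R 0)).card := by
    intro k
    induction k with
    | zero => simp
    | succ k ih =>
      have hge := hRge k
      have e1 : R (k + 1) = 2 * (2 * (2 * (2 * R k))) := by simp only [hR, pow_succ]; ring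
      have d1 := h.doubling hp (R k) (by omega)
      have d2 := h.doubling hp (2 * R k) (by omega)
      have d3 := h.doubling hp (2 * (2 * R k)) (by omega)
      have d4 := h.doubling hp (2 * (2 * (2 * R k))) (by omega)
      rw [e1]
      calc _ ≤ _ := d4
        _ ≤ N 2 * (N 2 * (N 2 * (N 2 * ((N 2 ^ 4) ^ k * (h.ball 1 (R 0)).card)))) := by
          refine Nat.mul_le_mul_left _ (d3.trans (Nat.mul_le_mul_left _ (d2.trans
            (Nat.mul_le_mul_left _ (d1.trans (Nat.mul_le_mul_left _ ih))))))
        _ = _ := by ring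
  obtain ⟨V, hV⟩ : ∃ V : ℝ, V = ∑ i, ‖v i‖ := ⟨_, rfl⟩
  have hvV : ∀ i, ‖v i‖ ≤ V := fun i => hV ▸
    Finset.single_le_sum (f := fun i => ‖v i‖) (fun _ _ => norm_nonneg _) (Finset.mem_univ i)
  have hV0 : 0 ≤ V := hV ▸ Finset.sum_nonneg fun _ _ => norm_nonneg _
  obtain ⟨P0, hP0⟩ : ∃ P0 : ℝ, P0 = (h.ball 1 (R 0)).card * (L ^ 2 * (R 0) ^ 2 * V ^ 2) := ⟨_, rfl⟩
  have hP00 : 0 ≤ P0 := by rw [hP0]; positivity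
  have hent : ∀ k i j, |M k i j| ≤ P0 * (Q : ℝ) ^ k := by
    intro k i j
    have h1 : ∀ g ∈ h.ball 1 (R k), |inner ℝ (b g) (v i) * inner ℝ (b g) (v j)| ≤
        L ^ 2 * (R k) ^ 2 * V ^ 2 := by
      intro g hg
      rw [h.mem_ball_one] at hg
      have hgR : (ℓ g : ℝ) ≤ R k := by exact_mod_cast hg
      have hb : ‖b g‖ ^ 2 ≤ L ^ 2 * (R k) ^ 2 := by
        calc ‖b g‖ ^ 2 ≤ (L * ℓ g) ^ 2 := by gcongr; exact hLip g
          _ = L ^ 2 * (ℓ g) ^ 2 := by ring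
          _ ≤ _ := by gcongr
      rw [abs_mul]
      calc _ ≤ (‖b g‖ * ‖v i‖) * (‖b g‖ * ‖v j‖) := by
            gcongr <;> exact abs_real_inner_le_norm _ _
        _ ≤ (‖b g‖ * V) * (‖b g‖ * V) := by gcongr <;> apply hvV
        _ = ‖b g‖ ^ 2 * V ^ 2 := by ring
        _ ≤ _ := by gcongr
    calc |M k i j| ≤ ∑ g ∈ h.ball 1 (R k), |inner ℝ (b g) (v i) * inner ℝ (b g) (v j)| := by
          rw [hM]; exact Finset.abs_sum_le_sum_abs _ _
      _ ≤ (h.ball 1 (R k)).card * (L ^ 2 * (R k) ^ 2 * V ^ 2) := by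
          rw [← nsmul_eq_mul]; exact Finset.sum_le_card_nsmul _ _ _ h1
      _ ≤ ((N 2 ^ 4) ^ k * (h.ball 1 (R 0)).card : ℕ) * (L ^ 2 * (R k) ^ 2 * V ^ 2) := by
          gcongr; exact hcard k
      _ = _ := by
          rw [hP0, hQ]
          simp only [hR]
          push_cast
          have : (256 : ℝ) ^ k = (16 ^ k) ^ 2 := by rw [← pow_mul, mul_comm, pow_mul]; norm_num
          rw [mul_pow (256 : ℝ), this]; ring
  have hdet : ∀ k, (M k).det ≤ ((2 * N').factorial : ℝ) * (P0 * (Q : ℝ) ^ k) ^ (2 * N') := by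
    intro k
    have := Matrix.det_le (A := M k) (abv := AbsoluteValue.abs) (x := P0 * (Q : ℝ) ^ k)
      (fun i j => hent k i j)
    simp only [Fintype.card_fin, nsmul_eq_mul] at this
    exact (le_abs_self _).trans this
  have hfin : ∀ k, (M 0).det ≤ (((2 * N').factorial : ℝ) * P0 ^ (2 * N')) * ((δ * Q ^ 2) ^ N') ^ k := by
    intro k
    calc _ ≤ _ := hiter k
      _ ≤ (δ ^ N') ^ k * (((2 * N').factorial : ℝ) * (P0 * (Q : ℝ) ^ k) ^ (2 * N')) := by
          gcongr; exact hdet k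
      _ = _ := by
          simp only [mul_pow, ← pow_mul]
          have : k * (2 * N') = 2 * N' * k := by ring
          rw [this]; ring
  have hlim : Filter.Tendsto (fun k : ℕ => (((2 * N').factorial : ℝ) * P0 ^ (2 * N')) *
      ((δ * Q ^ 2) ^ N') ^ k) Filter.atTop (nhds 0) := by
    have h1 : (δ * (Q : ℝ) ^ 2) ^ N' < 1 := pow_lt_one₀ (by positivity) hδQ (by omega)
    have := (tendsto_pow_atTop_nhds_zero_of_lt_one (by positivity) h1).const_mul
      (((2 * N').factorial : ℝ) * P0 ^ (2 * N'))
    simpa using this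
  have := ge_of_tendsto' hlim hfin
  exact absurd (hMpd 0).det_pos (not_lt.mpr this)


/-- bounded real functions -/
def Bdd {Γ : Type} (u : Γ → ℝ) : Prop := ∃ M : ℝ, ∀ x, |u x| ≤ M

theorem WLen.exists_slow {Γ : Type} [Group Γ] {S : Finset Γ} {ℓ : Γ → ℕ} (h : WLen S ℓ)
    {r0 : ℕ} (hr0 : 1 ≤ r0) {N : ℕ → ℕ} (hp : Packing ℓ r0 N) (η : ℝ) (hη : 0 < η) :
    ∃ n, ((h.ball 1 (n + 1)).card : ℝ) ≤ (1 + η) * (h.ball 1 n).card := by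
  by_contra hcon
  push Not at hcon
  have h1 : ∀ n, (1 + η) ^ n ≤ ((h.ball 1 n).card : ℝ) := by
    intro n
    induction n with
    | zero =>
      have := h.ball_pos 1 0
      simp only [pow_zero]; exact_mod_cast this
    | succ n ih =>
      calc (1 + η) ^ (n + 1) = (1 + η) * (1 + η) ^ n := by ring
        _ ≤ (1 + η) * (h.ball 1 n).card := by gcongr
        _ ≤ _ := (hcon n).le
  have h2 : ∀ j, (h.ball 1 (2 ^ j * r0)).card ≤ N 2 ^ j * (h.ball 1 r0).card := by
    intro j
    induction j with
    | zero => simp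
    | succ j ih =>
      have hle : r0 ≤ 2 ^ j * r0 := Nat.le_mul_of_pos_left _ (by positivity)
      have := h.doubling hp (2 ^ j * r0) hle
      have e : 2 ^ (j + 1) * r0 = 2 * (2 ^ j * r0) := by ring
      rw [e]
      calc _ ≤ _ := this
        _ ≤ N 2 * (N 2 ^ j * (h.ball 1 r0).card) := Nat.mul_le_mul_left _ ih
        _ = _ := by ring
  obtain ⟨p, hp2⟩ : ∃ p, N 2 ≤ 2 ^ p := ⟨N 2, Nat.lt_two_pow_self.le⟩
  have h3 : ∀ j : ℕ, (1 : ℝ) ≤ (h.ball 1 r0).card * ((((2 ^ j : ℕ) : ℝ)) ^ p / (1 + η) ^ (2 ^ j)) := by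
    intro j
    have h4 : (1 + η) ^ (2 ^ j) ≤ (((2 ^ j : ℕ) : ℝ)) ^ p * (h.ball 1 r0).card := by
      calc (1 + η) ^ (2 ^ j) ≤ (1 + η) ^ (2 ^ j * r0) :=
            pow_le_pow_right₀ (by linarith) (Nat.le_mul_of_pos_right _ hr0)
        _ ≤ _ := h1 _
        _ ≤ (N 2 ^ j * (h.ball 1 r0).card : ℕ) := by exact_mod_cast h2 j
        _ ≤ ((2 ^ p) ^ j * (h.ball 1 r0).card : ℕ) := by gcongr
        _ = _ := by push_cast; rw [← pow_mul, ← pow_mul, mul_comm p j]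
    rw [← mul_div_assoc, le_div_iff₀ (by positivity), one_mul, mul_comm]
    exact h4
  have h5 := (tendsto_pow_const_div_const_pow_of_one_lt p (show (1 : ℝ) < 1 + η by linarith)).comp
    (tendsto_pow_atTop_atTop_of_one_lt (show 1 < 2 by norm_num))
  have h6 := h5.const_mul ((h.ball 1 r0).card : ℝ)
  rw [mul_zero] at h6
  have := ge_of_tendsto' h6 h3
  linarith

theorem WLen.exists_mean {Γ : Type} [Group Γ] {S : Finset Γ} {ℓ : Γ → ℕ} (h : WLen S ℓ)
    {r0 : ℕ} (hr0 : 1 ≤ r0) {N : ℕ → ℕ} (hp : Packing ℓ r0 N) :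
    ∃ m : (Γ → ℝ) → ℝ, (∀ u v, Bdd u → Bdd v → m (fun x => u x + v x) = m u + m v) ∧
      (∀ (c : ℝ) u, Bdd u → m (fun x => c * u x) = c * m u) ∧
      (∀ u v, Bdd u → Bdd v → (∀ x, u x ≤ v x) → m u ≤ m v) ∧
      (∀ c : ℝ, m (fun _ => c) = c) ∧
      (∀ g u, Bdd u → m (fun x => u (x * g)) = m u) := by
  classical
  choose R hR using fun k : ℕ => h.exists_slow hr0 hp (1 / ((k : ℝ) + 1)) (by positivity)
  let av : (Γ → ℝ) → ℕ → ℝ := fun u k => (∑ x ∈ h.ball 1 (R k), u x) / (h.ball 1 (R k)).card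
  have hpos : ∀ k, (0 : ℝ) < (h.ball 1 (R k)).card := fun k => by exact_mod_cast h.ball_pos 1 (R k)
  have hav : ∀ u M, (∀ x, |u x| ≤ M) → ∀ k, |av u k| ≤ M := by
    intro u M hu k
    simp only [av]
    rw [abs_div, abs_of_pos (hpos k), div_le_iff₀ (hpos k)]
    calc _ ≤ ∑ x ∈ h.ball 1 (R k), |u x| := Finset.abs_sum_le_sum_abs _ _
      _ ≤ (h.ball 1 (R k)).card • M := Finset.sum_le_card_nsmul _ _ _ fun x _ => hu x
      _ = _ := by rw [nsmul_eq_mul, mul_comm]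
  let 𝒰 : Ultrafilter ℕ := Filter.hyperfilter ℕ
  have hex : ∀ u, ∃ a, Bdd u → Filter.Tendsto (av u) 𝒰 (nhds a) := by
    intro u
    by_cases hu : Bdd u
    · obtain ⟨M, hM⟩ := hu
      have hc : IsCompact (Set.Icc (-M) M) := isCompact_Icc
      obtain ⟨a, -, ha⟩ := hc.ultrafilter_le_nhds (𝒰.map (av u)) (by
        rw [Filter.le_principal_iff]
        exact Filter.mem_map.mpr (Filter.univ_mem' fun k => abs_le.mp (hav u M hM k)))
      exact ⟨a, fun _ => ha⟩
    · exact ⟨0, fun h => absurd h hu⟩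
  choose m hm using hex
  have hadd : ∀ u v, Bdd u → Bdd v → m (fun x => u x + v x) = m u + m v := by
    rintro u v hu hv
    have huv : Bdd (fun x => u x + v x) := by
      obtain ⟨M, hM⟩ := hu
      obtain ⟨M', hM'⟩ := hv
      exact ⟨M + M', fun x => (abs_add_le _ _).trans (add_le_add (hM x) (hM' x))⟩
    refine tendsto_nhds_unique (hm _ huv) (((hm u hu).add (hm v hv)).congr fun k => ?_)
    simp only [av, Finset.sum_add_distrib, add_div]
  have hmul : ∀ (c : ℝ) u, Bdd u → m (fun x => c * u x) = c * m u := by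
    intro c u hu
    have huv : Bdd (fun x => c * u x) := by
      obtain ⟨M, hM⟩ := hu
      exact ⟨|c| * M, fun x => by rw [abs_mul]; exact mul_le_mul_of_nonneg_left (hM x) (abs_nonneg c)⟩
    refine tendsto_nhds_unique (hm _ huv) (((hm u hu).const_mul c).congr fun k => ?_)
    simp only [av, ← Finset.mul_sum, mul_div_assoc]
  refine ⟨m, hadd, hmul, ?_, ?_, ?_⟩
  · intro u v hu hv huv
    refine le_of_tendsto_of_tendsto' (hm u hu) (hm v hv) fun k => ?_
    simp only [av]
    gcongr with x hx
    exact huv x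
  · intro c
    refine tendsto_nhds_unique (hm _ ⟨|c|, fun _ => le_rfl⟩) ?_
    refine tendsto_const_nhds.congr fun k => ?_
    simp only [av, Finset.sum_const, nsmul_eq_mul]
    rw [mul_div_cancel_left₀ _ (hpos k).ne']
  · have hS : ∀ s ∈ S, ∀ u, Bdd u → m (fun x => u (x * s)) = m u := by
      intro s hs u hu
      have hus : Bdd (fun x => u (x * s)) := by
        obtain ⟨M, hM⟩ := hu
        exact ⟨M, fun x => hM _⟩
      obtain ⟨M, hM⟩ := hu
      have hbound : ∀ k : ℕ, |av (fun x => u (x * s)) k - av u k| ≤ (2 * M) * (1 / ((k : ℝ) + 1)) := by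
        intro k
        simp only [av]
        rw [← sub_div, abs_div, abs_of_pos (hpos k), div_le_iff₀ (hpos k)]
        set B := h.ball 1 (R k) with hB
        set B' := B.map ⟨fun x => x * s, mul_left_injective s⟩ with hB'
        have e1 : ∑ x ∈ B, u (x * s) = ∑ x ∈ B', u x := by
          rw [hB', Finset.sum_map]; rfl
        have hc : B'.card = B.card := Finset.card_map _
        have hsub : B' ∪ B ⊆ h.ball 1 (R k + 1) := by
          apply Finset.union_subset
          · intro y hy
            obtain ⟨x, hx, rfl⟩ := Finset.mem_map.mp hy
            rw [h.mem_ball_one]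
            have := h.mul x s
            have h1 := h.gen s hs
            have h2 := h.mem_ball_one.mp hx
            simp only [Function.Embedding.coeFn_mk]
            omega
          · exact h.ball_mono 1 (by omega)
        have hcu : (B' ∪ B).card ≤ (h.ball 1 (R k + 1)).card := Finset.card_le_card hsub
        have hcu' : ((B' ∪ B).card : ℝ) ≤ (1 + 1 / ((k : ℝ) + 1)) * B.card :=
          (by exact_mod_cast hcu : ((B' ∪ B).card : ℝ) ≤ _).trans (hR k)
        have d1 : (B' \ B).card + B.card = (B' ∪ B).card := by
          rw [Finset.card_sdiff_add_card]
        have d2 : (B \ B').card + B'.card = (B' ∪ B).card := by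
          rw [Finset.card_sdiff_add_card, Finset.union_comm]
        have e2 : ∑ x ∈ B', u x - ∑ x ∈ B, u x = ∑ x ∈ B' \ B, u x - ∑ x ∈ B \ B', u x := by
          rw [← Finset.sum_sdiff_sub_sum_sdiff]
        have b1 : |∑ x ∈ B' \ B, u x| ≤ (B' \ B).card * M := by
          rw [← nsmul_eq_mul]
          exact (Finset.abs_sum_le_sum_abs _ _).trans (Finset.sum_le_card_nsmul _ _ _ fun x _ => hM x)
        have b2 : |∑ x ∈ B \ B', u x| ≤ (B \ B').card * M := by
          rw [← nsmul_eq_mul]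
          exact (Finset.abs_sum_le_sum_abs _ _).trans (Finset.sum_le_card_nsmul _ _ _ fun x _ => hM x)
        have hM0 : 0 ≤ M := (abs_nonneg _).trans (hM 1)
        have d1' : ((B' \ B).card : ℝ) ≤ (1 / ((k : ℝ) + 1)) * B.card := by
          have : ((B' \ B).card : ℝ) + B.card = (B' ∪ B).card := by exact_mod_cast d1
          linarith
        have d2' : ((B \ B').card : ℝ) ≤ (1 / ((k : ℝ) + 1)) * B.card := by
          have : ((B \ B').card : ℝ) + B.card = (B' ∪ B).card := by rw [← hc]; exact_mod_cast d2
          linarith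
        rw [e1, e2]
        calc _ ≤ _ := abs_sub _ _
          _ ≤ (B' \ B).card * M + (B \ B').card * M := add_le_add b1 b2
          _ ≤ ((1 / ((k : ℝ) + 1)) * B.card) * M + ((1 / ((k : ℝ) + 1)) * B.card) * M := by gcongr
          _ = _ := by ring
      have hz : Filter.Tendsto (fun k : ℕ => (2 * M) * (1 / ((k : ℝ) + 1))) 𝒰 (nhds 0) := by
        have := (tendsto_one_div_add_atTop_nhds_zero_nat (𝕜 := ℝ)).const_mul (2 * M)
        rw [mul_zero] at this
        exact this.mono_left Nat.hyperfilter_le_atTop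
      have hd := (hm _ hus).sub (hm u ⟨M, hM⟩)
      have := squeeze_zero_norm (f := fun k => av (fun x => u (x * s)) k - av u k) hbound hz
      exact sub_eq_zero.mp (tendsto_nhds_unique hd this)
    have : ∀ n g, ℓ g = n → ∀ u, Bdd u → m (fun x => u (x * g)) = m u := by
      intro n
      induction n with
      | zero =>
        intro g hg u hu
        rw [h.eq_one g hg]; simp
      | succ n ih =>
        intro g hg u hu
        obtain ⟨k, s, hs, hk, rfl⟩ := h.succ g n hg
        have hus : Bdd (fun x => u (x * s)) := by
          obtain ⟨M, hM⟩ := hu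
          exact ⟨M, fun x => hM _⟩
        have := ih k hk (fun x => u (x * s)) hus
        rw [hS s hs u hu] at this
        simpa [mul_assoc] using this
    intro g u hu
    exact this _ g rfl u hu


theorem completion_rep {Γ V : Type} [Group Γ] [SeminormedAddCommGroup V] [InnerProductSpace ℝ V]
    (ρ : Γ →* (V →ₗ[ℝ] V)) (hρ : ∀ g v, ‖ρ g v‖ = ‖v‖) (b : Γ → V)
    (hb : ∀ g h, b (g * h) = b g + ρ g (b h)) :
    ∃ (H : Type) (_ : NormedAddCommGroup H) (_ : InnerProductSpace ℝ H) (_ : CompleteSpace H)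
      (π : Γ →* (H →ₗ[ℝ] H)) (b' : Γ → H), (∀ g v, ‖π g v‖ = ‖v‖) ∧
      (∀ g h, b' (g * h) = b' g + π g (b' h)) ∧ (∀ g, ‖b' g‖ = ‖b g‖) := by
  let ρc : Γ → V →L[ℝ] V := fun g => (⟨ρ g, hρ g⟩ : V →ₗᵢ[ℝ] V).toContinuousLinearMap
  have hρc : ∀ g v, ρc g v = ρ g v := fun _ _ => rfl
  let P : Γ → UniformSpace.Completion V →L[ℝ] UniformSpace.Completion V := fun g => (ρc g).completion
  have hP : ∀ g (v : V), P g (v : UniformSpace.Completion V) = ((ρ g v : V) : UniformSpace.Completion V) :=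
    fun g v => (ρc g).completion_apply_coe v
  let π : Γ →* (UniformSpace.Completion V →ₗ[ℝ] UniformSpace.Completion V) :=
    { toFun := fun g => (P g).toLinearMap
      map_one' := by
        ext x
        change P 1 x = x
        induction x using UniformSpace.Completion.induction_on with
        | hp => exact isClosed_eq (P 1).continuous continuous_id
        | ih x => rw [hP, map_one]; rfl
      map_mul' := by
        intro g h
        ext x
        change P (g * h) x = P g (P h x)
        induction x using UniformSpace.Completion.induction_on with
        | hp => exact isClosed_eq (P _).continuous ((P g).continuous.comp (P h).continuous)
        | ih x => rw [hP, hP, hP, map_mul]; rfl }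
  refine ⟨UniformSpace.Completion V, inferInstance, inferInstance, inferInstance, π,
    fun g => (b g : UniformSpace.Completion V), ?_, ?_, ?_⟩
  · intro g x
    change ‖P g x‖ = ‖x‖
    induction x using UniformSpace.Completion.induction_on with
    | hp => exact isClosed_eq (P g).continuous.norm continuous_norm
    | ih x => rw [hP, UniformSpace.Completion.norm_coe, UniformSpace.Completion.norm_coe, hρ]
  · intro g h
    change _ = _ + P g _
    simp only []
    rw [hP, hb, UniformSpace.Completion.coe_add]
  · intro g
    exact UniformSpace.Completion.norm_coe _

theorem core_rep {Γ V : Type} [Group Γ] [AddCommGroup V] [Module ℝ V]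
    (core : PreInnerProductSpace.Core ℝ V)
    (ρ : Γ →* (V →ₗ[ℝ] V)) (hρ : ∀ g v, core.inner (ρ g v) (ρ g v) = core.inner v v) (b : Γ → V)
    (hb : ∀ g h, b (g * h) = b g + ρ g (b h)) :
    ∃ (H : Type) (_ : NormedAddCommGroup H) (_ : InnerProductSpace ℝ H) (_ : CompleteSpace H)
      (π : Γ →* (H →ₗ[ℝ] H)) (b' : Γ → H), (∀ g v, ‖π g v‖ = ‖v‖) ∧
      (∀ g h, b' (g * h) = b' g + π g (b' h)) ∧ (∀ g, ‖b' g‖ ^ 2 = core.inner (b g) (b g)) := by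
  let i1 : SeminormedAddCommGroup V := @InnerProductSpace.Core.toSeminormedAddCommGroup ℝ V _ _ _ core
  let i2 : InnerProductSpace ℝ V := InnerProductSpace.ofCore core
  have hn : ∀ v : V, ‖v‖ ^ 2 = core.inner v v := fun v => by
    rw [← real_inner_self_eq_norm_sq]
  obtain ⟨H, j1, j2, j3, π, b', h1, h2, h3⟩ := completion_rep ρ (fun g v => by
    have : ‖ρ g v‖ ^ 2 = ‖v‖ ^ 2 := by rw [hn, hn, hρ]
    exact (pow_left_inj₀ (norm_nonneg _) (norm_nonneg _) two_ne_zero).mp this) b hb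
  exact ⟨H, j1, j2, j3, π, b', h1, h2, fun g => by rw [h3, hn]⟩

theorem exists_rep {Γ : Type} [Group Γ] {E : Type} [NormedAddCommGroup E] [InnerProductSpace ℝ E]
    (m : (Γ → ℝ) → ℝ) (madd : ∀ u v, Bdd u → Bdd v → m (fun x => u x + v x) = m u + m v)
    (mmul : ∀ (c : ℝ) u, Bdd u → m (fun x => c * u x) = c * m u)
    (mmono : ∀ u v, Bdd u → Bdd v → (∀ x, u x ≤ v x) → m u ≤ m v)
    (mconst : ∀ c : ℝ, m (fun _ => c) = c)
    (minv : ∀ g u, Bdd u → m (fun x => u (x * g)) = m u)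
    (f : Γ → E) (lo hi : Γ → ℝ) (hlo : ∀ g x, lo g ≤ ‖f (x * g) - f x‖)
    (hhi : ∀ g x, ‖f (x * g) - f x‖ ≤ hi g) :
    ∃ (H : Type) (_ : NormedAddCommGroup H) (_ : InnerProductSpace ℝ H) (_ : CompleteSpace H)
      (π : Γ →* (H →ₗ[ℝ] H)) (b : Γ → H), (∀ g v, ‖π g v‖ = ‖v‖) ∧
      (∀ g h, b (g * h) = b g + π g (b h)) ∧ (∀ g, lo g ≤ ‖b g‖) ∧ (∀ g, ‖b g‖ ≤ hi g) := by
  let V : Submodule ℝ (Γ → E) :=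
    { carrier := {u | ∃ M : ℝ, ∀ x, ‖u x‖ ≤ M}
      add_mem' := by
        rintro u v ⟨M, hM⟩ ⟨M', hM'⟩
        exact ⟨M + M', fun x => (norm_add_le _ _).trans (add_le_add (hM x) (hM' x))⟩
      zero_mem' := ⟨0, fun x => by simp⟩
      smul_mem' := by
        rintro c u ⟨M, hM⟩
        refine ⟨|c| * M, fun x => ?_⟩
        rw [Pi.smul_apply, norm_smul]
        exact mul_le_mul_of_nonneg_left (hM x) (norm_nonneg _) }
  have hB : ∀ u v : V, Bdd (fun x => (inner ℝ (u.1 x) (v.1 x) : ℝ)) := by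
    rintro ⟨u, M, hM⟩ ⟨v, M', hM'⟩
    refine ⟨M * M', fun x => (abs_real_inner_le_norm _ _).trans ?_⟩
    exact mul_le_mul (hM x) (hM' x) (norm_nonneg _) ((norm_nonneg _).trans (hM x))
  have hBc : ∀ c : ℝ, Bdd (fun _ : Γ => c) := fun c => ⟨|c|, fun _ => le_rfl⟩
  let core : PreInnerProductSpace.Core ℝ V :=
    { inner := fun u v => m (fun x => inner ℝ (u.1 x) (v.1 x))
      conj_inner_symm := by
        intro u v
        simp only [conj_trivial]
        congr 1; funext x; exact real_inner_comm _ _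
      re_inner_nonneg := by
        intro u
        simp only [RCLike.re_to_real]
        rw [← mconst 0]
        exact mmono _ _ (hBc 0) (hB u u) fun x => real_inner_self_nonneg
      add_left := by
        intro u v w
        rw [← madd _ _ (hB u w) (hB v w)]
        congr 1; funext x; exact inner_add_left _ _ _
      smul_left := by
        intro u v r
        simp only [conj_trivial]
        rw [← mmul r _ (hB u v)]
        congr 1; funext x; exact real_inner_smul_left _ _ _ }
  have hcore : ∀ u v, core.inner u v = m (fun x => inner ℝ (u.1 x) (v.1 x)) := fun _ _ => rfl
  let ρ : Γ →* (V →ₗ[ℝ] V) :=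
    { toFun := fun g =>
        { toFun := fun u => ⟨fun x => u.1 (x * g), by
            obtain ⟨M, hM⟩ := u.2
            exact ⟨M, fun x => hM _⟩⟩
          map_add' := fun u v => rfl
          map_smul' := fun c u => rfl }
      map_one' := by
        ext u x
        change u.1 (x * 1) = u.1 x
        rw [mul_one]
      map_mul' := by
        intro g h
        ext u x
        change u.1 (x * (g * h)) = u.1 (x * g * h)
        rw [mul_assoc] }
  let b : Γ → V := fun g => ⟨fun x => f (x * g) - f x, hi g, fun x => hhi g x⟩
  obtain ⟨H, j1, j2, j3, π, b', h1, h2, h3⟩ := core_rep core ρ (by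
    intro g v
    rw [hcore, hcore]
    exact minv g _ (hB v v)) b (by
    intro g h
    apply Subtype.ext
    funext x
    change f (x * (g * h)) - f x = (f (x * g) - f x) + (f (x * g * h) - f (x * g))
    rw [mul_assoc]; abel)
  have hhi0 : ∀ g, 0 ≤ hi g := fun g => (norm_nonneg _).trans (hhi g 1)
  refine ⟨H, j1, j2, j3, π, b', h1, h2, ?_, ?_⟩
  · intro g
    rcases le_total (lo g) 0 with h0 | h0
    · exact h0.trans (norm_nonneg _)
    · refine le_of_sq_le_sq ?_ (norm_nonneg _)
      rw [h3, hcore, ← mconst (lo g ^ 2)]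
      refine mmono _ _ (hBc _) (hB _ _) fun x => ?_
      rw [real_inner_self_eq_norm_sq]
      exact pow_le_pow_left₀ h0 (hlo g x) 2
  · intro g
    refine le_of_sq_le_sq ?_ (hhi0 g)
    rw [h3, hcore, ← mconst (hi g ^ 2)]
    refine mmono _ _ (hB _ _) (hBc _) fun x => ?_
    rw [real_inner_self_eq_norm_sq]
    exact pow_le_pow_left₀ (norm_nonneg _) (hhi g x) 2


theorem WLen.cocycle_bound {Γ : Type} [Group Γ] {S : Finset Γ} {ℓ : Γ → ℕ} (h : WLen S ℓ)
    {H : Type} [NormedAddCommGroup H] [InnerProductSpace ℝ H]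
    (π : Γ →* (H →ₗ[ℝ] H)) (hπ : ∀ g v, ‖π g v‖ = ‖v‖) (b : Γ → H)
    (hb : ∀ g h, b (g * h) = b g + π g (b h)) (M : ℝ) (hM : ∀ s ∈ S, ‖b s‖ ≤ M) (g : Γ) :
    ‖b g‖ ≤ M * ℓ g := by
  have : ∀ n g, ℓ g = n → ‖b g‖ ≤ M * n := by
    intro n
    induction n with
    | zero =>
      intro g hg
      rw [h.eq_one g hg]
      have := hb 1 1
      simp only [mul_one, map_one, Module.End.one_apply] at this
      have : b 1 = 0 := by simpa using this
      simp [this]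
    | succ n ih =>
      intro g hg
      obtain ⟨k, s, hs, hk, rfl⟩ := h.succ g n hg
      rw [hb]
      have h1 := norm_add_le (b k) (π k (b s))
      rw [hπ] at h1
      have h2 := ih k hk
      have h3 := hM s hs
      push_cast
      linarith
  exact this _ g rfl

theorem inner_of_isom {H : Type} [NormedAddCommGroup H] [InnerProductSpace ℝ H]
    (T : H →ₗ[ℝ] H) (hT : ∀ v, ‖T v‖ = ‖v‖) (v w : H) : inner ℝ (T v) (T w) = inner ℝ v w :=
  LinearIsometry.inner_map_map ⟨T, hT⟩ v w

theorem WLen.harmonic {Γ : Type} [Group Γ] {S : Finset Γ} {ℓ : Γ → ℕ} (h : WLen S ℓ)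
    {H : Type} [NormedAddCommGroup H] [InnerProductSpace ℝ H] [CompleteSpace H]
    (π : Γ →* (H →ₗ[ℝ] H)) (hπ : ∀ g v, ‖π g v‖ = ‖v‖) (b : Γ → H)
    (hb : ∀ g h, b (g * h) = b g + π g (b h)) (c C : ℝ) (hc : 0 < c)
    (hlow : ∀ g, c * ℓ g - C ≤ ‖b g‖) :
    ∃ b' : Γ → H, (∀ g h, b' (g * h) = b' g + π g (b' h)) ∧ (∑ s ∈ S, b' s = 0) ∧
      (∀ R : ℝ, {g | ‖b' g‖ ≤ R}.Finite) := by
  classical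
  have hcancel : ∀ g v, π g⁻¹ (π g v) = v := by
    intro g v
    rw [← Module.End.mul_apply, ← map_mul]; simp
  let T : H →ₗ[ℝ] PiLp 2 (fun _ : S => H) :=
    (WithLp.linearEquiv 2 ℝ (S → H)).symm.toLinearMap ∘ₗ
      LinearMap.pi (fun s : S => π s.1 - LinearMap.id)
  have hT : ∀ v s, T v s = π s.1 v - v := fun v s => rfl
  let bS : PiLp 2 (fun _ : S => H) := WithLp.toLp 2 (fun s : S => b s.1)
  have hbS : ∀ s, bS s = b s.1 := fun s => rfl
  let K : Submodule ℝ (PiLp 2 (fun _ : S => H)) := (LinearMap.range T).topologicalClosure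
  have : CompleteSpace K := (Submodule.isClosed_topologicalClosure _).completeSpace_coe
  let p : PiLp 2 (fun _ : S => H) := K.orthogonalProjectionOnto bS
  have hpK : p ∈ closure (LinearMap.range T : Set (PiLp 2 (fun _ : S => H))) :=
    (K.orthogonalProjectionOnto bS).2
  obtain ⟨w, hwmem, hwlim⟩ := mem_closure_iff_seq_limit.mp hpK
  choose v hv using hwmem
  have hvlim : Filter.Tendsto (fun k => T (v k)) Filter.atTop (nhds p) := by
    simpa only [hv] using hwlim
  -- coboundaries
  let d : H → Γ → H := fun v g => π g v - v
  have hd : ∀ v g k, d v (g * k) = d v g + π g (d v k) := by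
    intro v g k
    simp only [d, map_mul, Module.End.mul_apply, map_sub]
    abel
  have hdT : ∀ v g, ‖d v g‖ ≤ ‖T v‖ * ℓ g := by
    intro v g
    refine h.cocycle_bound π hπ (d v) (hd v) ‖T v‖ ?_ g
    intro s hs
    exact PiLp.norm_apply_le (T v) ⟨s, hs⟩
  have hdsub : ∀ v w g, d v g - d w g = d (v - w) g := by
    intro v w g
    simp only [d, map_sub]; abel
  have hcauchy : ∀ g, CauchySeq (fun k => d (v k) g) := by
    intro g
    rw [Metric.cauchySeq_iff]
    intro ε hε
    have := Metric.cauchySeq_iff.mp hvlim.cauchySeq (ε / (ℓ g + 1)) (by positivity)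
    obtain ⟨K0, hK0⟩ := this
    refine ⟨K0, fun i hi j hj => ?_⟩
    have h1 := hK0 i hi j hj
    rw [dist_eq_norm, ← map_sub] at h1
    rw [dist_eq_norm, hdsub]
    calc _ ≤ ‖T (v i - v j)‖ * ℓ g := hdT _ _
      _ ≤ ‖T (v i - v j)‖ * (ℓ g + 1) := by gcongr; linarith
      _ < ε := by rwa [lt_div_iff₀ (by positivity)] at h1
  choose β hβ using fun g => cauchySeq_tendsto_of_complete (hcauchy g)
  have hβcoc : ∀ g k, β (g * k) = β g + π g (β k) := by
    intro g k
    refine tendsto_nhds_unique (hβ (g * k)) ?_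
    have hcont : Continuous (π g) := (⟨π g, hπ g⟩ : H →ₗᵢ[ℝ] H).continuous
    refine ((hβ g).add ((hcont.tendsto _).comp (hβ k))).congr fun j => ?_
    rw [hd]; rfl
  have hβS : ∀ s : S, β s.1 = p s := by
    intro s
    refine tendsto_nhds_unique (hβ s.1) ?_
    have hcont : Continuous (fun x : PiLp 2 (fun _ : S => H) => x s) := by fun_prop
    exact (hcont.tendsto _).comp hvlim
  have hb' : ∀ g k, (b (g * k) - β (g * k)) = (b g - β g) + π g (b k - β k) := by
    intro g k
    rw [hb, hβcoc, map_sub]; abel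
  refine ⟨fun g => b g - β g, hb', ?_, ?_⟩
  · have horth : ∀ x, ∑ s : S, inner ℝ (π s.1 x - x) (b s.1 - β s.1) = 0 := by
      intro x
      have h1 : T x ∈ K := Submodule.le_topologicalClosure _ ⟨x, rfl⟩
      have h2 : bS - p ∈ Kᗮ := Submodule.sub_starProjection_mem_orthogonal bS
      have h3 := (Submodule.mem_orthogonal K _).mp h2 _ h1
      rw [PiLp.inner_apply] at h3
      rw [← h3]
      refine Finset.sum_congr rfl fun s _ => ?_
      rw [hT, PiLp.sub_apply, hbS, hβS]
    have hone : b 1 - β 1 = 0 := by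
      have := hb' 1 1
      simp only [mul_one, map_one, Module.End.one_apply] at this
      simpa using this
    have hinv : ∀ g, π g⁻¹ (b g - β g) = - (b g⁻¹ - β g⁻¹) := by
      intro g
      have := hb' g⁻¹ g
      rw [inv_mul_cancel, hone] at this
      exact (neg_eq_of_add_eq_zero_right this.symm).symm
    set y := ∑ s ∈ S, (b s - β s) with hy
    have hyinv : ∑ s ∈ S, (b s⁻¹ - β s⁻¹) = y := by
      rw [hy]
      exact Finset.sum_nbij' (fun s => s⁻¹) (fun s => s⁻¹) (fun s hs => h.symm s hs)
        (fun s hs => h.symm s hs) (by simp) (by simp) (by simp)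
    have h4 := horth y
    rw [Finset.sum_coe_sort S (fun s => inner ℝ (π s y - y) (b s - β s))] at h4
    have h5 : ∀ s ∈ S, inner ℝ (π s y - y) (b s - β s) =
        - inner ℝ y (b s⁻¹ - β s⁻¹) - inner ℝ y (b s - β s) := by
      intro s _
      rw [inner_sub_left]
      congr 1
      rw [← inner_of_isom (π s⁻¹) (hπ _), hcancel, hinv, inner_neg_right]
    rw [Finset.sum_congr rfl h5, Finset.sum_sub_distrib, Finset.sum_neg_distrib, ← inner_sum,
      ← inner_sum, hyinv, ← hy] at h4
    have : inner ℝ y y = 0 := by linarith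
    exact inner_self_eq_zero.mp this
  · intro R
    obtain ⟨k, hk⟩ := ((Metric.tendsto_atTop.mp hvlim) (c / 2) (by positivity)).imp
      fun k hk => hk k le_rfl
    have hβb : ∀ g, ‖β g‖ ≤ (c / 2) * ℓ g + 2 * ‖v k‖ := by
      intro g
      have hcoc : ∀ g j, (β (g * j) - d (v k) (g * j)) = (β g - d (v k) g) + π g (β j - d (v k) j) := by
        intro g j
        rw [hd, hβcoc, map_sub (π g) (β j)]; abel
      have h1 := h.cocycle_bound π hπ (fun g => β g - d (v k) g) hcoc (c / 2) (by
        intro s hs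
        have := PiLp.norm_apply_le (T (v k) - p) ⟨s, hs⟩
        rw [PiLp.sub_apply, ← hβS, hT] at this
        rw [dist_eq_norm] at hk
        rw [norm_sub_rev]
        exact this.trans hk.le) g
      have h2 : ‖d (v k) g‖ ≤ 2 * ‖v k‖ := by
        have := norm_sub_le (π g (v k)) (v k)
        rw [hπ] at this
        simp only [d]; linarith
      have h3 : ‖β g‖ ≤ ‖β g - d (v k) g‖ + ‖d (v k) g‖ := by
        simpa using norm_add_le (β g - d (v k) g) (d (v k) g)
      linarith
    obtain ⟨n, hn⟩ := exists_nat_ge ((R + C + 2 * ‖v k‖) / (c / 2))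
    apply (h.finite n).subset
    intro g hg
    have h1 := hlow g
    have h2 := hβb g
    have h3 : ‖b g‖ ≤ ‖b g - β g‖ + ‖β g‖ := by simpa using norm_add_le (b g - β g) (β g)
    have h4 : ‖b g - β g‖ ≤ R := hg
    rw [div_le_iff₀ (by positivity)] at hn
    have h5 : (c / 2) * ℓ g ≤ n * (c / 2) := by linarith
    have h6 : (ℓ g : ℝ) ≤ n := by
      rw [mul_comm] at h5
      exact le_of_mul_le_mul_right h5 (by positivity)
    exact_mod_cast h6

/-- From a quasi-isometric embedding to a finite-dimensional proper isometric action. -/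
theorem WLen.finite_dim_action {Γ : Type} [Group Γ] {S : Finset Γ} {ℓ : Γ → ℕ} (h : WLen S ℓ)
    {d : ℕ} (f : Γ → EuclideanSpace ℝ (Fin d)) (c C L : ℝ) (hc : 0 < c) (hL : 0 < L)
    (hlow : ∀ x y, c * ℓ (x⁻¹ * y) - C ≤ ‖f x - f y‖)
    (hup : ∀ x y, ‖f x - f y‖ ≤ L * ℓ (x⁻¹ * y)) :
    ∃ (W : Type) (_ : NormedAddCommGroup W) (_ : InnerProductSpace ℝ W) (_ : FiniteDimensional ℝ W)
      (π : Γ →* (W →ₗ[ℝ] W)) (b : Γ → W), (∀ g v, ‖π g v‖ = ‖v‖) ∧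
      (∀ g h, b (g * h) = b g + π g (b h)) ∧ (∀ R : ℝ, {g | ‖b g‖ ≤ R}.Finite) := by
  obtain ⟨r0, N, hr0, hp⟩ := packing_of_embedding f c C L hc hL.le hlow hup
  obtain ⟨m, m1, m2, m3, m4, m5⟩ := h.exists_mean hr0 hp
  obtain ⟨H, i1, i2, i3, π, b, hπ, hb, hlo, hhi⟩ := exists_rep m m1 m2 m3 m4 m5 f
    (fun g => c * ℓ g - C) (fun g => L * ℓ g)
    (fun g x => by
      have := hlow x (x * g)
      rw [norm_sub_rev] at this
      simpa using this)
    (fun g x => by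
      have := hup x (x * g)
      rw [norm_sub_rev] at this
      simpa using this)
  obtain ⟨b', hb', hharm, hfin⟩ := h.harmonic π hπ b hb c C hc hlo
  have hLip := h.cocycle_bound π hπ b' hb' (∑ s ∈ S, ‖b' s‖) (fun s hs =>
    Finset.single_le_sum (f := fun s => ‖b' s‖) (fun _ _ => norm_nonneg _) hs)
  have hfd := h.finite_span hp b' _ hLip (by
    intro x
    have : ∀ s ∈ S, b' (x * s) - b' x = π x (b' s) := by
      intro s _; rw [hb']; abel
    rw [Finset.sum_congr rfl this, ← map_sum, hharm, map_zero])
  have hinv : ∀ g, ∀ w ∈ Submodule.span ℝ (Set.range b'), π g w ∈ Submodule.span ℝ (Set.range b') := by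
    intro g w hw
    induction hw using Submodule.span_induction with
    | mem w hw =>
      obtain ⟨x, rfl⟩ := hw
      have : π g (b' x) = b' (g * x) - b' g := by rw [hb']; abel
      rw [this]
      exact Submodule.sub_mem _ (Submodule.subset_span ⟨_, rfl⟩) (Submodule.subset_span ⟨_, rfl⟩)
    | zero => rw [map_zero]; exact Submodule.zero_mem _
    | add w1 w2 _ _ h1 h2 => rw [map_add]; exact Submodule.add_mem _ h1 h2
    | smul c w _ h1 => rw [map_smul]; exact Submodule.smul_mem _ _ h1
  let π' : Γ →* (Submodule.span ℝ (Set.range b') →ₗ[ℝ] Submodule.span ℝ (Set.range b')) :=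
    { toFun := fun g => (π g).restrict (hinv g)
      map_one' := by
        ext w
        simp
      map_mul' := by
        intro g k
        ext w
        simp }
  refine ⟨Submodule.span ℝ (Set.range b'), inferInstance, inferInstance, hfd, π',
    fun g => ⟨b' g, Submodule.subset_span ⟨g, rfl⟩⟩, ?_, ?_, hfin⟩
  · intro g w
    exact hπ g w.1
  · intro g k
    exact Subtype.ext (hb' g k)


open scoped commutatorElement

/-- iterated commutators with generators -/
def commSet {N : Type} [Group N] (S : Set N) : ℕ → Set N
  | 0 => S
  | k + 1 => {x | ∃ z ∈ commSet S k, ∃ s ∈ S, x = ⁅z, s⁆}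

theorem exists_finite_gen {N : Type} [Group N] [hfg : Group.FG N] (T : Set N)
    (hT : Subgroup.closure T = ⊤) : ∃ t : Set N, t.Finite ∧ t ⊆ T ∧ Subgroup.closure t = ⊤ := by
  classical
  have key : ∀ x ∈ Subgroup.closure T, ∃ t : Set N, t.Finite ∧ t ⊆ T ∧ x ∈ Subgroup.closure t := by
    intro x hx
    induction hx using Subgroup.closure_induction with
    | mem x hx => exact ⟨{x}, Set.finite_singleton x, by simpa using hx,
        Subgroup.subset_closure (Set.mem_singleton x)⟩
    | one => exact ⟨∅, Set.finite_empty, Set.empty_subset _, Subgroup.one_mem _⟩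
    | mul x y _ _ h1 h2 =>
      obtain ⟨t1, a1, b1, c1⟩ := h1
      obtain ⟨t2, a2, b2, c2⟩ := h2
      exact ⟨t1 ∪ t2, a1.union a2, Set.union_subset b1 b2, Subgroup.mul_mem _
        (Subgroup.closure_mono Set.subset_union_left c1) (Subgroup.closure_mono Set.subset_union_right c2)⟩
    | inv x _ h1 =>
      obtain ⟨t1, a1, b1, c1⟩ := h1
      exact ⟨t1, a1, b1, Subgroup.inv_mem _ c1⟩
  obtain ⟨F, hF⟩ := hfg.out
  choose t h1 h2 h3 using fun x : N => key x (by rw [hT]; trivial)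
  refine ⟨⋃ x ∈ F, t x, F.finite_toSet.biUnion fun x _ => h1 x, Set.iUnion₂_subset fun x _ => h2 x, ?_⟩
  rw [eq_top_iff, ← hF, Subgroup.closure_le]
  intro x hx
  exact Subgroup.closure_mono (Set.subset_biUnion_of_mem (u := t) hx) (h3 x)

section
variable {N W : Type} [Group N] [NormedAddCommGroup W] [InnerProductSpace ℝ W]

theorem cocycle_one (π : N →* (W →ₗ[ℝ] W)) (b : N → W)
    (hb : ∀ g h, b (g * h) = b g + π g (b h)) : b 1 = 0 := by
  have := hb 1 1
  simp only [mul_one, map_one, Module.End.one_apply] at this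
  simpa using this

theorem rep_inv (π : N →* (W →ₗ[ℝ] W)) (g : N) (v : W) : π g⁻¹ (π g v) = v := by
  rw [← Module.End.mul_apply, ← map_mul]; simp

theorem rep_inv' (π : N →* (W →ₗ[ℝ] W)) (g : N) (v : W) : π g (π g⁻¹ v) = v := by
  rw [← Module.End.mul_apply, ← map_mul]; simp

theorem comm_estimate (π : N →* (W →ₗ[ℝ] W)) (hπ : ∀ g v, ‖π g v‖ = ‖v‖) (b : N → W)
    (hb : ∀ g h, b (g * h) = b g + π g (b h)) (z s : N) (α ε β L : ℝ) (hα : 0 ≤ α) (hε : 0 ≤ ε)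
    (hz : ∀ v, ‖π z v - v‖ ≤ α * ‖v‖) (hs : ∀ v, ‖π s v - v‖ ≤ ε * ‖v‖) (hbz : ‖b z‖ ≤ β)
    (hbs : ‖b s‖ ≤ L) :
    (∀ v, ‖π ⁅z, s⁆ v - v‖ ≤ 2 * α * ε * ‖v‖) ∧
      ‖b ⁅z, s⁆‖ ≤ α * L + ε * β + 2 * α * ε * (L + β) := by
  have hcomm : ⁅z, s⁆ * (s * z) = z * s := by rw [commutatorElement_def]; group
  have h1 : ∀ v, ‖π ⁅z, s⁆ v - v‖ ≤ 2 * α * ε * ‖v‖ := by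
    intro v
    have hv : ‖v‖ = ‖π (s * z)⁻¹ v‖ := (hπ _ _).symm
    set w := π (s * z)⁻¹ v with hw
    have hv' : v = π (s * z) w := (rep_inv' π _ v).symm
    have e1 : π ⁅z, s⁆ v - v = (π z (π s w - w) - (π s w - w)) - (π s (π z w - w) - (π z w - w)) := by
      have : π ⁅z, s⁆ v = π (z * s) w := by
        rw [hv', ← Module.End.mul_apply, ← map_mul, hcomm]
      rw [this, hv', map_mul, map_mul]
      simp only [Module.End.mul_apply, map_sub]
      abel
    rw [e1, hv]
    calc _ ≤ ‖π z (π s w - w) - (π s w - w)‖ + ‖π s (π z w - w) - (π z w - w)‖ := norm_sub_le _ _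
      _ ≤ α * ‖π s w - w‖ + ε * ‖π z w - w‖ := add_le_add (hz _) (hs _)
      _ ≤ α * (ε * ‖w‖) + ε * (α * ‖w‖) := by gcongr; exact hs w; exact hz w
      _ = _ := by ring
  refine ⟨h1, ?_⟩
  have e2 : b ⁅z, s⁆ = (π z (b s) - b s) - (π s (b z) - b z) - (π ⁅z, s⁆ (b (s * z)) - b (s * z)) := by
    have := hb ⁅z, s⁆ (s * z)
    rw [hcomm, hb z s] at this
    have h3 : b ⁅z, s⁆ = b z + π z (b s) - π ⁅z, s⁆ (b (s * z)) := by rw [this]; abel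
    rw [h3]
    generalize π ⁅z, s⁆ (b (s * z)) = y
    rw [hb s z]
    abel
  have h4 : ‖b (s * z)‖ ≤ L + β := by
    rw [hb]
    have := norm_add_le (b s) (π s (b z))
    rw [hπ] at this
    linarith
  rw [e2]
  calc _ ≤ ‖(π z (b s) - b s) - (π s (b z) - b z)‖ + ‖π ⁅z, s⁆ (b (s * z)) - b (s * z)‖ := norm_sub_le _ _
    _ ≤ (‖π z (b s) - b s‖ + ‖π s (b z) - b z‖) + ‖π ⁅z, s⁆ (b (s * z)) - b (s * z)‖ := by
        gcongr; exact norm_sub_le _ _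
    _ ≤ (α * ‖b s‖ + ε * ‖b z‖) + 2 * α * ε * ‖b (s * z)‖ := by
        gcongr; exact hz _; exact hs _; exact h1 _
    _ ≤ _ := by gcongr

theorem commSet_trivial (π : N →* (W →ₗ[ℝ] W)) (hπ : ∀ g v, ‖π g v‖ = ‖v‖) (b : N → W)
    (hb : ∀ g h, b (g * h) = b g + π g (b h)) (hfin : ∀ R : ℝ, {g | ‖b g‖ ≤ R}.Finite)
    (S : Set N) (hS : S.Finite) (hrot : ∀ s ∈ S, ∀ v, ‖π s v - v‖ ≤ (1 / 8) * ‖v‖) :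
    ∃ K, ∀ z ∈ commSet S K, b z = 0 ∧ ∀ v, π z v = v := by
  obtain ⟨L, hL⟩ : ∃ L : ℝ, ∀ s ∈ S, ‖b s‖ ≤ L := by
    obtain ⟨L, hL⟩ := (hS.image (fun s => ‖b s‖)).bddAbove
    exact ⟨L, fun s hs => hL ⟨s, hs, rfl⟩⟩
  wlog hL0 : 0 ≤ L generalizing L
  · exact this (max L 0) (fun s hs => (hL s hs).trans (le_max_left _ _)) (le_max_right _ _)
  have hest : ∀ k, ∀ z ∈ commSet S k, (∀ v, ‖π z v - v‖ ≤ (1 / 8) * (1 / 4) ^ k * ‖v‖) ∧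
      ‖b z‖ ≤ L * (1 / 2) ^ k := by
    intro k
    induction k with
    | zero =>
      intro z hz
      refine ⟨fun v => ?_, ?_⟩
      · simpa using hrot z hz v
      · simpa using hL z hz
    | succ k ih =>
      rintro x ⟨z, hz, s, hs, rfl⟩
      obtain ⟨i1, i2⟩ := ih z hz
      obtain ⟨j1, j2⟩ := comm_estimate π hπ b hb z s ((1 / 8) * (1 / 4) ^ k) (1 / 8)
        (L * (1 / 2) ^ k) L (by positivity) (by norm_num) i1 (hrot s hs) i2 (hL s hs)
      refine ⟨fun v => (j1 v).trans (le_of_eq (by ring)), j2.trans ?_⟩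
      have e : ((1 : ℝ) / 4) ^ k ≤ (1 / 2) ^ k := pow_le_pow_left₀ (by norm_num) (by norm_num) k
      have e1 : ((1 : ℝ) / 2) ^ k ≤ 1 := pow_le_one₀ (by norm_num) (by norm_num)
      have e2 : (0 : ℝ) ≤ (1 / 2) ^ k := by positivity
      have e3 : (0 : ℝ) ≤ (1 / 4) ^ k := by positivity
      rw [pow_succ]
      have f1 : L * (1 / 4) ^ k ≤ L * (1 / 2) ^ k := by gcongr
      have f2 : L * (1 / 2) ^ k ≤ L := mul_le_of_le_one_right hL0 e1
      have f3 : (1 / 4 : ℝ) ^ k * (L + L * (1 / 2) ^ k) ≤ (1 / 4 : ℝ) ^ k * (L + L) := by gcongr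
      have f4 : (0 : ℝ) ≤ L * (1 / 2) ^ k := by positivity
      linarith
  have hev : ∀ᶠ k : ℕ in Filter.atTop, ∀ g ∈ {g | ‖b g‖ ≤ L},
      (∀ v, ‖π g v - v‖ ≤ (1 / 8) * (1 / 4) ^ k * ‖v‖) ∧ ‖b g‖ ≤ L * (1 / 2) ^ k →
        b g = 0 ∧ ∀ v, π g v = v := by
    rw [Filter.eventually_all_finite (hfin L)]
    intro g _
    by_cases hb0 : b g = 0
    · by_cases hv : ∀ v, π g v = v
      · exact Filter.Eventually.of_forall fun k _ => ⟨hb0, hv⟩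
      · push Not at hv
        obtain ⟨v, hv⟩ := hv
        have hlim : Filter.Tendsto (fun k : ℕ => (1 / 8 : ℝ) * (1 / 4) ^ k * ‖v‖) Filter.atTop (nhds 0) := by
          have := ((tendsto_pow_atTop_nhds_zero_of_lt_one (r := (1 / 4 : ℝ)) (by norm_num)
            (by norm_num)).const_mul (1 / 8)).mul_const ‖v‖
          simpa using this
        have hpos : 0 < ‖π g v - v‖ := norm_pos_iff.mpr (sub_ne_zero.mpr hv)
        filter_upwards [hlim.eventually_lt_const hpos] with k hk h
        exact absurd (h.1 v) (not_le.mpr hk)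
    · have hlim : Filter.Tendsto (fun k : ℕ => L * (1 / 2 : ℝ) ^ k) Filter.atTop (nhds 0) := by
        have := (tendsto_pow_atTop_nhds_zero_of_lt_one (r := (1 / 2 : ℝ)) (by norm_num)
            (by norm_num)).const_mul L
        simpa using this
      filter_upwards [hlim.eventually_lt_const (norm_pos_iff.mpr hb0)] with k hk h
      exact absurd h.2 (not_le.mpr hk)
  obtain ⟨K, hK⟩ := hev.exists
  refine ⟨K, fun z hz => hK z ?_ (hest K z hz)⟩
  refine (hest K z hz).2.trans (mul_le_of_le_one_right hL0 ?_)
  exact pow_le_one₀ (by norm_num) (by norm_num)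

/-- affine action on an invariant subspace -/
def affAct (π : N →* (W →ₗ[ℝ] W)) (b : N → W) (hb : ∀ g h, b (g * h) = b g + π g (b h))
    (U : Submodule ℝ W) (hU : ∀ g, ∀ u ∈ U, π g u ∈ U) (hbU : ∀ g, b g ∈ U) :
    N →* Equiv.Perm U where
  toFun g :=
    { toFun := fun u => ⟨π g u + b g, U.add_mem (hU g _ u.2) (hbU g)⟩
      invFun := fun u => ⟨π g⁻¹ u + b g⁻¹, U.add_mem (hU _ _ u.2) (hbU _)⟩
      left_inv := by
        intro u
        apply Subtype.ext
        simp only [map_add, rep_inv]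
        have := hb g⁻¹ g
        rw [inv_mul_cancel, cocycle_one π b hb] at this
        rw [add_assoc, add_comm (π g⁻¹ (b g)), ← this, add_zero]
      right_inv := by
        intro u
        apply Subtype.ext
        simp only [map_add, rep_inv']
        have := hb g g⁻¹
        rw [mul_inv_cancel, cocycle_one π b hb] at this
        rw [add_assoc, add_comm (π g (b g⁻¹)), ← this, add_zero] }
  map_one' := by
    ext u
    simp [cocycle_one π b hb]
  map_mul' := by
    intro g h
    ext u
    simp only [Equiv.coe_fn_mk, Equiv.Perm.coe_mul, Function.comp_apply, map_mul,
      Module.End.mul_apply, map_add, hb]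
    abel

theorem affAct_apply (π : N →* (W →ₗ[ℝ] W)) (b : N → W) (hb : ∀ g h, b (g * h) = b g + π g (b h))
    (U : Submodule ℝ W) (hU : ∀ g, ∀ u ∈ U, π g u ∈ U) (hbU : ∀ g, b g ∈ U) (g : N) (u : U) :
    (affAct π b hb U hU hbU g u : W) = π g u + b g := rfl

theorem fixed_point [FiniteDimensional ℝ W] (π : N →* (W →ₗ[ℝ] W)) (hπ : ∀ g v, ‖π g v‖ = ‖v‖)
    (S : Set N) (hS : Subgroup.closure S = ⊤) (K : ℕ) (n : ℕ) :
    ∀ (U : Submodule ℝ W), Module.finrank ℝ U = n → (∀ g, ∀ u ∈ U, π g u ∈ U) →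
      (∀ u ∈ U, (∀ g, π g u = u) → u = 0) → ∀ (b : N → W),
      (∀ g h, b (g * h) = b g + π g (b h)) → (∀ g, b g ∈ U) →
      (∀ z ∈ commSet S K, b z = 0 ∧ ∀ v, π z v = v) → ∃ v ∈ U, ∀ g, b g = π g v - v := by
  classical
  induction n using Nat.strong_induction_on with
  | _ n ih =>
  intro U hUn hU hfix b hb hbU hK
  set φ := affAct π b hb U hU hbU with hφ
  have hφa : ∀ g (u : U), (φ g u : W) = π g u + b g := fun g u => rfl
  have hφ1 : ∀ g, (b g = 0 ∧ ∀ u ∈ U, π g u = u) → φ g = 1 := by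
    rintro g ⟨h1, h2⟩
    ext u
    rw [hφa, h1, h2 u u.2, add_zero]; rfl
  have hex : ∃ k, ∀ z ∈ commSet S k, φ z = 1 :=
    ⟨K, fun z hz => hφ1 z ⟨(hK z hz).1, fun u _ => (hK z hz).2 u⟩⟩
  have hgen : ∀ (P : Subgroup (Equiv.Perm U)), (∀ s ∈ S, φ s ∈ P) → ∀ g, φ g ∈ P := by
    intro P hP g
    have : Subgroup.closure S ≤ P.comap φ := (Subgroup.closure_le _).mpr hP
    rw [hS] at this
    exact this (Subgroup.mem_top g)
  obtain ⟨k, hk, hmin⟩ : ∃ k, (∀ z ∈ commSet S k, φ z = 1) ∧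
      ∀ j < k, ¬ ∀ z ∈ commSet S j, φ z = 1 := ⟨Nat.find hex, Nat.find_spec hex, fun j hj => Nat.find_min hex hj⟩
  cases k with
  | zero =>
    have h1 : ∀ g, φ g = 1 := fun g => Subgroup.mem_bot.mp (hgen ⊥ (fun s hs =>
      Subgroup.mem_bot.mpr (hk s hs)) g)
    refine ⟨0, U.zero_mem, fun g => ?_⟩
    have := hφa g 0
    rw [h1] at this
    simpa using this.symm
  | succ k =>
    have := hmin k (Nat.lt_succ_self k)
    push Not at this
    obtain ⟨z, hz, hz1⟩ := this
    have hcomm : ∀ g, φ z * φ g = φ g * φ z := by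
      intro g
      have := hgen (Subgroup.centralizer {φ z}) (by
        intro s hs
        rw [Subgroup.mem_centralizer_singleton_iff]
        have := hk ⁅z, s⁆ ⟨z, hz, s, hs, rfl⟩
        rw [map_commutatorElement, commutatorElement_eq_one_iff_mul_comm] at this
        exact this.symm) g
      rw [Subgroup.mem_centralizer_singleton_iff] at this
      exact this.symm
    have hc0 : ∀ g, π z (b g) + b z = π g (b z) + b g := by
      intro g
      have := congrArg (fun p : Equiv.Perm U => (p 0 : W)) (hcomm g)
      simp only [Equiv.Perm.mul_apply, hφa] at this
      simpa using this
    have hc1 : ∀ g, ∀ u ∈ U, π z (π g u) = π g (π z u) := by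
      intro g u hu
      have := congrArg (fun p : Equiv.Perm U => (p ⟨u, hu⟩ : W)) (hcomm g)
      simp only [Equiv.Perm.mul_apply, hφa, map_add] at this
      have h0 := hc0 g
      rw [add_assoc, add_assoc, h0] at this
      exact add_right_cancel this
    have hnz : ∃ u ∈ U, π z u ≠ u := by
      by_contra hcon
      push Not at hcon
      apply hz1
      refine hφ1 z ⟨hfix _ (hbU z) fun g => ?_, hcon⟩
      have := hc0 g
      rw [hcon _ (hbU g), add_comm] at this
      exact (add_right_cancel this).symm
    let U1 : Submodule ℝ W := U ⊓ LinearMap.ker (π z - 1)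
    have hU1 : ∀ u, u ∈ U1 ↔ u ∈ U ∧ π z u = u := by
      intro u
      simp [U1, sub_eq_zero]
    have hlt : U1 < U := by
      refine lt_of_le_of_ne inf_le_left ?_
      intro h
      obtain ⟨u, hu, hne⟩ := hnz
      rw [← h, hU1] at hu
      exact hne hu.2
    have hdis : ∀ x w, w = π z x - x → π z w = w → w = 0 := by
      intro x w h1 h2
      have e : inner ℝ w w = inner ℝ w (π z x) - inner ℝ w x := by
        rw [← inner_sub_right, ← h1]
      have e2 : inner ℝ w (π z x) = inner ℝ w x := by
        have := inner_of_isom _ (hπ z) w x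
        rwa [h2] at this
      have : inner ℝ w w = 0 := by rw [e, e2, sub_self]
      exact inner_self_eq_zero.mp this
    -- decomposition
    have hdec : ∀ u ∈ U, ∃ v ∈ U, u - (π z v - v) ∈ U1 := by
      let D : U →ₗ[ℝ] U := (π z).restrict (hU z) - 1
      have hD : ∀ u, (D u : W) = π z u - u := fun u => rfl
      have htop : LinearMap.range D ⊔ LinearMap.ker D = ⊤ := by
        apply Submodule.eq_top_of_disjoint
        · rw [LinearMap.finrank_range_add_finrank_ker]
        · rw [Submodule.disjoint_def]
          rintro _ ⟨x, rfl⟩ hy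
          apply Subtype.ext
          refine hdis x _ (hD x) ?_
          have : (D (D x) : W) = 0 := by rw [LinearMap.mem_ker.mp hy]; rfl
          rw [hD] at this
          exact sub_eq_zero.mp this
      intro u hu
      have : (⟨u, hu⟩ : U) ∈ LinearMap.range D ⊔ LinearMap.ker D := by rw [htop]; trivial
      obtain ⟨_, ⟨v, rfl⟩, y, hy, hyv⟩ := Submodule.mem_sup.mp this
      refine ⟨v, v.2, ?_⟩
      have e : u - (π z v - v) = y := by
        have := congrArg Subtype.val hyv
        rw [Submodule.coe_add, hD] at this
        simp only at this
        rw [← this]; abel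
      rw [e, hU1]
      refine ⟨y.2, ?_⟩
      have : (D y : W) = 0 := by rw [LinearMap.mem_ker.mp hy]; rfl
      rw [hD] at this
      exact sub_eq_zero.mp this
    obtain ⟨v2, hv2, hv2z⟩ := hdec (b z) (hbU z)
    have hU1inv : ∀ g, ∀ u ∈ U1, π g u ∈ U1 := by
      intro g u hu
      rw [hU1] at hu ⊢
      exact ⟨hU g u hu.1, by rw [hc1 g u hu.1, hu.2]⟩
    have hb'U : ∀ g, b g - (π g v2 - v2) ∈ U1 := by
      intro g
      have hmem : b g - (π g v2 - v2) ∈ U := U.sub_mem (hbU g) (U.sub_mem (hU g _ hv2) hv2)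
      rw [hU1]
      refine ⟨hmem, ?_⟩
      set x := b g - (π g v2 - v2) with hx
      have e : π z x - x = π g (b z - (π z v2 - v2)) - (b z - (π z v2 - v2)) := by
        rw [hx]
        simp only [map_sub]
        rw [hc1 g v2 hv2]
        have h0 : π z (b g) = π g (b z) + b g - b z := by rw [← hc0 g]; abel
        rw [h0]; abel
      have h2 : π z x - x ∈ U1 := by
        rw [e]; exact U1.sub_mem (hU1inv g _ hv2z) hv2z
      exact sub_eq_zero.mp (hdis x _ rfl ((hU1 _).mp h2).2)
    obtain ⟨v1, hv1, hv1b⟩ := ih (Module.finrank ℝ U1) (hUn ▸ Submodule.finrank_lt_finrank_of_lt hlt)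
      U1 rfl hU1inv (fun u hu hg => hfix u (hlt.le hu) hg) (fun g => b g - (π g v2 - v2)) (by
        intro g h
        simp only [hb, map_mul, Module.End.mul_apply, map_sub]
        abel) hb'U (by
        intro x hx
        refine ⟨?_, (hK x hx).2⟩
        simp [(hK x hx).1, (hK x hx).2])
    refine ⟨v1 + v2, U.add_mem (hlt.le hv1) hv2, fun g => ?_⟩
    have := hv1b g
    rw [sub_eq_iff_eq_add] at this
    rw [this, map_add]; abel

theorem center_finiteIndex [FiniteDimensional ℝ W] (π : N →* (W →ₗ[ℝ] W))
    (hπ : ∀ g v, ‖π g v‖ = ‖v‖) (b : N → W) (hb : ∀ g h, b (g * h) = b g + π g (b h))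
    (hfin : ∀ R : ℝ, {g | ‖b g‖ ≤ R}.Finite)
    (S : Set N) (hSf : S.Finite) (hS : Subgroup.closure S = ⊤)
    (hrot : ∀ s ∈ S, ∀ v, ‖π s v - v‖ ≤ (1 / 8) * ‖v‖) :
    (Subgroup.center N).FiniteIndex := by
  obtain ⟨K, hK⟩ := commSet_trivial π hπ b hb hfin S hSf hrot
  let F : Submodule ℝ W := ⨅ g, LinearMap.ker (π g - 1)
  have hF : ∀ w, w ∈ F ↔ ∀ g, π g w = w := by
    intro w
    simp [F, Submodule.mem_iInf, sub_eq_zero]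
  have hperp : ∀ g, ∀ u ∈ Fᗮ, π g u ∈ Fᗮ := by
    intro g u hu
    rw [Submodule.mem_orthogonal] at hu ⊢
    intro w hw
    rw [← (hF w).mp hw g, inner_of_isom _ (hπ g)]
    exact hu w hw
  have hPF : ∀ x, F.starProjection x ∈ F := fun x => Submodule.starProjection_apply_mem _ _
  have hPperp : ∀ x, x - F.starProjection x ∈ Fᗮ := fun x => Submodule.sub_starProjection_mem_orthogonal x
  have hPπ : ∀ g x, F.starProjection (π g x) = F.starProjection x := by
    intro g x
    refine Submodule.eq_starProjection_of_mem_orthogonal (hPF x) ?_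
    have : π g x - F.starProjection x = π g (x - F.starProjection x) := by
      rw [map_sub, (hF _).mp (hPF x) g]
    rw [this]
    exact hperp g _ (hPperp x)
  have hb0 : ∀ g h, F.starProjection (b (g * h)) = F.starProjection (b g) + F.starProjection (b h) := by
    intro g h
    rw [hb, map_add, hPπ]
  obtain ⟨v, hv, hvb⟩ := fixed_point π hπ S hS K _ Fᗮ rfl hperp (by
      intro u hu hfix
      have h1 : u ∈ F := (hF u).mpr hfix
      exact inner_self_eq_zero.mp ((Submodule.mem_orthogonal _ _).mp hu u h1))
    (fun g => b g - F.starProjection (b g)) (by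
      intro g h
      simp only [hb0, map_sub]
      rw [hb, (hF _).mp (hPF (b h)) g]
      abel) (fun g => hPperp _) (by
      intro z hz
      refine ⟨?_, (hK z hz).2⟩
      simp [(hK z hz).1])
  have hfinc : (commutatorSet N).Finite := by
    apply (hfin (2 * ‖v‖)).subset
    rintro _ ⟨g, h, rfl⟩
    have h0 : F.starProjection (b ⁅g, h⁆) = 0 := by
      have h1 : ⁅g, h⁆ * (h * g) = g * h := by rw [commutatorElement_def]; group
      have h2 := hb0 ⁅g, h⁆ (h * g)
      rw [h1, hb0 g h, hb0 h g, add_comm (F.starProjection (b h))] at h2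
      simpa using h2
    have h3 := hvb ⁅g, h⁆
    simp only [h0, sub_zero] at h3
    change ‖b ⁅g, h⁆‖ ≤ 2 * ‖v‖
    rw [h3]
    have := norm_sub_le (π ⁅g, h⁆ v) v
    rw [hπ] at this
    linarith
  have : Finite (commutatorSet N) := hfinc
  have : Group.FG N := ⟨⟨hSf.toFinset, by simpa using hS⟩⟩
  infer_instance

end


theorem abelianByFinite_of_action {Γ W : Type} [Group Γ] [hfg : Group.FG Γ] [NormedAddCommGroup W]
    [InnerProductSpace ℝ W] [FiniteDimensional ℝ W] (π : Γ →* (W →ₗ[ℝ] W))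
    (hπ : ∀ g v, ‖π g v‖ = ‖v‖) (b : Γ → W) (hb : ∀ g h, b (g * h) = b g + π g (b h))
    (hfin : ∀ R : ℝ, {g | ‖b g‖ ≤ R}.Finite) : AbelianByFinite Γ := by
  classical
  let T : Set Γ := {g | ∀ v, ‖π g v - v‖ ≤ (1 / 8) * ‖v‖}
  let N := Subgroup.closure T
  let ρ : Γ → (W →L[ℝ] W) := fun g => (π g).toContinuousLinearMap
  have hρ : ∀ g v, ρ g v = π g v := fun g v => rfl
  have hbdd : Bornology.IsBounded (Set.range ρ) := by
    rw [isBounded_iff_forall_norm_le]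
    refine ⟨1, ?_⟩
    rintro _ ⟨g, rfl⟩
    refine ContinuousLinearMap.opNorm_le_bound _ zero_le_one fun v => ?_
    rw [hρ, hπ, one_mul]
  have : ProperSpace (W →L[ℝ] W) := FiniteDimensional.proper ℝ _
  obtain ⟨t, hts, htf, htc⟩ := Metric.finite_approx_of_totallyBounded (hbdd.isCompact_closure.totallyBounded.subset subset_closure) (1 / 8) (by norm_num)
  have hidx : N.FiniteIndex := by
    have : Finite (Γ ⧸ N) := by
      have : Finite t := htf
      choose r hr using fun x : t => hts x.2
      refine Finite.of_surjective (fun x : t => (QuotientGroup.mk (r x) : Γ ⧸ N)) ?_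
      intro q
      induction q using QuotientGroup.induction_on with
      | H g =>
        have := htc ⟨g, rfl⟩
        simp only [Set.mem_iUnion, Metric.mem_ball] at this
        obtain ⟨x, hx, hd⟩ := this
        refine ⟨⟨x, hx⟩, ?_⟩
        apply QuotientGroup.eq.mpr
        apply Subgroup.subset_closure
        intro v
        have e : π ((r ⟨x, hx⟩)⁻¹ * g) v - v = π (r ⟨x, hx⟩)⁻¹ (π g v - π (r ⟨x, hx⟩) v) := by
          rw [map_sub, rep_inv, map_mul, Module.End.mul_apply]
        rw [e, hπ, ← hρ, ← hρ, hr]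
        rw [dist_eq_norm] at hd
        have := (ρ g - x).le_opNorm v
        rw [sub_apply] at this
        exact this.trans (mul_le_mul_of_nonneg_right hd.le (norm_nonneg _))
    exact Subgroup.finiteIndex_of_finite_quotient
  have hN : Group.FG N := (Group.fg_iff_subgroup_fg N).mpr (by
    have := Subgroup.fg_of_index_ne_zero N
    exact (Group.fg_iff_subgroup_fg N).mp this)
  obtain ⟨S, hSf, hST, hSc⟩ := exists_finite_gen (N := N) (((↑) : N → Γ) ⁻¹' T)
    (Subgroup.closure_closure_coe_preimage)
  have hcen := center_finiteIndex (π.comp N.subtype) (fun g v => hπ _ v) (fun g => b g)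
    (fun g h => hb g h) (fun R => (hfin R).preimage (Subtype.val_injective.injOn)) S hSf hSc
    (fun s hs v => hST hs v)
  let A := (Subgroup.center N).map N.subtype
  have hA : A.FiniteIndex := by
    refine ⟨?_⟩
    rw [Subgroup.index_map_subtype]
    exact mul_ne_zero hcen.index_ne_zero hidx.index_ne_zero
  refine ⟨A.normalCore, inferInstance, ?_, inferInstance⟩
  intro x y hx hy
  obtain ⟨x', hx', rfl⟩ := A.normalCore_le hx
  obtain ⟨y', hy', rfl⟩ := A.normalCore_le hy
  have := (Subgroup.mem_center_iff.mp hy' x')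
  simpa using congrArg N.subtype this

theorem AbelianByFinite.subgroup {G : Type} [Group G] {H K : Subgroup G} (hKH : K ≤ H)
    (h : AbelianByFinite H) : AbelianByFinite K := by
  obtain ⟨N, hN, hc, hf⟩ := h
  refine ⟨N.comap (Subgroup.inclusion hKH), inferInstance, ?_, ?_⟩
  · intro a b ha hb
    have := hc _ _ ha hb
    rw [← map_mul, ← map_mul] at this
    exact Subgroup.inclusion_injective hKH this
  · have : N.FiniteIndex := Subgroup.finiteIndex_of_finite_quotient
    have : (N.comap (Subgroup.inclusion hKH)).FiniteIndex := ⟨by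
      rw [Subgroup.index_comap]
      exact fun h0 => this.index_ne_zero (Nat.eq_zero_of_zero_dvd
        (h0 ▸ Subgroup.relIndex_dvd_index_of_normal N _))⟩
    infer_instance


theorem wordDist_eq {Γ : Type} [Group Γ] (S : Set Γ) (x y : Γ) :
    wordDist S x y = wordDist S 1 (x⁻¹ * y) := by
  simp [wordDist]

theorem wordDist_le {Γ : Type} [Group Γ] (S : Set Γ) (l : List Γ) (hl : ∀ a ∈ l, a ∈ S) :
    wordDist S 1 l.prod ≤ l.length :=
  Nat.sInf_le ⟨l, hl, rfl, by simp⟩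

theorem wordDist_spec {Γ : Type} [Group Γ] (S : Finset Γ) (hS : IsWordGenSet S) (g : Γ) :
    ∃ l : List Γ, (∀ a ∈ l, a ∈ S) ∧ l.length = wordDist (S : Set Γ) 1 g ∧ l.prod = g := by
  have hne : {n : ℕ | ∃ l : List Γ, (∀ a ∈ l, a ∈ (S : Set Γ)) ∧ l.length = n ∧
      l.prod = (1 : Γ)⁻¹ * g}.Nonempty := by
    have : g ∈ Subgroup.closure (S : Set Γ) := by rw [hS.2]; trivial
    rw [← Subgroup.mem_toSubmonoid, Subgroup.closure_toSubmonoid] at this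
    obtain ⟨l, hl, hp⟩ := Submonoid.exists_list_of_mem_closure this
    refine ⟨l.length, l, fun a ha => ?_, rfl, by simpa using hp⟩
    rcases hl a ha with h | h
    · exact h
    · have := hS.1 _ h
      rwa [inv_inv] at this
  obtain ⟨l, h1, h2, h3⟩ := Nat.sInf_mem hne
  exact ⟨l, h1, h2, by simpa using h3⟩

theorem wlen_of_gen {Γ : Type} [Group Γ] (S : Finset Γ) (hS : IsWordGenSet S) :
    WLen S (fun g => wordDist (S : Set Γ) 1 g) := by
  have hone : wordDist (S : Set Γ) 1 1 = 0 := by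
    have := wordDist_le (S : Set Γ) [] (by simp)
    simpa using this
  have hmul : ∀ g h, wordDist (S : Set Γ) 1 (g * h) ≤ wordDist (S : Set Γ) 1 g + wordDist (S : Set Γ) 1 h := by
    intro g h
    obtain ⟨l, h1, h2, h3⟩ := wordDist_spec S hS g
    obtain ⟨l', h1', h2', h3'⟩ := wordDist_spec S hS h
    have := wordDist_le (S : Set Γ) (l ++ l') (by
      intro a ha
      rcases List.mem_append.mp ha with ha | ha
      · exact h1 a ha
      · exact h1' a ha)
    rwa [List.prod_append, h3, h3', List.length_append, h2, h2'] at this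
  have hgen : ∀ s ∈ S, wordDist (S : Set Γ) 1 s ≤ 1 := by
    intro s hs
    have := wordDist_le (S : Set Γ) [s] (by simpa using hs)
    simpa using this
  have hinv : ∀ g, wordDist (S : Set Γ) 1 g⁻¹ ≤ wordDist (S : Set Γ) 1 g := by
    intro g
    obtain ⟨l, h1, h2, h3⟩ := wordDist_spec S hS g
    have := wordDist_le (S : Set Γ) (l.map fun x => x⁻¹).reverse (by
      intro a ha
      rw [List.mem_reverse, List.mem_map] at ha
      obtain ⟨b, hb, rfl⟩ := ha
      exact hS.1 b (h1 b hb))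
    rw [← List.prod_inv_reverse, h3] at this
    simpa [h2] using this
  refine ⟨hS.1, hone, fun g => le_antisymm (hinv g) ?_, hmul, hgen, ?_, ?_⟩
  · simpa using hinv g⁻¹
  · intro g hg
    obtain ⟨l, h1, h2, h3⟩ := wordDist_spec S hS g
    rw [show wordDist (S : Set Γ) 1 g = 0 from hg, List.length_eq_zero_iff] at h2
    rw [← h3, h2]; rfl
  · intro g n hg
    obtain ⟨l, h1, h2, h3⟩ := wordDist_spec S hS g
    rw [show wordDist (S : Set Γ) 1 g = n + 1 from hg] at h2
    rcases List.eq_nil_or_concat l with rfl | ⟨l', s, rfl⟩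
    · simp at h2
    · have hp : g = l'.prod * s := by rw [← h3]; simp
      have hs : s ∈ S := h1 s (by simp)
      have hl : l'.length = n := by simpa using h2
      have h4 := wordDist_le (S : Set Γ) l' (fun a ha => h1 a (by simp [ha]))
      refine ⟨l'.prod, s, hs, le_antisymm (hl ▸ h4) ?_, hp⟩
      have h5 := hmul l'.prod s
      rw [← hp, hg] at h5
      have := hgen s hs
      omega

theorem exists_gen (Γ : Type) [Group Γ] [h : Group.FG Γ] : ∃ S : Finset Γ, IsWordGenSet S := by
  classical
  obtain ⟨F, hF⟩ := h.out
  refine ⟨F ∪ F.image (fun x => x⁻¹), ?_, ?_⟩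
  · intro a ha
    simp only [Finset.mem_union, Finset.mem_image] at ha ⊢
    rcases ha with h | ⟨b, hb, rfl⟩
    · exact Or.inr ⟨a, h, rfl⟩
    · left; simpa using hb
  · rw [eq_top_iff, ← hF]
    apply Subgroup.closure_mono
    simp

theorem undist_chain {G : Type} [Group G] (Gs : ℕ → Subgroup G) (hmono : ∀ n, Gs n ≤ Gs (n + 1))
    (hund : ∀ n, UndistortedIn (Gs n) (Gs (n + 1))) (S : ∀ n, Finset (Gs n))
    (hS : ∀ n, IsWordGenSet (S n)) (n m : ℕ) (hnm : n ≤ m) :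
    ∃ L C : ℝ, 0 ≤ L ∧ 0 ≤ C ∧ ∀ (x y : G) (hx : x ∈ Gs n) (hy : y ∈ Gs n) (hx' : x ∈ Gs m)
      (hy' : y ∈ Gs m), (wordDist (S n : Set (Gs n)) ⟨x, hx⟩ ⟨y, hy⟩ : ℝ) ≤
        L * (wordDist (S m : Set (Gs m)) ⟨x, hx'⟩ ⟨y, hy'⟩ : ℝ) + C := by
  induction m, hnm using Nat.le_induction with
  | base => exact ⟨1, 0, zero_le_one, le_rfl, fun x y hx hy hx' hy' => by simp⟩
  | succ m hnm ih =>
    obtain ⟨L, C, hL, hC, h⟩ := ih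
    obtain ⟨L', C', hL', hC', h'⟩ := hund m (hmono m) (S m) (S (m + 1)) (hS m) (hS (m + 1))
    have hL0 : 0 < L' := by linarith
    refine ⟨L * L', L * (L' * C') + C, by positivity, by positivity, ?_⟩
    intro x y hx hy hx' hy'
    have hle : Gs n ≤ Gs m := monotone_nat_of_le_succ hmono hnm
    have h1 := h x y hx hy (hle hx) (hle hy)
    have h2 := (h' ⟨x, hle hx⟩ ⟨y, hle hy⟩).1
    have e1 : Subgroup.inclusion (hmono m) ⟨x, hle hx⟩ = ⟨x, hx'⟩ := rfl
    have e2 : Subgroup.inclusion (hmono m) ⟨y, hle hy⟩ = ⟨y, hy'⟩ := rfl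
    rw [e1, e2] at h2
    set u := (wordDist (S m : Set (Gs m)) ⟨x, hle hx⟩ ⟨y, hle hy⟩ : ℝ)
    set v := (wordDist (S (m + 1) : Set (Gs (m + 1))) ⟨x, hx'⟩ ⟨y, hy'⟩ : ℝ)
    have h3 : u ≤ L' * (v + C') := by
      have : L'⁻¹ * u ≤ v + C' := by linarith
      rwa [inv_mul_le_iff₀ hL0] at this
    have h4 := mul_le_mul_of_nonneg_left h3 hL
    linarith

theorem ab_embed {A : Type} [AddCommGroup A] [AddGroup.FG A] (B : A → ℝ → Prop)
    (hzero : B 0 0) (hadd : ∀ a b R R', B a R → B b R' → B (a + b) (R + R'))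
    (hneg : ∀ a R, B a R → B (-a) R) (hmono : ∀ a R R', R ≤ R' → B a R → B a R')
    (hex : ∀ a, ∃ R, B a R) :
    ∃ (r : ℕ) (q : A →+ EuclideanSpace ℝ (Fin r)) (C : ℝ), 0 ≤ C ∧ ∀ a, B a (C * ‖q a‖ + C) := by
  classical
  obtain ⟨r, ι, _, p, hp, k, ⟨e⟩⟩ := AddCommGroup.equiv_free_prod_directSum_zmod A
  have hNZ : ∀ i, NeZero (p i ^ k i) := fun i => ⟨pow_ne_zero _ (hp i).ne_zero⟩
  have hF : Finite (DirectSum ι fun i => ZMod (p i ^ k i)) :=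
    Finite.of_equiv _ (DirectSum.addEquivProd (fun i => ZMod (p i ^ k i))).symm.toEquiv
  choose ρ hρ using hex
  obtain ⟨M, hM⟩ := (Set.finite_range (fun t : DirectSum ι fun i => ZMod (p i ^ k i) =>
    ρ (e.symm (0, t)))).bddAbove
  obtain ⟨P, hP⟩ := (Set.finite_range (fun i : Fin r => ρ (e.symm (Finsupp.single i 1, 0)))).bddAbove
  have hnsmul : ∀ (n : ℕ) a R, B a R → B (n • a) (n * R) := by
    intro n a R h
    induction n with
    | zero => simpa using hzero
    | succ n ih =>
      have := hadd _ _ _ _ ih h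
      rw [succ_nsmul]
      refine hmono _ _ _ (le_of_eq ?_) this
      push_cast; ring
  have hzsmul : ∀ (n : ℤ) a R, B a R → B (n • a) (|(n : ℝ)| * R) := by
    intro n a R h
    obtain ⟨m, rfl | rfl⟩ := n.eq_nat_or_neg
    · simpa using hnsmul m a R h
    · simpa using hneg _ _ (hnsmul m a R h)
  have hsum : ∀ (s : Finset (Fin r)) (f : Fin r → A) (R : Fin r → ℝ), (∀ i, B (f i) (R i)) →
      B (∑ i ∈ s, f i) (∑ i ∈ s, R i) := by
    intro s f R h
    induction s using Finset.induction_on with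
    | empty => simpa using hzero
    | insert i s hi ih =>
      rw [Finset.sum_insert hi, Finset.sum_insert hi]
      exact hadd _ _ _ _ (h i) ih
  let q : A →+ EuclideanSpace ℝ (Fin r) :=
    { toFun := fun a => WithLp.toLp 2 (fun i => (((e a).1 i : ℤ) : ℝ))
      map_zero' := by ext i; simp
      map_add' := by intro a b; ext i; simp }
  have hq : ∀ a i, q a i = (((e a).1 i : ℤ) : ℝ) := fun a i => rfl
  refine ⟨r, q, max (r * max P 0) (max M 0), le_max_of_le_right (le_max_right _ _), fun a => ?_⟩
  have h1 : a = ∑ i, (e a).1 i • e.symm (Finsupp.single i 1, 0) + e.symm (0, (e a).2) := by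
    apply e.injective
    simp only [map_add, map_sum, map_zsmul, AddEquiv.apply_symm_apply]
    refine Prod.ext ?_ ?_
    · simp only [Prod.fst_add, Prod.fst_sum, Prod.smul_fst, add_zero]
      ext j
      simp
    · simp [Prod.snd_sum]
  have h2 : ∀ i, B ((e a).1 i • e.symm (Finsupp.single i 1, 0)) (‖q a‖ * max P 0) := by
    intro i
    refine hmono _ _ _ ?_ (hzsmul _ _ _ (hρ _))
    have i1 : |(((e a).1 i : ℤ) : ℝ)| ≤ ‖q a‖ := by
      have := PiLp.norm_apply_le (q a) i
      rwa [hq, Real.norm_eq_abs] at this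
    have i2 : ρ (e.symm (Finsupp.single i 1, 0)) ≤ max P 0 := (hP ⟨i, rfl⟩).trans (le_max_left _ _)
    calc _ ≤ |(((e a).1 i : ℤ) : ℝ)| * max P 0 := by gcongr
      _ ≤ _ := by gcongr
  have h3 := hadd _ _ _ _ (hsum Finset.univ _ _ h2) (hρ (e.symm (0, (e a).2)))
  rw [← h1] at h3
  refine hmono _ _ _ ?_ h3
  have i3 : ρ (e.symm (0, (e a).2)) ≤ max M 0 := (hM ⟨_, rfl⟩).trans (le_max_left _ _)
  simp only [Finset.sum_const, Finset.card_univ, Fintype.card_fin, nsmul_eq_mul]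
  have i4 : (r * max P 0) * ‖q a‖ ≤ max (r * max P 0) (max M 0) * ‖q a‖ := by
    gcongr; exact le_max_left _ _
  have i5 := le_max_right (r * max P 0) (max M 0)
  linarith


theorem exists_level {G : Type} [Group G] (Gs : ℕ → Subgroup G) (hmono : Monotone Gs)
    (hun : ∀ x : G, ∃ n, x ∈ Gs n) (s : Set G) (hs : s.Finite) (n : ℕ) :
    ∃ m, n ≤ m ∧ ∀ x ∈ s, x ∈ Gs m := by
  choose k hk using hun
  obtain ⟨M, hM⟩ := (hs.image k).bddAbove
  exact ⟨max n M, le_max_left _ _, fun x hx => hmono ((hM ⟨x, hx, rfl⟩).trans (le_max_right _ _)) (hk x)⟩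

theorem level_abelianByFinite
    (G A : Type) [Group G] [AddCommGroup A] [MetricSpace G] [MetricSpace A]
    (hGinv : ∀ g x y : G, dist (g * x) (g * y) = dist x y)
    (hGprop : ∀ (x : G) (r : ℝ), {y : G | dist x y ≤ r}.Finite)
    (hAinv : ∀ a x y : A, dist (a + x) (a + y) = dist x y)
    (hAprop : ∀ (x : A) (r : ℝ), {y : A | dist x y ≤ r}.Finite)
    (Gs : ℕ → Subgroup G) (hsucc : ∀ n, Gs n ≤ Gs (n + 1)) (hfg : ∀ n, Group.FG (Gs n))
    (hun : ∀ x : G, ∃ n, x ∈ Gs n) (hund : ∀ n, UndistortedIn (Gs n) (Gs (n + 1)))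
    (hce : CoarseEquiv G A) (n : ℕ) : AbelianByFinite (Gs n) := by
  classical
  obtain ⟨f, g, K, hK, hf, hg, hgf, -⟩ := hce
  choose S hS using fun n => exists_gen (Gs n)
  have hW := fun n => wlen_of_gen (S n) (hS n)
  have hGd : ∀ x y : G, dist 1 (x⁻¹ * y) = dist x y := by
    intro x y
    rw [← hGinv x 1, mul_one, mul_inv_cancel_left]
  have hAd : ∀ x y : A, dist 0 (y - x) = dist x y := by
    intro x y
    rw [← hAinv x 0, add_zero, add_sub_cancel]
  -- bound on generators
  obtain ⟨δ, hδ⟩ := ((S n).finite_toSet.image (fun s : Gs n => dist (1 : G) s)).bddAbove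
  obtain ⟨ε, hε0, hε⟩ := hf (max δ 0) (le_max_right _ _)
  let D : Set A := {a | dist 0 a ≤ ε}
  have hDfin : D.Finite := hAprop 0 ε
  have hfD : ∀ (x s : Gs n), s ∈ S n → f ((x * s : Gs n) : G) - f x ∈ D := by
    intro x s hs
    change dist 0 _ ≤ ε
    rw [hAd]
    apply hε
    have : dist (x : G) ((x * s : Gs n) : G) = dist (1 : G) s := by
      rw [← hGd]; simp
    rw [this]
    exact (hδ ⟨s, hs, rfl⟩).trans (le_max_left _ _)
  let A1 := AddSubgroup.closure D
  have hA1 : AddGroup.FG A1 := by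
    have := AddGroup.closure_finset_fg hDfin.toFinset
    rwa [hDfin.coe_toFinset] at this
  have hmem : ∀ (h x : Gs n), f ((x * h : Gs n) : G) - f x ∈ A1 := by
    intro h
    have : h ∈ Subgroup.closure (S n : Set (Gs n)) := by rw [(hS n).2]; trivial
    induction this using Subgroup.closure_induction with
    | mem s hs => exact fun x => AddSubgroup.subset_closure (hfD x s hs)
    | one => intro x; simp
    | mul a b _ _ h1 h2 =>
      intro x
      have := A1.add_mem (h2 (x * a)) (h1 x)
      rwa [sub_add_sub_cancel, mul_assoc] at this
    | inv a _ h1 =>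
      intro x
      have := A1.neg_mem (h1 (x * a⁻¹))
      rwa [inv_mul_cancel_right, neg_sub] at this
  -- the target level
  obtain ⟨ε', hε'0, hε'⟩ := hg ε hε0
  obtain ⟨m, hnm, hm⟩ := exists_level Gs (monotone_nat_of_le_succ hsucc) hun
    {z : G | dist 1 z ≤ max ε' K} (hGprop 1 _) n
  let ℓ : Gs m → ℕ := fun x => wordDist (S m : Set (Gs m)) 1 x
  have hℓ : WLen (S m) ℓ := hW m
  have hR : ∃ R : ℝ, ∀ z : G, dist 1 z ≤ max ε' K → ∃ h : z ∈ Gs m, (ℓ ⟨z, h⟩ : ℝ) ≤ R := by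
    have : ({z : Gs m | dist 1 (z : G) ≤ max ε' K}).Finite :=
      (hGprop 1 (max ε' K)).preimage Subtype.val_injective.injOn
    obtain ⟨R, hR⟩ := (this.image (fun z => (ℓ z : ℝ))).bddAbove
    exact ⟨R, fun z hz => ⟨hm z hz, hR ⟨⟨z, hm z hz⟩, hz, rfl⟩⟩⟩
  obtain ⟨R, hR⟩ := hR
  let B : A → ℝ → Prop := fun a r => ∀ y : A, ∃ h : (g y)⁻¹ * g (y + a) ∈ Gs m, (ℓ ⟨_, h⟩ : ℝ) ≤ r
  have hB0 : B 0 0 := by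
    intro y
    refine ⟨by simp, ?_⟩
    have : ∀ h, ℓ ⟨(g y)⁻¹ * g (y + 0), h⟩ = 0 := by
      intro h
      have : (⟨(g y)⁻¹ * g (y + 0), h⟩ : Gs m) = 1 := by ext; simp
      rw [this, hℓ.one]
    rw [this, Nat.cast_zero]
  have hBadd : ∀ a b r r', B a r → B b r' → B (a + b) (r + r') := by
    intro a b r r' h1 h2 y
    obtain ⟨k1, j1⟩ := h1 y
    obtain ⟨k2, j2⟩ := h2 (y + a)
    have e : (g y)⁻¹ * g (y + (a + b)) = ((g y)⁻¹ * g (y + a)) * ((g (y + a))⁻¹ * g (y + a + b)) := by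
      rw [add_assoc]; group
    have hk : (g y)⁻¹ * g (y + (a + b)) ∈ Gs m := by rw [e]; exact mul_mem k1 k2
    refine ⟨hk, ?_⟩
    have e' : (⟨_, hk⟩ : Gs m) = ⟨_, k1⟩ * ⟨_, k2⟩ := Subtype.ext e
    rw [e']
    have : (ℓ (⟨_, k1⟩ * ⟨_, k2⟩) : ℝ) ≤ ℓ ⟨_, k1⟩ + ℓ ⟨_, k2⟩ := by exact_mod_cast hℓ.mul _ _
    linarith
  have hBneg : ∀ a r, B a r → B (-a) r := by
    intro a r h y
    obtain ⟨k1, j1⟩ := h (y + -a)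
    have e : (g y)⁻¹ * g (y + -a) = ((g (y + -a))⁻¹ * g (y + -a + a))⁻¹ := by
      rw [neg_add_cancel_right]; group
    have hk : (g y)⁻¹ * g (y + -a) ∈ Gs m := by rw [e]; exact inv_mem k1
    refine ⟨hk, ?_⟩
    have e' : (⟨_, hk⟩ : Gs m) = (⟨_, k1⟩)⁻¹ := Subtype.ext e
    rw [e', hℓ.inv]
    exact j1
  have hBex : ∀ a ∈ A1, ∃ r, B a r := by
    intro a ha
    induction ha using AddSubgroup.closure_induction with
    | mem a ha =>
      refine ⟨R, fun y => hR _ ?_⟩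
      rw [hGd]
      refine (hε' _ _ ?_).trans (le_max_left _ _)
      rw [← hAd, add_sub_cancel_left]
      exact ha
    | zero => exact ⟨0, hB0⟩
    | add a b _ _ h1 h2 =>
      obtain ⟨r, h1⟩ := h1
      obtain ⟨r', h2⟩ := h2
      exact ⟨_, hBadd _ _ _ _ h1 h2⟩
    | neg a _ h1 =>
      obtain ⟨r, h1⟩ := h1
      exact ⟨r, hBneg _ _ h1⟩
  obtain ⟨d, q, C, hC, hq⟩ := ab_embed (A := A1) (fun a r => B a r) hB0
    (fun a b r r' h1 h2 => hBadd a b r r' h1 h2) (fun a r h => hBneg a r h)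
    (fun a r r' hr h y => ⟨(h y).1, (h y).2.trans hr⟩) (fun a => hBex a a.2)
  obtain ⟨L1, C1, hL1, hC1, hchain⟩ := undist_chain Gs hsucc hund S hS n m hnm
  have hle : Gs n ≤ Gs m := monotone_nat_of_le_succ hsucc hnm
  let lS : Gs n → ℕ := fun x => wordDist (S n : Set (Gs n)) 1 x
  have hlS : WLen (S n) lS := hW n
  have hmem2 : ∀ x y : Gs n, f y - f x ∈ A1 := by
    intro x y
    have := hmem (x⁻¹ * y) x
    rwa [mul_inv_cancel_left] at this
  let F : Gs n → EuclideanSpace ℝ (Fin d) := fun x => q ⟨f x - f (1 : Gs n), hmem2 1 x⟩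
  have hF : ∀ x y, F y - F x = q ⟨f y - f x, hmem2 x y⟩ := by
    intro x y
    simp only [F]
    rw [← map_sub]
    congr 1
    ext
    simp
  -- lower bound
  have hlow : ∀ x y : Gs n, (lS (x⁻¹ * y) : ℝ) ≤ L1 * (R + (C * ‖F y - F x‖ + C) + R) + C1 := by
    intro x y
    have h1 := hchain x y x.2 y.2 (hle x.2) (hle y.2)
    rw [wordDist_eq (S n : Set (Gs n)), wordDist_eq (S m : Set (Gs m))] at h1
    refine le_trans h1 ?_
    gcongr
    obtain ⟨k1, j1⟩ := hR ((x : G)⁻¹ * g (f x)) (by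
      rw [hGd, dist_comm]; exact (hgf _).trans (le_max_right _ _))
    obtain ⟨k3, j3⟩ := hR ((g (f y))⁻¹ * (y : G)) (by
      rw [hGd]; exact (hgf _).trans (le_max_right _ _))
    obtain ⟨k2, j2⟩ := hq ⟨f y - f x, hmem2 x y⟩ (f x)
    rw [← hF] at j2
    have e : (⟨(x : G), hle x.2⟩ : Gs m)⁻¹ * ⟨(y : G), hle y.2⟩ = ⟨_, k1⟩ * ⟨_, k2⟩ * ⟨_, k3⟩ := by
      apply Subtype.ext
      simp [mul_assoc]
    change (ℓ _ : ℝ) ≤ _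
    rw [e]
    have i1 : (ℓ (⟨_, k1⟩ * ⟨_, k2⟩ * ⟨_, k3⟩) : ℝ) ≤ ℓ (⟨_, k1⟩ * ⟨_, k2⟩) + ℓ ⟨_, k3⟩ := by
      exact_mod_cast hℓ.mul _ _
    have i2 : (ℓ (⟨_, k1⟩ * ⟨_, k2⟩) : ℝ) ≤ ℓ ⟨_, k1⟩ + ℓ ⟨_, k2⟩ := by exact_mod_cast hℓ.mul _ _
    linarith
  -- upper bound
  obtain ⟨M, hM⟩ : ∃ M : ℝ, ∀ a : A1, (a : A) ∈ D → ‖q a‖ ≤ M := by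
    have : {a : A1 | (a : A) ∈ D}.Finite := hDfin.preimage Subtype.val_injective.injOn
    obtain ⟨M, hM⟩ := (this.image (fun a => ‖q a‖)).bddAbove
    exact ⟨M, fun a ha => hM ⟨a, ha, rfl⟩⟩
  have hup : ∀ k : ℕ, ∀ x h : Gs n, lS h = k → ‖F (x * h) - F x‖ ≤ (max M 0 + 1) * k := by
    intro k
    induction k with
    | zero =>
      intro x h hh
      rw [hlS.eq_one h hh]; simp
    | succ k ih =>
      intro x h hh
      obtain ⟨h', s, hs, hk, rfl⟩ := hlS.succ h k hh
      have i1 := ih x h' hk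
      have i2 : ‖F (x * h' * s) - F (x * h')‖ ≤ max M 0 + 1 := by
        rw [hF]
        have := hM _ (show ((⟨_, hmem2 (x * h') (x * h' * s)⟩ : A1) : A) ∈ D from hfD (x * h') s hs)
        exact this.trans ((le_max_left M 0).trans (by linarith))
      have i3 : F (x * (h' * s)) - F x = (F (x * h' * s) - F (x * h')) + (F (x * h') - F x) := by
        rw [mul_assoc]; abel
      rw [i3]
      refine (norm_add_le _ _).trans ?_
      push_cast
      linarith
  set P := L1 * C with hP
  have hP0 : 0 ≤ P := mul_nonneg hL1 hC
  set Q := L1 * (R + C + R) + C1 with hQ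
  obtain ⟨W, _, _, _, π, b, hπ, hb, hfin⟩ := hlS.finite_dim_action F (P + 1)⁻¹ ((P + 1)⁻¹ * Q)
    (max M 0 + 1) (by positivity) (by positivity) (by
      intro x y
      have h1 := hlow x y
      rw [norm_sub_rev]
      rw [← mul_sub, inv_mul_le_iff₀ (by positivity)]
      have := norm_nonneg (F y - F x)
      have e : L1 * (R + (C * ‖F y - F x‖ + C) + R) + C1 = P * ‖F y - F x‖ + Q := by
        rw [hP, hQ]; ring
      rw [e] at h1
      linarith) (by
      intro x y
      have := hup _ x (x⁻¹ * y) rfl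
      rwa [mul_inv_cancel_left, norm_sub_rev] at this)
  have := hfg n
  exact abelianByFinite_of_action π hπ b hb hfin


/-- If a countable undistorted group `G` with a proper left-invariant metric is coarsely
equivalent to a countable abelian group `A` with a proper left-invariant metric, then
`G` is locally abelian-by-finite. -/
theorem locally_abelianByFinite_of_undistorted_of_coarseEquiv_abelian
    (G A : Type) [Group G] [AddCommGroup A] [Countable G] [Countable A]
    [MetricSpace G] [MetricSpace A]
    (hGinv : ∀ g x y : G, dist (g * x) (g * y) = dist x y)
    (hGprop : ∀ (x : G) (r : ℝ), {y : G | dist x y ≤ r}.Finite)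
    (hAinv : ∀ a x y : A, dist (a + x) (a + y) = dist x y)
    (hAprop : ∀ (x : A) (r : ℝ), {y : A | dist x y ≤ r}.Finite)
    (hund : Undistorted G) (hce : CoarseEquiv G A) :
    ∀ K : Subgroup G, Group.FG K → AbelianByFinite K := by
  obtain ⟨Gs, hsucc, hfg, hun, hu⟩ := hund
  intro K hK
  obtain ⟨F, hF⟩ := (Group.fg_iff_subgroup_fg K).mp hK
  obtain ⟨m, -, hm⟩ := exists_level Gs (monotone_nat_of_le_succ hsucc) hun F F.finite_toSet 0
  have hle : K ≤ Gs m := by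
    rw [← hF, Subgroup.closure_le]
    exact hm
  exact AbelianByFinite.subgroup hle (level_abelianByFinite G A hGinv hGprop hAinv hAprop Gs hsucc
    hfg hun hu hce m)
end

section
/- Every countable locally finite-by-abelian group G, endowed with a proper left-invariant metric, is bijectively coarsely equivalent to the abelian group ℤ^m × ℤ_f (endowed with a proper left-invariant metric) for some m ∈ ℕ∪{0,∞} and some function f : Π → ℕ∪{0,∞}. -/
/-- `d` is a metric (as a two-variable real function). -/
def IsMetricFun {X : Type*} (d : X → X → ℝ) : Prop :=
  (∀ x y : X, d x y = 0 ↔ x = y) ∧ (∀ x y : X, d x y = d y x) ∧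
    (∀ x y z : X, d x z ≤ d x y + d y z)

/-- A group is finite-by-abelian: it has a finite normal subgroup with abelian quotient. -/
def FiniteByAbelian (G : Type*) [Group G] : Prop :=
  ∃ N : Subgroup G, N.Normal ∧ Finite N ∧ ∀ a b : G, a * b * a⁻¹ * b⁻¹ ∈ N

/-- A group is locally finite-by-abelian: every finitely generated subgroup is
finite-by-abelian. -/
def LocallyFiniteByAbelian (G : Type*) [Group G] : Prop :=
  ∀ K : Subgroup G, Group.FG K → FiniteByAbelian K

/-- A length function with finite balls. -/
def HasNorm (A : Type*) [AddCommGroup A] : Prop :=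
  ∃ N : A → ℕ, (∀ x, N x = 0 ↔ x = 0) ∧ (∀ x, N (-x) = N x) ∧
    (∀ x y, N (x + y) ≤ N x + N y) ∧ ∀ r : ℕ, {x | N x ≤ r}.Finite

lemma hasNorm_int : HasNorm ℤ := by
  refine ⟨Int.natAbs, fun x => Int.natAbs_eq_zero, Int.natAbs_neg, Int.natAbs_add_le, fun r => ?_⟩
  refine (Set.finite_Icc (-(r : ℤ)) r).subset ?_
  intro x hx
  simp only [Set.mem_ofPred_eq, Set.mem_Icc] at *
  omega

open Classical in
lemma hasNorm_finite (A : Type*) [AddCommGroup A] [Finite A] : HasNorm A := by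
  refine ⟨fun x => if x = 0 then 0 else 1, ?_, ?_, ?_, fun r => Set.toFinite _⟩
  · intro x; by_cases h : x = 0 <;> simp [h]
  · intro x; simp
  · intro x y
    by_cases h : x = 0 <;> by_cases h' : y = 0 <;> simp [h, h']
    split <;> simp

lemma HasNorm.congr {A B : Type*} [AddCommGroup A] [AddCommGroup B] (e : A ≃+ B)
    (h : HasNorm B) : HasNorm A := by
  obtain ⟨N, h0, hn, ha, hf⟩ := h
  refine ⟨fun x => N (e x), fun x => by simp [h0], fun x => by simp [hn],
    fun x y => by simpa using ha _ _, fun r => ?_⟩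
  exact (hf r).preimage e.injective.injOn

lemma HasNorm.prod {A B : Type*} [AddCommGroup A] [AddCommGroup B]
    (h : HasNorm A) (h' : HasNorm B) : HasNorm (A × B) := by
  obtain ⟨N, h0, hn, ha, hf⟩ := h
  obtain ⟨N', h0', hn', ha', hf'⟩ := h'
  refine ⟨fun x => N x.1 + N' x.2, fun x => by simp [h0, h0', Prod.ext_iff],
    fun x => by simp [hn, hn'], fun x y => ?_, fun r => ?_⟩
  · have := ha x.1 y.1
    have := ha' x.2 y.2
    simp only [Prod.fst_add, Prod.snd_add]
    omega
  · refine ((hf r).prod (hf' r)).subset ?_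
    intro x hx
    simp only [Set.mem_ofPred_eq, Set.mem_prod] at *
    omega

open Classical in
lemma hasNorm_dfinsupp (B : ℕ → Type) [∀ n, AddCommGroup (B n)] (h : ∀ n, HasNorm (B n)) :
    HasNorm (Π₀ n, B n) := by
  choose N h0 hn ha hf using h
  have key : ∀ (x : Π₀ n, B n) (s : Finset ℕ), x.support ⊆ s →
      ∑ n ∈ x.support, (n + 1) * N n (x n) = ∑ n ∈ s, (n + 1) * N n (x n) := by
    intro x s hs
    refine Finset.sum_subset hs ?_
    intro n _ hx
    have : x n = 0 := by simpa using hx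
    rw [this, (h0 n 0).2 rfl, mul_zero]
  refine ⟨fun x => ∑ n ∈ x.support, (n + 1) * N n (x n), ?_, ?_, ?_, ?_⟩
  · intro x
    simp only [Finset.sum_eq_zero_iff, mul_eq_zero, h0]
    constructor
    · intro h
      ext n
      by_contra hx
      have := h n (by simpa using hx)
      simp at this
      exact hx this
    · rintro rfl; simp
  · intro x
    simp [hn]
  · intro x y
    show ∑ n ∈ (x + y).support, (n + 1) * N n ((x + y) n) ≤
      ∑ n ∈ x.support, (n + 1) * N n (x n) + ∑ n ∈ y.support, (n + 1) * N n (y n)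
    rw [key (x + y) (x.support ∪ y.support) DFinsupp.support_add,
      key x (x.support ∪ y.support) Finset.subset_union_left,
      key y (x.support ∪ y.support) Finset.subset_union_right, ← Finset.sum_add_distrib]
    refine Finset.sum_le_sum fun n _ => ?_
    rw [← mul_add]
    exact Nat.mul_le_mul_left _ (ha n _ _)
  · intro r
    have hb : ∀ x : Π₀ n, B n, ∑ n ∈ x.support, (n + 1) * N n (x n) ≤ r →
        (∀ n, N n (x n) ≤ r) ∧ ∀ n, r ≤ n → x n = 0 := by
      intro x hx
      have h1 : ∀ n, x n ≠ 0 → (n + 1) * N n (x n) ≤ r := fun n hn =>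
        (Finset.single_le_sum (f := fun n => (n + 1) * N n (x n)) (fun _ _ => Nat.zero_le _)
          (by simpa using hn)).trans hx
      refine ⟨fun n => ?_, fun n hr => ?_⟩
      · by_cases hz : x n = 0
        · rw [hz, (h0 n 0).2 rfl]; omega
        · have := h1 n hz
          nlinarith
      · by_contra hz
        have := h1 n hz
        have h2 : N n (x n) ≠ 0 := fun h => hz ((h0 _ _).1 h)
        have : 1 ≤ N n (x n) := Nat.one_le_iff_ne_zero.2 h2
        nlinarith
    refine Set.Finite.of_finite_image (f := fun x : Π₀ n, B n => fun i : Fin r => x i) ?_ ?_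
    · refine (Set.Finite.pi (fun i : Fin r => hf i r)).subset ?_
      rintro _ ⟨x, hx, rfl⟩
      simp only [Set.mem_pi, Set.mem_univ, forall_true_left]
      exact fun i => (hb x hx).1 i
    · intro x hx y hy hxy
      ext n
      by_cases hr : n < r
      · exact congrFun hxy ⟨n, hr⟩
      · rw [(hb x hx).2 n (by omega), (hb y hy).2 n (by omega)]

lemma exists_card_dfinsupp (m : ℕ) (hm : m ≠ 0) : ∃ κ : ℕ → ℕ, (∀ i, κ i = 1 ∨ (κ i).Prime) ∧
    Nat.card (Π₀ i, ZMod (κ i)) = m := by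
  classical
  induction m using induction_on_primes with
  | zero => exact absurd rfl hm
  | one =>
    refine ⟨fun _ => 1, fun _ => Or.inl rfl, ?_⟩
    rw [Nat.card_eq_one_iff_unique]
    refine ⟨⟨fun x y => ?_⟩, ⟨0⟩⟩
    refine DFinsupp.ext fun i => ?_
    exact Subsingleton.elim (α := ZMod 1) (x i) (y i)
  | prime_mul p a hp ih =>
    obtain ⟨κ, h1, h2⟩ := ih (by rintro rfl; simp at hm)
    obtain ⟨e⟩ : Nonempty (Option ℕ ≃ ℕ) := by
      exact nonempty_equiv_of_countable
    refine ⟨fun i => (e.symm i).elim p κ, fun i => ?_, ?_⟩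
    · show (e.symm i).elim p κ = 1 ∨ ((e.symm i).elim p κ).Prime
      cases e.symm i with
      | none => exact Or.inr hp
      | some j => exact h1 j
    · rw [Nat.card_congr ((DFinsupp.equivCongrLeft
        (β := fun o : Option ℕ => ZMod (o.elim p κ)) e).symm),
        Nat.card_congr DFinsupp.equivProdDFinsupp, Nat.card_prod]
      show Nat.card (ZMod p) * Nat.card (Π₀ i, ZMod (κ i)) = _
      rw [h2, Nat.card_zmod]

lemma target_equiv (Z : ℕ → Type) (κ : ℕ → ℕ → ℕ) :
    Nonempty ((Π₀ n, ((Z n →₀ ℤ) × Π₀ i, ZMod (κ n i))) ≃+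
      (((Σ n, Z n) →₀ ℤ) × DirectSum ℕ fun j => ZMod (κ (Nat.unpair j).1 (Nat.unpair j).2))) := by
  classical
  let e1 : (Π₀ n, ((Z n →₀ ℤ) × Π₀ i, ZMod (κ n i))) ≃+
      (Π₀ n, (Z n →₀ ℤ)) × (Π₀ n, Π₀ i, ZMod (κ n i)) :=
    AddEquiv.ofBijective (AddMonoidHom.prod
      (DFinsupp.mapRange.addMonoidHom fun n => AddMonoidHom.fst _ _)
      (DFinsupp.mapRange.addMonoidHom fun n => AddMonoidHom.snd _ _)) (by
      constructor
      · intro x y h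
        simp only [AddMonoidHom.prod_apply, Prod.mk.injEq] at h
        refine DFinsupp.ext fun n => Prod.ext ?_ ?_
        · simpa using DFunLike.congr_fun h.1 n
        · simpa using DFunLike.congr_fun h.2 n
      · rintro ⟨x, y⟩
        refine ⟨DFinsupp.zipWith (fun n a b => (a, b)) (fun n => rfl) x y, ?_⟩
        refine Prod.ext ?_ ?_ <;> ext n <;> simp)
  let e2 : (Π₀ n, (Z n →₀ ℤ)) ≃+ ((Σ n, Z n) →₀ ℤ) := sigmaFinsuppAddEquivDFinsupp.symm
  let e3 : (Π₀ n, Π₀ i, ZMod (κ n i)) ≃+ (DirectSum (Σ _ : ℕ, ℕ) fun i => ZMod (κ i.1 i.2)) :=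
    (DirectSum.sigmaCurryEquiv (δ := fun n i => ZMod (κ n i))).symm
  let q : (Σ _ : ℕ, ℕ) ≃ ℕ := (Equiv.sigmaEquivProd ℕ ℕ).trans Nat.pairEquiv
  let e4 : (DirectSum (Σ _ : ℕ, ℕ) fun i => ZMod (κ i.1 i.2)) ≃+
      DirectSum ℕ fun j => ZMod (κ (Nat.unpair j).1 (Nat.unpair j).2) :=
    DirectSum.equivCongrLeft (β := fun i : (Σ _ : ℕ, ℕ) => ZMod (κ i.1 i.2)) q
  exact ⟨e1.trans (e2.prodCongr (e3.trans e4))⟩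

/-- One step of the tower: `c` is a coarse transversal of the left cosets of `H` in `K`. -/
structure IsStep {G : Type} [Group G] (H K : Subgroup G) (B : Type) [AddCommGroup B]
    (c : B → G) : Prop where
  le : H ≤ K
  mem : ∀ b, c b ∈ K
  zero : c 0 = 1
  ex : ∀ x ∈ K, ∃ b, (c b)⁻¹ * x ∈ H
  uniq : ∀ b b', (c b)⁻¹ * c b' ∈ H → b = b'
  fin1 : ∀ β, (Set.range fun b => (c b)⁻¹ * c (b + β)).Finite
  fin2 : ∀ u ∈ K, {β | ∃ b, (c (b + β))⁻¹ * (c b * u) ∈ H}.Finite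
  fc : ∀ s ∈ K, ((fun k => k⁻¹ * s * k) '' (K : Set G)).Finite

section Assembly

variable {G : Type} [Group G] {B : ℕ → Type} [∀ n, AddCommGroup (B n)]

/-- Partial products. -/
def phiN (c : ∀ n, B n → G) : ℕ → (∀ n, B n) → G
  | 0, _ => 1
  | n + 1, y => c n (y n) * phiN c n y

variable {c : ∀ n, B n → G} {H : ℕ → Subgroup G}

lemma phiN_mem (hs : ∀ n, IsStep (H n) (H (n + 1)) (B n) (c n)) (N : ℕ) (y : ∀ n, B n) :
    phiN c N y ∈ H N := by
  induction N with
  | zero => exact one_mem _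
  | succ n ih => exact mul_mem ((hs n).mem _) ((hs n).le ih)

lemma phiN_congr (N : ℕ) (y y' : ∀ n, B n) (h : ∀ n < N, y n = y' n) :
    phiN c N y = phiN c N y' := by
  induction N with
  | zero => rfl
  | succ n ih =>
    show c n (y n) * phiN c n y = c n (y' n) * phiN c n y'
    rw [h n (by omega), ih (fun m hm => h m (by omega))]

lemma phiN_stable (hs : ∀ n, IsStep (H n) (H (n + 1)) (B n) (c n)) (N M : ℕ) (hNM : N ≤ M)
    (y : ∀ n, B n) (hy : ∀ n, N ≤ n → y n = 0) : phiN c M y = phiN c N y := by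
  induction M, hNM using Nat.le_induction with
  | base => rfl
  | succ m hm ih =>
    show c m (y m) * phiN c m y = _
    rw [hy m hm, (hs m).zero, one_mul, ih]

lemma phiN_add_stable (N M : ℕ) (hNM : N ≤ M)
    (y a : ∀ n, B n) (ha : ∀ n, N ≤ n → a n = 0) :
    (phiN c M y)⁻¹ * phiN c M (y + a) = (phiN c N y)⁻¹ * phiN c N (y + a) := by
  induction M, hNM using Nat.le_induction with
  | base => rfl
  | succ m hm ih =>
    show (c m (y m) * phiN c m y)⁻¹ * (c m ((y + a) m) * phiN c m (y + a)) = _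
    rw [← ih, Pi.add_apply, ha m hm, add_zero]
    group

lemma phiN_mul_stable (hs : ∀ n, IsStep (H n) (H (n + 1)) (B n) (c n)) (hmono : Monotone H)
    (N M : ℕ) (hNM : N ≤ M)
    (y y' : ∀ n, B n) (s : G) (hsN : s ∈ H N) (h : phiN c M y' = phiN c M y * s) :
    phiN c N y' = phiN c N y * s ∧ ∀ n, N ≤ n → n < M → y' n = y n := by
  induction M, hNM using Nat.le_induction with
  | base => exact ⟨h, fun n h1 h2 => by omega⟩
  | succ m hm ih =>
    have h' : c m (y' m) * phiN c m y' = c m (y m) * phiN c m y * s := h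
    have e : y m = y' m := by
      apply (hs m).uniq
      have : (c m (y m))⁻¹ * c m (y' m) = phiN c m y * s * (phiN c m y')⁻¹ := by
        rw [eq_mul_inv_iff_mul_eq, mul_assoc, h']; group
      rw [this]
      exact mul_mem (mul_mem (phiN_mem hs _ _) (hmono hm hsN)) (inv_mem (phiN_mem hs _ _))
    have h2 : phiN c m y' = phiN c m y * s := by
      rw [e, mul_assoc] at h'
      exact mul_left_cancel h'
    obtain ⟨i1, i2⟩ := ih h2
    refine ⟨i1, fun n h1 h3 => ?_⟩
    rcases Nat.lt_succ_iff_lt_or_eq.1 h3 with h4 | rfl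
    · exact i2 n h1 h4
    · exact e.symm

lemma conj_fin {K : Subgroup G} (fc : ∀ s ∈ K, ((fun k => k⁻¹ * s * k) '' (K : Set G)).Finite)
    {S : Set G} (hS : S.Finite) (hSK : S ⊆ K) :
    {x | ∃ s ∈ S, ∃ k ∈ K, x = k⁻¹ * s * k}.Finite := by
  refine (hS.biUnion (t := fun s => (fun k => k⁻¹ * s * k) '' (K : Set G))
    fun s hs => fc s (hSK hs)).subset ?_
  rintro x ⟨s, hs, k, hk, rfl⟩
  exact Set.mem_biUnion hs ⟨k, hk, rfl⟩

lemma phiN_finA (hs : ∀ n, IsStep (H n) (H (n + 1)) (B n) (c n)) (N : ℕ) (a : ∀ n, B n) :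
    (Set.range fun y => (phiN c N y)⁻¹ * phiN c N (y + a)).Finite := by
  induction N with
  | zero =>
    refine (Set.finite_singleton (1 : G)).subset ?_
    rintro _ ⟨y, rfl⟩
    simp [phiN]
  | succ n ih =>
    have h1 := conj_fin (hs n).fc ((hs n).fin1 (a n)) (by
      rintro _ ⟨b, rfl⟩
      exact mul_mem (inv_mem ((hs n).mem _)) ((hs n).mem _))
    refine (Set.Finite.image2 (fun x y => x * y) h1 ih).subset ?_
    rintro _ ⟨y, rfl⟩
    refine ⟨_, ⟨_, ⟨y n, rfl⟩, phiN c n y, (hs n).le (phiN_mem hs _ _), rfl⟩, _, ⟨y, rfl⟩, ?_⟩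
    simp only [phiN, Pi.add_apply]
    group

lemma phiN_finB (hs : ∀ n, IsStep (H n) (H (n + 1)) (B n) (c n)) (N : ℕ) (s : G) (hsN : s ∈ H N) :
    ∃ T : Set (∀ n, B n), T.Finite ∧ ∀ y y', phiN c N y' = phiN c N y * s →
      ∃ t ∈ T, ∀ n < N, y' n = y n + t n := by
  classical
  induction N generalizing s with
  | zero => exact ⟨{0}, Set.finite_singleton _, fun y y' _ => ⟨0, rfl, fun n hn => by omega⟩⟩
  | succ n ih =>
    have hC := (hs n).fc s hsN
    set C := (fun k => k⁻¹ * s * k) '' (H (n + 1) : Set G) with hCd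
    have hCK : ∀ u ∈ C, u ∈ H (n + 1) := by
      rintro _ ⟨k, hk, rfl⟩
      exact mul_mem (mul_mem (inv_mem hk) hsN) hk
    -- possible values of the difference of the last coordinates
    set D : Set (B n) := ⋃ u ∈ C, {β | ∃ b, (c n (b + β))⁻¹ * (c n b * u) ∈ H n} with hD
    have hDf : D.Finite := hC.biUnion fun u hu => (hs n).fin2 u (hCK u hu)
    set E : Set G := ⋃ β ∈ D, (Set.range fun b => (c n b)⁻¹ * c n (b + β))⁻¹ with hE
    have hEf : E.Finite := hDf.biUnion fun β _ => ((hs n).fin1 β).inv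
    have hEK : E ⊆ H (n + 1) := by
      intro x hx
      simp only [hE, Set.mem_iUnion] at hx
      obtain ⟨β, _, b, hb⟩ := hx
      rw [← inv_inv x, ← hb]
      exact inv_mem (mul_mem (inv_mem ((hs n).mem _)) ((hs n).mem _))
    have hE2 := conj_fin (hs n).fc hEf hEK
    have hE3 := hE2.image (fun x => x * s)
    set W := (fun x => x * s) '' {x | ∃ s ∈ E, ∃ k ∈ H (n + 1), x = k⁻¹ * s * k} with hW
    have ih' : ∀ w : G, ∃ T : Set (∀ n, B n), T.Finite ∧ (w ∈ H n → ∀ y y',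
        phiN c n y' = phiN c n y * w → ∃ t ∈ T, ∀ m < n, y' m = y m + t m) := by
      intro w
      by_cases hw : w ∈ H n
      · obtain ⟨T, h1, h2⟩ := ih w hw
        exact ⟨T, h1, fun _ => h2⟩
      · exact ⟨∅, Set.finite_empty, fun h => absurd h hw⟩
    choose T hT1 hT2 using ih'
    refine ⟨Set.image2 (fun (t : ∀ n, B n) β => Function.update t n β) (⋃ w ∈ W, T w) D,
      Set.Finite.image2 _ (hE3.biUnion fun w _ => hT1 w) hDf, ?_⟩
    intro y y' h
    have h' : c n (y' n) * phiN c n y' = c n (y n) * phiN c n y * s := h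
    have hy := phiN_mem hs n y
    have hy' := phiN_mem hs n y'
    set p := phiN c n y with hp
    set p' := phiN c n y' with hp'
    have hβ : y' n - y n ∈ D := by
      refine Set.mem_biUnion (x := p * s * p⁻¹) ⟨p⁻¹, inv_mem ((hs n).le hy), by simp⟩ ⟨y n, ?_⟩
      have : (c n (y n + (y' n - y n)))⁻¹ * (c n (y n) * (p * s * p⁻¹)) = p' * p⁻¹ := by
        rw [add_sub_cancel, inv_mul_eq_iff_eq_mul, ← mul_assoc (c n (y' n)), h']
        group
      rw [this]
      exact mul_mem hy' (inv_mem hy)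
    have hw : p⁻¹ * p' ∈ W := by
      refine ⟨p⁻¹ * ((c n (y' n))⁻¹ * c n (y n)) * p, ⟨(c n (y' n))⁻¹ * c n (y n), ?_, p,
        (hs n).le hy, rfl⟩, ?_⟩
      · refine Set.mem_biUnion hβ ?_
        refine ⟨y n, ?_⟩
        simp
      · show p⁻¹ * ((c n (y' n))⁻¹ * c n (y n)) * p * s = p⁻¹ * p'
        have : p' = (c n (y' n))⁻¹ * (c n (y n) * p * s) := by rw [← h']; group
        rw [this]; group
    obtain ⟨t, ht, ht2⟩ := hT2 (p⁻¹ * p') (mul_mem (inv_mem hy) hy') y y' (by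
      rw [← hp, ← hp']; group)
    refine ⟨_, ⟨t, Set.mem_biUnion hw ht, y' n - y n, hβ, rfl⟩, ?_⟩
    intro m hm
    rcases Nat.lt_succ_iff_lt_or_eq.1 hm with h4 | rfl
    · show y' m = y m + Function.update t n (y' n - y n) m
      rw [Function.update_of_ne (by omega)]; exact ht2 m h4
    · simp

lemma dfinsupp_bound (y : Π₀ n, B n) : ∃ N, ∀ n, N ≤ n → y n = 0 := by
  classical
  refine ⟨y.support.sup id + 1, fun n hn => ?_⟩
  by_contra h
  have : n ≤ y.support.sup id := Finset.le_sup (f := id) (by simpa using h)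
  omega

theorem assembly (hs : ∀ n, IsStep (H n) (H (n + 1)) (B n) (c n)) (h0 : H 0 = ⊥)
    (hall : ∀ g, ∃ n, g ∈ H n) :
    ∃ F : G ≃ Π₀ n, B n, (∀ s, (Set.range fun x => F (x * s) - F x).Finite) ∧
      ∀ a, (Set.range fun y => (F.symm y)⁻¹ * F.symm (y + a)).Finite := by
  classical
  have hmono : Monotone H := monotone_nat_of_le_succ fun n => (hs n).le
  choose bd hbd using fun y : Π₀ n, B n => dfinsupp_bound y
  let Φ : (Π₀ n, B n) → G := fun y => phiN c (bd y) y
  have hΦ : ∀ y M, (∀ n, M ≤ n → y n = 0) → Φ y = phiN c M y := by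
    intro y M hM
    rcases le_total M (bd y) with h | h
    · exact phiN_stable hs _ _ h y hM
    · exact (phiN_stable hs _ _ h y (hbd y)).symm
  have hΦ2 : ∀ y M, bd y ≤ M → Φ y = phiN c M y := fun y M h =>
    hΦ y M fun n hn => hbd y n (h.trans hn)
  have key : ∀ N y y' s, s ∈ H N → Φ y' = Φ y * s →
      phiN c N y' = phiN c N y * s ∧ ∀ n, N ≤ n → y' n = y n := by
    intro N y y' s hsN h
    have h1 : ∀ M, N ≤ M → bd y ≤ M → bd y' ≤ M → _ := fun M a1 a2 a3 =>
      phiN_mul_stable hs hmono N M a1 y y' s hsN (by rw [← hΦ2 y M a2, ← hΦ2 y' M a3, h])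
    refine ⟨(h1 (N + bd y + bd y') (by omega) (by omega) (by omega)).1, fun n hn => ?_⟩
    exact (h1 (N + bd y + bd y' + n + 1) (by omega) (by omega) (by omega)).2 n hn (by omega)
  have hinj : Function.Injective Φ := by
    intro y' y h
    refine DFinsupp.ext fun n => ?_
    exact (key 0 y y' 1 (one_mem _) (by simpa using h)).2 n (Nat.zero_le _)
  have hsurj' : ∀ N, ∀ g ∈ H N, ∃ y : Π₀ n, B n, (∀ n, N ≤ n → y n = 0) ∧ phiN c N y = g := by
    intro N
    induction N with
    | zero =>
      intro g hg
      rw [h0, Subgroup.mem_bot] at hg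
      exact ⟨0, fun _ _ => rfl, hg.symm⟩
    | succ n ih =>
      intro g hg
      obtain ⟨b, hb⟩ := (hs n).ex g hg
      obtain ⟨y, hy1, hy2⟩ := ih _ hb
      refine ⟨y.update n b, fun m hm => ?_, ?_⟩
      · rw [DFinsupp.coe_update, Function.update_of_ne (by omega)]
        exact hy1 m (by omega)
      · show c n (y.update n b n) * phiN c n (y.update n b) = g
        rw [phiN_congr n (y.update n b) y, hy2]
        · simp
        · intro m hm
          rw [DFinsupp.coe_update, Function.update_of_ne (by omega)]
  have hsurj : Function.Surjective Φ := by
    intro g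
    obtain ⟨N, hN⟩ := hall g
    obtain ⟨y, hy1, hy2⟩ := hsurj' N g hN
    exact ⟨y, by rw [hΦ y N hy1, hy2]⟩
  let E : (Π₀ n, B n) ≃ G := Equiv.ofBijective Φ ⟨hinj, hsurj⟩
  have hE : ∀ y, E y = Φ y := fun y => rfl
  refine ⟨E.symm, fun s => ?_, fun a => ?_⟩
  · obtain ⟨N, hN⟩ := hall s
    obtain ⟨T, hT, hT2⟩ := phiN_finB hs N s hN
    refine Set.Finite.of_finite_image (f := fun (d : Π₀ n, B n) => (d : ∀ n, B n)) ?_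
      DFunLike.coe_injective.injOn
    refine (hT.image fun t n => if n < N then t n else 0).subset ?_
    rintro _ ⟨_, ⟨x, rfl⟩, rfl⟩
    obtain ⟨y, rfl⟩ := E.surjective x
    obtain ⟨y', hy'⟩ := E.surjective (E y * s)
    obtain ⟨k1, k2⟩ := key N y y' s hN hy'
    obtain ⟨t, ht, ht2⟩ := hT2 y y' k1
    refine ⟨t, ht, ?_⟩
    simp only [← hy', Equiv.symm_apply_apply]
    funext n
    by_cases hn : n < N
    · simp [hn, ht2 n hn]
    · simp [hn, k2 n (by omega)]
  · obtain ⟨N, hN⟩ := dfinsupp_bound a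
    refine (phiN_finA hs N a).subset ?_
    rintro _ ⟨y, rfl⟩
    refine ⟨y, ?_⟩
    show _ = (Φ y)⁻¹ * Φ (y + a)
    rw [hΦ2 y (N + bd y + bd (y + a)) (by omega), hΦ2 (y + a) (N + bd y + bd (y + a)) (by omega)]
    exact (phiN_add_stable N (N + bd y + bd (y + a)) (by omega) y a hN).symm

end Assembly

section GroupTheory

variable {G : Type} [Group G]

lemma fba_data (hG : LocallyFiniteByAbelian G) (K : Subgroup G) (hK : K.FG) :
    ∃ N : Subgroup G, N ≤ K ∧ (N : Set G).Finite ∧ (∀ k ∈ K, ∀ n ∈ N, k * n * k⁻¹ ∈ N) ∧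
      ∀ a ∈ K, ∀ b ∈ K, a * b * a⁻¹ * b⁻¹ ∈ N := by
  obtain ⟨N, hn, hf, hc⟩ := hG K ((Group.fg_iff_subgroup_fg K).2 hK)
  refine ⟨N.map K.subtype, ?_, ?_, ?_, ?_⟩
  · rintro _ ⟨x, _, rfl⟩
    exact x.2
  · rw [Subgroup.coe_map]
    exact (Set.toFinite (N : Set K)).image _
  · rintro k hk _ ⟨x, hx, rfl⟩
    exact ⟨⟨k, hk⟩ * x * ⟨k, hk⟩⁻¹, hn.conj_mem x hx _, rfl⟩
  · intro a ha b hb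
    exact ⟨_, hc ⟨a, ha⟩ ⟨b, hb⟩, rfl⟩

lemma fc_of_fba (hG : LocallyFiniteByAbelian G) (K : Subgroup G) (hK : K.FG) (s : G) (hs : s ∈ K) :
    ((fun k => k⁻¹ * s * k) '' (K : Set G)).Finite := by
  obtain ⟨N, _, hf, _, hc⟩ := fba_data hG K hK
  refine (hf.image fun n => n * s).subset ?_
  rintro _ ⟨k, hk, rfl⟩
  refine ⟨_, hc k⁻¹ (inv_mem hk) s hs, ?_⟩
  simp

lemma central_pow (hG : LocallyFiniteByAbelian G) (K : Subgroup G) (hK : K.FG) (g : G)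
    (hg : g ∈ K) : ∃ k : ℕ, 0 < k ∧ ∀ x ∈ K, g ^ k * x = x * g ^ k := by
  have : Group.FG K := (Group.fg_iff_subgroup_fg K).2 hK
  obtain ⟨N, hn, hf, hc⟩ := hG K inferInstance
  have : Finite (commutatorSet K) := by
    refine Set.Finite.subset (Set.toFinite (N : Set K)) ?_
    rintro _ ⟨a, b, rfl⟩
    exact hc a b
  refine ⟨(Subgroup.center K).index, Nat.pos_of_ne_zero Subgroup.FiniteIndex.index_ne_zero, ?_⟩
  intro x hx
  have h := Subgroup.pow_index_mem (Subgroup.center K) ⟨g, hg⟩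
  have h2 := (Subgroup.mem_center_iff.1 h) ⟨x, hx⟩
  exact (congrArg Subtype.val h2).symm

lemma finite_quot (hG : LocallyFiniteByAbelian G) (H D K : Subgroup G) (hK : K.FG) (g : G)
    (hKd : K = Subgroup.closure ((H : Set G) ∪ {g})) (hHD : H ≤ D)
    (j : ℕ) (hj : 0 < j) (hgj : g ^ j ∈ D) : Finite (K ⧸ D.subgroupOf K) := by
  obtain ⟨N, hNK, hf, hn, hc⟩ := fba_data hG K hK
  have hgK : g ∈ K := by rw [hKd]; exact Subgroup.subset_closure (Or.inr rfl)
  have hHK : H ≤ K := by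
    intro x hx; rw [hKd]; exact Subgroup.subset_closure (Or.inl hx)
  have h1 : ∀ x ∈ K, ∃ n ∈ N, ∃ i : ℤ, ∃ d ∈ D, x = n * g ^ i * d := by
    have hH : ∀ h ∈ H, ∀ y, (∃ n ∈ N, ∃ i : ℤ, ∃ d ∈ D, y = n * g ^ i * d) →
        ∃ n ∈ N, ∃ i : ℤ, ∃ d ∈ D, h * y = n * g ^ i * d := by
      rintro h hh _ ⟨n, hn1, i, d, hd, rfl⟩
      refine ⟨(h * n * h⁻¹) * (h * g ^ i * h⁻¹ * (g ^ i)⁻¹),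
        mul_mem (hn h (hHK hh) n hn1) (hc h (hHK hh) _ (zpow_mem hgK i)), i, h * d,
        mul_mem (hHD hh) hd, ?_⟩
      group
    have hg : ∀ z : ℤ, ∀ y, (∃ n ∈ N, ∃ i : ℤ, ∃ d ∈ D, y = n * g ^ i * d) →
        ∃ n ∈ N, ∃ i : ℤ, ∃ d ∈ D, g ^ z * y = n * g ^ i * d := by
      rintro z _ ⟨n, hn1, i, d, hd, rfl⟩
      refine ⟨g ^ z * n * (g ^ z)⁻¹, hn _ (zpow_mem hgK z) n hn1, z + i, d, hd, ?_⟩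
      rw [zpow_add]
      group
    intro x hx
    rw [hKd] at hx
    induction hx using Subgroup.closure_induction_left with
    | one => exact ⟨1, one_mem _, 0, 1, one_mem _, by simp⟩
    | mul_left x hx y hy ih =>
      rcases hx with hx | rfl
      · exact hH x hx y ih
      · simpa using hg 1 y ih
    | inv_mul_cancel x hx y hy ih =>
      rcases hx with hx | rfl
      · exact hH x⁻¹ (inv_mem hx) y ih
      · simpa using hg (-1) y ih
  have : Finite N := hf
  let q : N × Fin j → K ⧸ D.subgroupOf K := fun p =>
    QuotientGroup.mk ⟨p.1 * g ^ (p.2 : ℕ), mul_mem (hNK p.1.2) (pow_mem hgK _)⟩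
  refine Finite.of_surjective q ?_
  intro x
  obtain ⟨⟨x, hx⟩, rfl⟩ := QuotientGroup.mk_surjective x
  obtain ⟨n, hn1, i, d, hd, rfl⟩ := h1 x hx
  have hj0 : (j : ℤ) ≠ 0 := by omega
  refine ⟨(⟨n, hn1⟩, ⟨(i % j).toNat, ?_⟩), ?_⟩
  · have := Int.emod_lt_of_pos i (by omega : (0 : ℤ) < j)
    omega
  · rw [QuotientGroup.eq, Subgroup.mem_subgroupOf]
    show (n * g ^ (i % j).toNat)⁻¹ * (n * g ^ i * d) ∈ D
    have e1 : g ^ (i % j).toNat = g ^ (i % j) := by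
      rw [← zpow_natCast, Int.toNat_of_nonneg (Int.emod_nonneg i hj0)]
    have e2 : g ^ i = g ^ (i % j) * (g ^ j) ^ (i / j) := by
      rw [← zpow_natCast g j, ← zpow_mul, ← zpow_add, Int.emod_add_mul_ediv]
    have : (n * g ^ (i % j).toNat)⁻¹ * (n * g ^ i * d) = (g ^ j) ^ (i / j) * d := by
      rw [e1, e2]; group
    rw [this]
    exact mul_mem (zpow_mem hgj _) hd

lemma step_core (hG : LocallyFiniteByAbelian G) (H K : Subgroup G) (hK : K.FG) (g : G)
    (hKd : K = Subgroup.closure ((H : Set G) ∪ {g})) (Z : Type) (ζ : (Z →₀ ℤ) → G)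
    (hadd : ∀ a b, ζ (a + b) = ζ a * ζ b) (hζK : ∀ a, ζ a ∈ K)
    (hcomm : ∀ a, ∀ x ∈ K, ζ a * x = x * ζ a) (hζ : ∀ a, ζ a ∈ H → a = 0)
    (j : ℕ) (hj : 0 < j) (hgj : ∃ h ∈ H, ∃ a, g ^ j = h * ζ a) (hnorm : HasNorm (Z →₀ ℤ)) :
    ∃ (κ : ℕ → ℕ) (c : (Z →₀ ℤ) × (Π₀ i, ZMod (κ i)) → G),
      (∀ i, κ i = 1 ∨ (κ i).Prime) ∧ HasNorm ((Z →₀ ℤ) × (Π₀ i, ZMod (κ i))) ∧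
      IsStep H K _ c := by
  classical
  have hHK : H ≤ K := by
    intro x hx; rw [hKd]; exact Subgroup.subset_closure (Or.inl hx)
  have hz0 : ζ 0 = 1 := by
    have := hadd 0 0
    simpa using this
  have hneg : ∀ a, ζ (-a) = (ζ a)⁻¹ := by
    intro a
    rw [eq_inv_iff_mul_eq_one, ← hadd, neg_add_cancel, hz0]
  let D : Subgroup G :=
    { carrier := {x | ∃ h ∈ H, ∃ a, x = h * ζ a}
      one_mem' := ⟨1, one_mem _, 0, by simp [hz0]⟩
      mul_mem' := by
        rintro _ _ ⟨h, hh, a, rfl⟩ ⟨h', hh', a', rfl⟩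
        refine ⟨h * h', mul_mem hh hh', a + a', ?_⟩
        rw [hadd, mul_assoc, ← mul_assoc (ζ a), hcomm a h' (hHK hh')]
        group
      inv_mem' := by
        rintro _ ⟨h, hh, a, rfl⟩
        refine ⟨h⁻¹, inv_mem hh, -a, ?_⟩
        rw [mul_inv_rev, ← hneg, hcomm _ _ (inv_mem (hHK hh))] }
  have hD : ∀ x, x ∈ D ↔ ∃ h ∈ H, ∃ a, x = h * ζ a := fun x => Iff.rfl
  have hfin : Finite (K ⧸ D.subgroupOf K) :=
    finite_quot hG H D K hK g hKd (fun h hh => ⟨h, hh, 0, by simp [hz0]⟩) j hj hgj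
  obtain ⟨κ, hκ, hcard⟩ := exists_card_dfinsupp (Nat.card (K ⧸ D.subgroupOf K)) Nat.card_pos.ne'
  have : Finite (Π₀ i, ZMod (κ i)) := Nat.finite_of_card_ne_zero (by
    rw [hcard]; exact Nat.card_pos.ne')
  obtain ⟨e0⟩ : Nonempty ((Π₀ i, ZMod (κ i)) ≃ (K ⧸ D.subgroupOf K)) :=
    Finite.card_eq.1 hcard
  let e : (Π₀ i, ZMod (κ i)) ≃ (K ⧸ D.subgroupOf K) :=
    e0.trans (Equiv.swap (e0 0) (QuotientGroup.mk 1))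
  have he0 : e 0 = QuotientGroup.mk 1 := by simp [e]
  let r : (Π₀ i, ZMod (κ i)) → K := fun b => if b = 0 then 1 else (e b).out
  have hr : ∀ b, (QuotientGroup.mk (r b) : K ⧸ D.subgroupOf K) = e b := by
    intro b
    by_cases hb : b = 0
    · subst hb; simp [r, he0]
    · simp [r, hb]
  have hrD : ∀ b b', ((r b : G))⁻¹ * r b' ∈ D → b = b' := by
    intro b b' h
    apply e.injective
    rw [← hr, ← hr, QuotientGroup.eq, Subgroup.mem_subgroupOf]
    exact h
  have hrex : ∀ x ∈ K, ∃ b, (r b : G)⁻¹ * x ∈ D := by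
    intro x hx
    obtain ⟨b, hb⟩ := e.surjective (QuotientGroup.mk ⟨x, hx⟩)
    rw [← hr, QuotientGroup.eq, Subgroup.mem_subgroupOf] at hb
    exact ⟨b, hb⟩
  refine ⟨κ, fun p => r p.2 * ζ p.1, hκ, hnorm.prod (hasNorm_finite _), ?_⟩
  refine ⟨hHK, fun p => mul_mem (r p.2).2 (hζK _), by simp [r, hz0], ?_, ?_, ?_, ?_,
    fc_of_fba hG K hK⟩
  · intro x hx
    obtain ⟨b, h, hh, a, ha⟩ := hrex x hx
    refine ⟨(a, b), ?_⟩
    have : ((r b : G) * ζ a)⁻¹ * x = h := by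
      rw [mul_inv_rev, mul_assoc, ha, ← hcomm a h (hHK hh)]; group
    show ((r b : G) * ζ a)⁻¹ * x ∈ H
    rwa [this]
  · rintro ⟨a, b⟩ ⟨a', b'⟩ h
    have h : ((r b : G) * ζ a)⁻¹ * (r b' * ζ a') ∈ H := h
    have e1 : ((r b : G) * ζ a)⁻¹ * (r b' * ζ a') = ((r b : G)⁻¹ * r b') * ζ (a' - a) := by
      rw [mul_inv_rev, ← hneg, mul_assoc, hcomm _ _ (mul_mem (inv_mem (r b).2)
        (mul_mem (r b').2 (hζK a'))), sub_eq_add_neg, hadd]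
      group
    rw [e1] at h
    have hb : b = b' := by
      apply hrD
      refine (hD _).2 ⟨_, h, -(a' - a), ?_⟩
      rw [mul_assoc, ← hadd]; simp [hz0]
    subst hb
    have := hζ _ (by simpa using h)
    rw [sub_eq_zero] at this
    rw [this]
  · rintro ⟨μ, β⟩
    refine (Set.finite_range fun b : (Π₀ i, ZMod (κ i)) =>
      ((r b : G)⁻¹ * r (b + β)) * ζ μ).subset ?_
    rintro _ ⟨⟨a, b⟩, rfl⟩
    refine ⟨b, ?_⟩
    show _ = ((r b : G) * ζ a)⁻¹ * (r (b + β) * ζ (a + μ))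
    rw [mul_inv_rev, ← hneg, mul_assoc (ζ (-a)), hcomm _ _ (mul_mem (inv_mem (r b).2)
        (mul_mem (r (b + β)).2 (hζK _)))]
    have : ζ μ = ζ (a + μ) * ζ (-a) := by
      rw [← hadd]; congr 1; abel
    show ((r b : G)⁻¹ * r (b + β)) * ζ μ = _
    rw [this]; group
  · intro u hu
    have h1 : (⋃ p : (Π₀ i, ZMod (κ i)) × (Π₀ i, ZMod (κ i)),
        (fun μ => (μ, p.2)) '' {μ : Z →₀ ℤ |
          ((r (p.1 + p.2) : G)⁻¹ * r p.1 * u) * ζ (-μ) ∈ H}).Finite := by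
      refine Set.finite_iUnion fun p => Set.Finite.image _ (Set.Subsingleton.finite ?_)
      intro μ hμ μ' hμ'
      have hμ : ((r (p.1 + p.2) : G)⁻¹ * r p.1 * u) * ζ (-μ) ∈ H := hμ
      have hμ' : ((r (p.1 + p.2) : G)⁻¹ * r p.1 * u) * ζ (-μ') ∈ H := hμ'
      have := mul_mem (inv_mem hμ) hμ'
      rw [mul_inv_rev, mul_assoc, inv_mul_cancel_left, ← hneg, ← hadd] at this
      have := hζ _ this
      rw [neg_neg, ← sub_eq_add_neg, sub_eq_zero] at this
      exact this
    refine h1.subset ?_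
    rintro ⟨μ, β⟩ ⟨⟨a, b⟩, h⟩
    refine Set.mem_iUnion.2 ⟨(b, β), μ, ?_, rfl⟩
    have h : ((r (b + β) : G) * ζ (a + μ))⁻¹ * ((r b * ζ a) * u) ∈ H := h
    show ((r (b + β) : G)⁻¹ * r b * u) * ζ (-μ) ∈ H
    convert h using 1
    rw [mul_inv_rev, ← hneg, mul_assoc (r b : G), hcomm a u hu, mul_assoc (ζ _),
      hcomm (-(a + μ)) _ (mul_mem (inv_mem (r (b + β)).2) (mul_mem (r b).2 (mul_mem hu (hζK a))))]
    have : ζ (-μ) = ζ a * ζ (-(a + μ)) := by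
      rw [← hadd]; congr 1; abel
    rw [this]; group

lemma step_exists (hG : LocallyFiniteByAbelian G) (H : Subgroup G) (hH : H.FG) (g : G) :
    ∃ (K : Subgroup G), K.FG ∧ g ∈ K ∧ ∃ (Z : Type) (κ : ℕ → ℕ)
      (c : (Z →₀ ℤ) × (Π₀ i, ZMod (κ i)) → G), Countable Z ∧
      (∀ i, κ i = 1 ∨ (κ i).Prime) ∧ HasNorm ((Z →₀ ℤ) × (Π₀ i, ZMod (κ i))) ∧
      IsStep H K _ c := by
  obtain ⟨K, hKd⟩ : ∃ K, K = Subgroup.closure ((H : Set G) ∪ {g}) := ⟨_, rfl⟩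
  have hK : K.FG := by
    obtain ⟨S, hS⟩ := hH
    classical
    refine ⟨S ∪ {g}, ?_⟩
    rw [hKd, ← hS, Finset.coe_union, Subgroup.closure_union, Subgroup.closure_union,
      Subgroup.closure_eq, Finset.coe_singleton]
  have hgK : g ∈ K := by rw [hKd]; exact Subgroup.subset_closure (Or.inr rfl)
  refine ⟨K, hK, hgK, ?_⟩
  by_cases hj : ∃ j : ℕ, 0 < j ∧ g ^ j ∈ H
  · obtain ⟨j, hj, hgj⟩ := hj
    obtain ⟨κ, c, h1, h2, h3⟩ := step_core hG H K hK g hKd Empty (fun _ => 1) (by simp)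
      (fun _ => one_mem _) (by simp) (fun a _ => Subsingleton.elim _ _) j hj
      ⟨_, hgj, 0, by simp⟩ (hasNorm_finite _)
    exact ⟨Empty, κ, c, inferInstance, h1, h2, h3⟩
  · obtain ⟨k, hk, hcen⟩ := central_pow hG K hK g hgK
    obtain ⟨κ, c, h1, h2, h3⟩ := step_core hG H K hK g hKd Unit (fun a => (g ^ k) ^ (a ()))
      (fun a b => by simp [zpow_add]) (fun _ => zpow_mem (pow_mem hgK _) _) (fun a x hx =>
        ((show Commute (g ^ k) x from hcen x hx).zpow_left _))
      (fun a ha => by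
        by_contra hne
        have h0 : a () ≠ 0 := fun h => hne (Finsupp.ext fun u => by simpa using h)
        apply hj
        refine ⟨k * (a ()).natAbs, Nat.mul_pos hk (Int.natAbs_pos.2 h0), ?_⟩
        rw [pow_mul]
        rcases Int.natAbs_eq (a ()) with h | h
        · rw [h, zpow_natCast] at ha
          exact ha
        · rw [h, zpow_neg, zpow_natCast] at ha
          exact inv_mem_iff.1 ha) k hk
      ⟨1, one_mem _, Finsupp.single () 1, by simp⟩
      (hasNorm_int.congr (Finsupp.uniqueAddEquiv ()))
    exact ⟨Unit, κ, c, inferInstance, h1, h2, h3⟩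

end GroupTheory

/-- Every countable locally finite-by-abelian group `G` with a proper left-invariant
metric is bijectively coarsely equivalent to the abelian group `ℤ^m × ℤ_f` (with a proper
left-invariant metric) for some `m ∈ ℕ ∪ {0, ∞}` and some `f : Π → ℕ ∪ {0, ∞}` — here
`ℤ^m` is realized as `ι →₀ ℤ` for a countable type `ι` and `ℤ_f` as a direct sum
`⨁ (n : ℕ), ℤ/(g n)ℤ` with each `g n` equal to `1` or prime. -/
theorem locallyFiniteByAbelian_bijectively_coarsely_equiv_Zm_mul_Zf
    (G : Type) [Group G] [Countable G] [MetricSpace G]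
    (hinv : ∀ g x y : G, dist (g * x) (g * y) = dist x y)
    (hprop : ∀ (x : G) (r : ℝ), {y : G | dist x y ≤ r}.Finite)
    (hG : LocallyFiniteByAbelian G) :
    ∃ (ι : Type) (_ : Countable ι) (g : ℕ → ℕ), (∀ n, g n = 1 ∨ (g n).Prime) ∧
      ∃ d : ((ι →₀ ℤ) × DirectSum ℕ fun n => ZMod (g n)) →
            ((ι →₀ ℤ) × DirectSum ℕ fun n => ZMod (g n)) → ℝ,
        IsMetricFun d ∧
        (∀ a x y : (ι →₀ ℤ) × DirectSum ℕ fun n => ZMod (g n), d (a + x) (a + y) = d x y) ∧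
        (∀ (x : (ι →₀ ℤ) × DirectSum ℕ fun n => ZMod (g n)) (r : ℝ), {y | d x y ≤ r}.Finite) ∧
        ∃ F : G → (ι →₀ ℤ) × DirectSum ℕ fun n => ZMod (g n), Function.Bijective F ∧
          (∀ δ : ℝ, 0 ≤ δ → ∃ ε : ℝ, 0 ≤ ε ∧
            ∀ x y : G, dist x y ≤ δ → d (F x) (F y) ≤ ε) ∧
          (∀ δ : ℝ, 0 ≤ δ → ∃ ε : ℝ, 0 ≤ ε ∧
            ∀ x y : G, d (F x) (F y) ≤ δ → dist x y ≤ ε) := by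
  obtain ⟨enum, henum⟩ := exists_surjective_nat G
  choose K hKfg hgK Z κ c hZ hκ hnorm hstep using
    fun (p : {H : Subgroup G // H.FG}) (g : G) => step_exists hG p.1 p.2 g
  let P : ℕ → {H : Subgroup G // H.FG} := fun n =>
    Nat.rec ⟨⊥, Subgroup.FG.bot⟩ (fun n p => ⟨K p (enum n), hKfg p (enum n)⟩) n
  have hs : ∀ n, IsStep (P n).1 (P (n + 1)).1 _ (c (P n) (enum n)) :=
    fun n => hstep (P n) (enum n)
  have hall : ∀ g, ∃ n, g ∈ (P n).1 := by
    intro g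
    obtain ⟨n, rfl⟩ := henum g
    exact ⟨n + 1, hgK (P n) (enum n)⟩
  obtain ⟨F, hF1, hF2⟩ := assembly (H := fun n => (P n).1) hs rfl hall
  obtain ⟨E⟩ := target_equiv (fun n => Z (P n) (enum n)) (fun n => κ (P n) (enum n))
  have hsub : ∀ a b, E (a - b) = E a - E b := fun a b => map_sub E.toAddMonoidHom a b
  have hN := HasNorm.congr E.symm (hasNorm_dfinsupp _ fun n => hnorm (P n) (enum n))
  have := fun n => hZ (P n) (enum n)
  refine ⟨Σ n, Z (P n) (enum n), inferInstance,
    fun j => κ (P (Nat.unpair j).1) (enum (Nat.unpair j).1) (Nat.unpair j).2,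
    fun j => hκ _ _ _, ?_⟩
  obtain ⟨N, n0, nneg, nadd, nfin⟩ := hN
  refine ⟨fun x y => (N (y - x) : ℝ), ⟨?_, ?_, ?_⟩, ?_, ?_, fun x => E (F x), ?_, ?_, ?_⟩
  · intro x y
    rw [Nat.cast_eq_zero, n0, sub_eq_zero, eq_comm]
  · intro x y
    show (N (y - x) : ℝ) = N (x - y)
    rw [← nneg, neg_sub]
  · intro x y z
    have := nadd (y - x) (z - y)
    rw [show y - x + (z - y) = z - x by abel] at this
    show (N (z - x) : ℝ) ≤ N (y - x) + N (z - y)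
    exact_mod_cast this
  · intro a x y
    simp only [add_sub_add_left_eq_sub]
  · intro x r
    refine Set.Finite.of_finite_image (f := fun y => y - x) ?_ (sub_left_injective.injOn)
    refine (nfin ⌈r⌉₊).subset ?_
    rintro _ ⟨y, hy, rfl⟩
    have hy : (N (y - x) : ℝ) ≤ r := hy
    show N (y - x) ≤ ⌈r⌉₊
    exact_mod_cast le_trans hy (Nat.le_ceil r)
  · exact E.bijective.comp F.bijective
  · intro δ _
    have hfin : (⋃ s ∈ {s : G | dist 1 s ≤ δ},
        (fun a => (N (E a) : ℝ)) '' Set.range fun x => F (x * s) - F x).Finite :=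
      (hprop 1 δ).biUnion fun s _ => (hF1 s).image _
    obtain ⟨ε, hε⟩ := hfin.bddAbove
    refine ⟨max ε 0, le_max_right _ _, fun x y hxy => le_max_of_le_left (hε ?_)⟩
    refine Set.mem_biUnion (x := x⁻¹ * y) ?_ ⟨_, ⟨x, rfl⟩, ?_⟩
    · show dist 1 (x⁻¹ * y) ≤ δ
      rw [← hinv x]; simpa using hxy
    · show (N (E (F (x * (x⁻¹ * y)) - F x)) : ℝ) = N (E (F y) - E (F x))
      rw [mul_inv_cancel_left, hsub]
  · intro δ _
    have hfin : (⋃ a ∈ {a | N (E a) ≤ ⌈δ⌉₊},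
        (fun s => dist 1 s) '' Set.range fun y => (F.symm y)⁻¹ * F.symm (y + a)).Finite :=
      ((nfin ⌈δ⌉₊).preimage E.injective.injOn).biUnion fun a _ => (hF2 a).image _
    obtain ⟨ε, hε⟩ := hfin.bddAbove
    refine ⟨max ε 0, le_max_right _ _, fun x y hxy => le_max_of_le_left (hε ?_)⟩
    refine Set.mem_biUnion (x := F y - F x) ?_ ⟨_, ⟨F x, rfl⟩, ?_⟩
    · show N (E (F y - F x)) ≤ ⌈δ⌉₊
      rw [hsub]
      have hxy : (N (E (F y) - E (F x)) : ℝ) ≤ δ := hxy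
      exact_mod_cast le_trans hxy (Nat.le_ceil δ)
    · simp only [Equiv.symm_apply_apply, add_sub_cancel]
      rw [← hinv x]; simp
end
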